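/- Fix ρ ∈ (0,1), let h₀ := 1/(1+√ρ), c₀ := √(1−ρ)/(1+√ρ), and λ₁ := √(3(1+√ρ)⁴/(4√ρ(ρ − √ρ + 1))). Then there exist ε₀ > 0 and C > 0 such that for every ε with 0 < |ε| < ε₀, setting h := h₀ + ε, there exists a bore with upstream depth h, Froude number c = c₀, density ratio ρ and vorticity ω = 0, i.e. a C² function η : ℝ → ℝ with 0 < h + η(x) < 1 and stream functions ψ₁ ∈ C²(Ω₁), ψ₂ ∈ C²(Ω₂), with Δψ₁ = Δψ₂ = 0 in the respective interiors, ψ₁(x,0) = c₀h, ψ₁ = ψ₂ = 0 on the interface Y = h + η(x), ψ₂(x,1) = −c₀(1−h), and (ρ/2)|∇ψ₂|² − (1/2)|∇ψ₁|² + (ρ−1)η = (ρ−1)c₀²/2 on the interface, satisfying: (i) |η(x) + ε(1 + tanh(λ₁|ε|x))/2| ≤ Cε² for all x; (ii) η(x) → 0 as x → −∞ and η(x) → −ε as x → +∞ (so the exact downstream depth of the lower layer is h₀); (iii) ∇ψ₁(x,Y) → (0, −c₀) and ∇ψ₂(x,Y) → (0, −c₀) uniformly as x → −∞. -/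

import Mathlib

open Real Set Filter

/-- Partial derivative in the first (horizontal) variable. -/
noncomputable def pdx (u : ℝ × ℝ → ℝ) (p : ℝ × ℝ) : ℝ :=
  deriv (fun t => u (t, p.2)) p.1

/-- Partial derivative in the second (vertical) variable. -/
noncomputable def pdy (u : ℝ × ℝ → ℝ) (p : ℝ × ℝ) : ℝ :=
  deriv (fun t => u (p.1, t)) p.2

open Real Set Filter
namespace Bore
noncomputable section
section
abbrev II := Icc (-1 : ℝ) 1
def E := C(II, ℂ)
instance : NormedCommRing E := inferInstanceAs (NormedCommRing C(II, ℂ))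
instance : NormedAlgebra ℂ E := inferInstanceAs (NormedAlgebra ℂ C(II, ℂ))
instance : CompleteSpace E := inferInstanceAs (CompleteSpace C(II, ℂ))
instance : FunLike E II ℂ := inferInstanceAs (FunLike C(II, ℂ) II ℂ)
def mkE (f : II → ℂ) (h : Continuous f) : E := (⟨f, h⟩ : C(II, ℂ))
@[simp] lemma mkE_apply (f : II → ℂ) (h : Continuous f) (s : II) : mkE f h s = f s := rfl
@[ext] lemma E.ext {e f : E} (h : ∀ s, e s = f s) : e = f := ContinuousMap.ext h
lemma E.cont (e : E) : Continuous (fun s => e s) := ContinuousMap.continuous e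
lemma E.norm_le {e : E} {C : ℝ} (hC : 0 ≤ C) (h : ∀ s, ‖e s‖ ≤ C) : ‖e‖ ≤ C :=
  (ContinuousMap.norm_le (f := (e : C(II, ℂ))) hC).2 h
lemma E.le_norm (e : E) (s : II) : ‖e s‖ ≤ ‖e‖ := ContinuousMap.norm_coe_le_norm (e : C(II, ℂ)) s
@[simp] lemma E.add_apply (e f : E) (s : II) : (e + f) s = e s + f s := rfl
@[simp] lemma E.sub_apply (e f : E) (s : II) : (e - f) s = e s - f s := rfl
@[simp] lemma E.neg_apply (e : E) (s : II) : (-e) s = -e s := rfl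
@[simp] lemma E.mul_apply (e f : E) (s : II) : (e * f) s = e s * f s := rfl
@[simp] lemma E.smul_apply (c : ℂ) (e : E) (s : II) : (c • e) s = c * e s := rfl
@[simp] lemma E.rsmul_apply (c : ℝ) (e : E) (s : II) : (c • e) s = c * e s := rfl
@[simp] lemma E.zero_apply (s : II) : (0 : E) s = 0 := rfl
@[simp] lemma E.one_apply (s : II) : (1 : E) s = 1 := rfl
def evalE (s : II) : E →L[ℂ] ℂ :=
  LinearMap.mkContinuous ⟨⟨fun e => e s, fun _ _ => rfl⟩, fun _ _ => rfl⟩ 1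
    (fun e => by rw [one_mul]; exact e.le_norm s)
@[simp] lemma evalE_apply (s : II) (e : E) : evalE s e = e s := rfl
lemma mone_le : (-1 : ℝ) ≤ 1 := by norm_num
def pm1 : II := ⟨-1, by norm_num⟩
def p1 : II := ⟨1, by norm_num⟩
def ext (e : E) (t : ℝ) : ℂ := e (projIcc (-1) 1 mone_le t)
@[fun_prop] lemma ext_cont (e : E) : Continuous (ext e) :=
  e.cont.comp continuous_projIcc
lemma ext_of_mem e {t} (h : t ∈ Icc (-1 : ℝ) 1) : ext e t = e ⟨t, h⟩ := by
  simp [ext, projIcc_of_mem _ h]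
@[simp] lemma ext_coe (e : E) (s : II) : ext e s = e s := ext_of_mem e s.2
lemma ext_norm (e : E) (t : ℝ) : ‖ext e t‖ ≤ ‖e‖ := e.le_norm _
@[simp] lemma ext_add (e f : E) (t : ℝ) : ext (e + f) t = ext e t + ext f t := rfl
@[simp] lemma ext_sub (e f : E) (t : ℝ) : ext (e - f) t = ext e t - ext f t := rfl
@[simp] lemma ext_mul (e f : E) (t : ℝ) : ext (e * f) t = ext e t * ext f t := rfl
@[simp] lemma ext_smul (c : ℂ) (e : E) (t : ℝ) : ext (c • e) t = c * ext e t := rfl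
lemma ext_ii e a b : IntervalIntegrable (ext e) MeasureTheory.volume a b :=
  (ext_cont e).intervalIntegrable a b
def Jfun (e : E) : E := mkE (fun s => ∫ t in (-1 : ℝ)..s, ext e t) (by
    have : Continuous fun x : ℝ => ∫ t in (-1 : ℝ)..x, ext e t :=
      intervalIntegral.continuous_primitive (fun a b => ext_ii e a b) _
    exact this.comp continuous_subtype_val)
def Jop : E →L[ℂ] E :=
  LinearMap.mkContinuous
    { toFun := Jfun
      map_add' := by
        intro e f; ext s
        simp only [Jfun, mkE_apply, E.add_apply, ext_add]
        exact intervalIntegral.integral_add (ext_ii e _ _) (ext_ii f _ _)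
      map_smul' := by
        intro c e; ext s
        simp only [Jfun, mkE_apply, E.smul_apply, ext_smul, RingHom.id_apply]
        exact intervalIntegral.integral_const_mul _ _ }
    2 (by
      intro e
      refine E.norm_le (by positivity) fun s => ?_
      have := intervalIntegral.norm_integral_le_of_norm_le_const (a := -1) (b := (s : ℝ)) (f := ext e)
        (C := ‖e‖) (fun t _ => ext_norm e t)
      refine this.trans ?_
      rw [mul_comm]
      refine mul_le_mul_of_nonneg_right ?_ (norm_nonneg _)
      have := s.2.1; have := s.2.2
      rw [abs_le]; constructor <;> linarith)
lemma Jop_apply e (s : II) : Jop e s = ∫ t in (-1 : ℝ)..s, ext e t := rfl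
lemma Jop_norm e : ‖Jop e‖ ≤ 2 * ‖e‖ :=
  (Jop.le_opNorm e).trans (mul_le_mul_of_nonneg_right
    (LinearMap.mkContinuous_norm_le _ (by norm_num) _) (norm_nonneg _))
def cst : ℂ →L[ℂ] E := ContinuousLinearMap.toSpanSingleton ℂ (1 : E)
@[simp] lemma cst_apply (z : ℂ) (s : II) : cst z s = z := by simp [cst]
lemma cst_norm (z : ℂ) : ‖cst z‖ ≤ ‖z‖ :=
  E.norm_le (norm_nonneg _) fun s => by simp
def at1 : E →L[ℂ] ℂ := evalE p1
def atm1 : E →L[ℂ] ℂ := evalE pm1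
@[simp] lemma at1_apply (e : E) : at1 e = e p1 := rfl
@[simp] lemma atm1_apply (e : E) : atm1 e = e pm1 := rfl
def meanE : E →L[ℂ] E := cst ∘L ((1 / 2 : ℂ) • (at1 ∘L Jop))
def c1 : E →L[ℂ] E := cst ∘L atm1
def trE : E →L[ℂ] E := cst ∘L ((1 / 2 : ℂ) • (at1 + atm1))
@[simp] lemma meanE_apply (e : E) (s : II) : meanE e s = (1 / 2) * Jop e p1 := by simp [meanE]
@[simp] lemma c1_apply (e : E) (s : II) : c1 e s = e pm1 := by simp [c1]
@[simp] lemma trE_apply (e : E) (s : II) : trE e s = (1 / 2) * (e p1 + e pm1) := by simp [trE]; ring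
@[simp] lemma Jop_m1 (e : E) : Jop e pm1 = 0 := by simp [Jop_apply, pm1]
lemma meanE_norm (e : E) : ‖meanE e‖ ≤ ‖e‖ := by
  refine E.norm_le (norm_nonneg _) fun s => ?_
  rw [meanE_apply, norm_mul]
  have := ((Jop e).le_norm p1).trans (Jop_norm e)
  have h2 : ‖(1 / 2 : ℂ)‖ = 1 / 2 := by simp
  rw [h2]; linarith
lemma trE_norm (e : E) : ‖trE e‖ ≤ ‖e‖ := by
  refine E.norm_le (norm_nonneg _) fun s => ?_
  rw [trE_apply, norm_mul]
  have h2 : ‖(1 / 2 : ℂ)‖ = 1 / 2 := by simp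
  rw [h2]
  have := norm_add_le (e p1) (e pm1)
  have := e.le_norm p1
  have := e.le_norm pm1
  linarith
lemma Jop_cst z (s : II) : Jop (cst z) s = (s + 1) * z := by
  rw [Jop_apply]
  have : ext (cst z) = fun _ => z := by funext t; simp [ext]
  rw [this]; simp
lemma meanE_cst z : meanE (cst z) = cst z := by
  ext s; rw [meanE_apply, Jop_cst]; simp [p1]; ring
lemma meanE_eq e : meanE e = cst ((1 / 2) * Jop e p1) := by ext s; simp
lemma meanE_meanE e : meanE (meanE e) = meanE e := by
  rw [meanE_eq e, meanE_cst]
lemma c1_cst z : c1 (cst z) = cst z := by ext s; simp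
lemma c1_meanE e : c1 (meanE e) = meanE e := by rw [meanE_eq e, c1_cst]
lemma trE_cst z : trE (cst z) = cst z := by ext s; simp; ring
lemma trE_meanE e : trE (meanE e) = meanE e := by rw [meanE_eq e, trE_cst]
lemma c1_Jop e : c1 (Jop e) = 0 := by ext s; simp
lemma J_of_deriv {f f' : ℝ → ℂ} {e} (hf : ∀ t, HasDerivAt f (f' t) t)
    (he : ∀ s : II, e s = f' s) (s : II) (hc : Continuous f') : Jop e s = f s - f (-1) := by
  rw [Jop_apply, ← intervalIntegral.integral_eq_sub_of_hasDerivAt (fun t _ => hf t)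
    (hc.intervalIntegrable _ _)]
  refine intervalIntegral.integral_congr fun t ht => ?_
  rw [uIcc_of_le s.2.1] at ht
  have h : t ∈ Icc (-1 : ℝ) 1 := ⟨ht.1, ht.2.trans s.2.2⟩
  rw [ext_of_mem e h, he]
def Sol (α : ℝ) (e u : E) : Prop :=
  meanE u = 0 ∧ u - c1 u = Jop (e - meanE e - (α : ℂ) • u)
lemma Sol.add {α} {e u e' u'} (h : Sol α e u) (h' : Sol α e' u') :
    Sol α (e + e') (u + u') := by
  refine ⟨by rw [map_add, h.1, h'.1, add_zero], ?_⟩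
  have : e + e' - meanE (e + e') - (α : ℂ) • (u + u')
      = (e - meanE e - (α : ℂ) • u) + (e' - meanE e' - (α : ℂ) • u') := by
    rw [map_add, smul_add]; abel
  rw [this, map_add Jop, ← h.2, ← h'.2, map_add]; abel
lemma Sol.smul {α : ℝ} {e u : E} (c : ℂ) (h : Sol α e u) : Sol α (c • e) (c • u) := by
  refine ⟨by rw [map_smul, h.1, smul_zero], ?_⟩
  have : c • e - meanE (c • e) - (α : ℂ) • (c • u) = c • (e - meanE e - (α : ℂ) • u) := by
    rw [map_smul, smul_sub, smul_sub, smul_comm c]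
  rw [this, map_smul Jop, ← h.2, map_smul, smul_sub]
lemma Sol.sub {α : ℝ} {e u e' u' : E} (h : Sol α e u) (h' : Sol α e' u') :
    Sol α (e - e') (u - u') := by
  have := h.add (h'.smul (-1))
  simpa [sub_eq_add_neg] using this
lemma Sol.per {α} {e u} (h : Sol α e u) : u p1 = u pm1 := by
  have h1 : Jop (e - meanE e - (α : ℂ) • u) p1 = 0 := by
    have h3 : Jop u p1 = 0 := by
      have := congrArg (fun v : E => v p1) h.1
      simpa using this
    have h4 := Jop_cst ((1 / 2) * Jop e p1) p1
    rw [map_sub, map_sub, map_smul, meanE_eq]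
    simp only [E.sub_apply, E.smul_apply, h3, h4]
    simp [p1]; ring
  have h2 := congrArg (fun v : E => v p1) h.2
  simp only [E.sub_apply, c1_apply, h1] at h2
  exact sub_eq_zero.1 h2
lemma maxd {φ} {t₀ d y} (hm : IsMaxOn φ (Icc (-1) 1) t₀) (ht : t₀ ∈ Icc (-1 : ℝ) 1)
    (hd : HasDerivAt φ d t₀) (hy : y ∈ Icc (-1 : ℝ) 1) : d * (y - t₀) ≤ 0 := by
  have h1 := hm.localize.hasFDerivWithinAt_nonpos (y := y - t₀) hd.hasFDerivAt.hasFDerivWithinAt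
    (sub_mem_posTangentConeAt_of_segment_subset ((convex_Icc _ _).segment_subset ht hy))
  simpa [mul_comm] using h1
lemma Sol.bound1 {α : ℝ} {e u : E} (h : Sol α e u) : |α| * ‖u‖ ≤ 2 * ‖e‖ := by
  rcases eq_or_ne α 0 with rfl | hα
  · simp
  set g : E := e - meanE e with hg
  have hgn : ‖g‖ ≤ 2 * ‖e‖ := by
    have := norm_sub_le e (meanE e); have := meanE_norm e; linarith
  set hh : E := g - (α : ℂ) • u with hhh
  let U : ℝ → ℂ := fun t => u pm1 + ∫ τ in (-1 : ℝ)..t, ext hh τ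
  have hU : ∀ s : II, U s = u s := by
    intro s
    have h2 := congrArg (fun v : E => v s) h.2
    simp only [E.sub_apply, c1_apply, Jop_apply] at h2
    simp only [U]; rw [← h2]; ring
  have hdU : ∀ t, HasDerivAt U (ext hh t) t := fun t => by
    have := ((ext_cont hh).integral_hasStrictDerivAt (-1) t).hasDerivAt
    exact this.const_add _
  let φ : ℝ → ℝ := fun t => ‖U t‖ ^ 2
  have hφ : ∀ t, HasDerivAt φ (2 * (inner ℝ (U t) (ext hh t))) t := fun t => (hdU t).norm_sq
  have hφc : Continuous φ := continuous_iff_continuousAt.2 fun t => (hφ t).continuousAt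
  obtain ⟨t₁, ht₁, hm₁⟩ := isCompact_Icc.exists_isMaxOn (s := Icc (-1 : ℝ) 1) ⟨-1, by norm_num⟩
    hφc.continuousOn
  have hper : U 1 = U (-1) := by
    have := h.per
    rw [← hU, ← hU] at this; exact this
  have key : ∃ t₀ ∈ Icc (-1 : ℝ) 1, IsMaxOn φ (Icc (-1) 1) t₀ ∧
      0 ≤ α * (2 * (inner ℝ (U t₀) (ext hh t₀))) := by
    have hend : ∀ a b : ℝ, U a = U b → IsMaxOn φ (Icc (-1) 1) a → IsMaxOn φ (Icc (-1) 1) b := by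
      intro a b hab hm x hx
      have := hm hx
      simp only [φ, mem_ofPred_eq] at this ⊢
      rwa [← hab]
    rcases lt_or_gt_of_ne hα with hneg | hpos
    · have : ∃ t₀ ∈ Icc (-1 : ℝ) 1, IsMaxOn φ (Icc (-1) 1) t₀ ∧ t₀ < 1 := by
        by_cases h1 : t₁ = 1
        · subst h1; exact ⟨-1, by norm_num, hend _ _ hper hm₁, by norm_num⟩
        · exact ⟨t₁, ht₁, hm₁, lt_of_le_of_ne ht₁.2 h1⟩
      obtain ⟨t₀, h0, hm, hl⟩ := this
      refine ⟨t₀, h0, hm, ?_⟩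
      have := maxd hm h0 (hφ t₀) (y := 1) (by norm_num)
      have : 2 * (inner ℝ (U t₀) (ext hh t₀)) ≤ 0 := by
        by_contra hcon; push Not at hcon; nlinarith
      nlinarith
    · have : ∃ t₀ ∈ Icc (-1 : ℝ) 1, IsMaxOn φ (Icc (-1) 1) t₀ ∧ -1 < t₀ := by
        by_cases h1 : t₁ = -1
        · subst h1; exact ⟨1, by norm_num, hend _ _ hper.symm hm₁, by norm_num⟩
        · exact ⟨t₁, ht₁, hm₁, lt_of_le_of_ne ht₁.1 (Ne.symm h1)⟩
      obtain ⟨t₀, h0, hm, hl⟩ := this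
      refine ⟨t₀, h0, hm, ?_⟩
      have := maxd hm h0 (hφ t₀) (y := -1) (by norm_num)
      have : 0 ≤ 2 * (inner ℝ (U t₀) (ext hh t₀)) := by
        by_contra hcon; push Not at hcon; nlinarith
      nlinarith
  obtain ⟨t₀, h0, hm, hk⟩ := key
  have e1 : ext hh t₀ = ext g t₀ - α • U t₀ := by
    have h9 : U t₀ = u ⟨t₀, h0⟩ := hU ⟨t₀, h0⟩
    rw [ext_of_mem _ h0, ext_of_mem _ h0, h9]
    simp [hhh]
  rw [e1, inner_sub_right, inner_smul_right, real_inner_self_eq_norm_sq] at hk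
  have hb := abs_real_inner_le_norm (U t₀) (ext g t₀)
  have hgt := (ext_norm g t₀).trans hgn
  have h5 : |α| * ‖U t₀‖ ≤ 2 * ‖e‖ := by
    by_contra hcon
    push Not at hcon
    have hUpos : 0 < ‖U t₀‖ := by
      by_contra hz
      have : ‖U t₀‖ = 0 := le_antisymm (not_lt.1 hz) (norm_nonneg _)
      rw [this] at hcon; simp at hcon; linarith [norm_nonneg e]
    have h6 : α * inner ℝ (U t₀) (ext g t₀) ≤ |α| * (‖U t₀‖ * (2 * ‖e‖)) := by
      refine (le_abs_self _).trans ?_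
      rw [abs_mul]
      refine mul_le_mul_of_nonneg_left (hb.trans ?_) (abs_nonneg _)
      exact mul_le_mul_of_nonneg_left hgt (norm_nonneg _)
    have h7 : |α| * |α| = α * α := abs_mul_abs_self α
    have hα0 : 0 < |α| := abs_pos.2 hα
    have h8 : |α| * ‖U t₀‖ * (2 * ‖e‖) < |α| * ‖U t₀‖ * (|α| * ‖U t₀‖) :=
      mul_lt_mul_of_pos_left hcon (by positivity)
    nlinarith
  refine le_trans (mul_le_mul_of_nonneg_left ?_ (abs_nonneg _)) h5
  refine E.norm_le (norm_nonneg _) fun s => ?_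
  have := hm s.2
  simp only [φ, mem_ofPred_eq] at this
  rw [← hU s]
  exact (sq_le_sq₀ (norm_nonneg _) (norm_nonneg _)).1 this
lemma Sol.bound2 {α} {e u} (h : Sol α e u) : ‖u‖ ≤ 16 * ‖e‖ := by
  set hh : E := e - meanE e - (α : ℂ) • u with hhh
  have h1 : ‖hh‖ ≤ 4 * ‖e‖ := by
    have a1 := norm_sub_le (e - meanE e) ((α : ℂ) • u)
    have a2 := norm_sub_le e (meanE e); have := meanE_norm e
    have a3 := h.bound1
    have a4 : ‖(α : ℂ) • u‖ = |α| * ‖u‖ := by rw [norm_smul]; simp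
    linarith
  have h2 : u = c1 u + Jop hh := by rw [← h.2]; abel
  have h3 : c1 u = - meanE (Jop hh) := by
    have : meanE u = c1 u + meanE (Jop hh) := by
      conv_lhs => rw [h2]
      rw [map_add]
      have : c1 u = cst (u pm1) := by ext s; simp
      rw [this, meanE_cst]
    rw [h.1] at this
    exact eq_neg_of_add_eq_zero_left this.symm
  have h4 : u = Jop hh - meanE (Jop hh) := by
    conv_lhs => rw [h2, h3]
    abel
  rw [h4]
  have := norm_sub_le (Jop hh) (meanE (Jop hh))
  have := meanE_norm (Jop hh)
  have := Jop_norm hh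
  linarith
lemma Sol.unique {α} {e u u'} (h : Sol α e u) (h' : Sol α e u') : u = u' := by
  have := (h.sub h').bound2
  simp at this
  exact sub_eq_zero.1 this
def expE (α : ℝ) : E := mkE (fun s => Complex.exp (α * (s : ℝ))) (by fun_prop)
lemma Sol.exists (α : ℝ) (e : E) : ∃ u, Sol α e u := by
  rcases eq_or_ne α 0 with rfl | hα
  · refine ⟨Jop (e - meanE e) - meanE (Jop (e - meanE e)), ?_, ?_⟩
    · rw [map_sub, meanE_meanE, sub_self]
    · rw [map_sub c1, c1_meanE, c1_Jop]; simp only [Complex.ofReal_zero, zero_smul, sub_zero]; abel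
  set g : E := e - meanE e with hg
  let W : ℝ → ℂ := fun t => ∫ τ in (-1 : ℝ)..t, Complex.exp (α * τ) * ext g τ
  have hW : ∀ t : ℝ, HasDerivAt W (Complex.exp (α * t) * ext g t) t := fun t => by
    have hc : Continuous fun τ : ℝ => Complex.exp (α * τ) * ext g τ := by fun_prop
    exact (hc.integral_hasStrictDerivAt (-1) t).hasDerivAt
  let q : ℂ := Complex.exp (-α) * W 1 / (Complex.exp α - Complex.exp (-α))
  have hq : Complex.exp (-α) * (W 1 + q) = Complex.exp α * q := by
    have : Complex.exp α - Complex.exp (-α) ≠ 0 := by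
      rw [sub_ne_zero]
      have h1 : Complex.exp (α : ℂ) = ((Real.exp α : ℝ) : ℂ) := by simp
      have h2 : Complex.exp (-α : ℂ) = ((Real.exp (-α) : ℝ) : ℂ) := by simp
      rw [h1, h2]
      intro h
      have := Real.exp_injective (Complex.ofReal_injective h)
      exact hα (by linarith)
    simp only [q]; field_simp; ring
  let U : ℝ → ℂ := fun t => Complex.exp (-(α * t)) * (W t + q)
  have hU : ∀ t : ℝ, HasDerivAt U (ext g t - α * U t) t := fun t => by
    have h1 : HasDerivAt (fun t : ℝ => Complex.exp (-(α * t))) (Complex.exp (-(α * t)) * (-α)) t := by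
      have h0 : HasDerivAt (fun t : ℝ => (-(α * t) : ℂ)) (-α) t := by
        have := ((Complex.ofRealCLM.hasDerivAt (x := t)).const_mul (α : ℂ)).neg
        simp only [Complex.ofRealCLM_apply, Complex.ofReal_one, mul_one] at this
        exact this
      exact h0.cexp
    refine (h1.mul ((hW t).add_const q)).congr_deriv ?_
    have : Complex.exp (-(α * t)) * Complex.exp (α * t) = 1 := by
      rw [← Complex.exp_add]; simp
    simp only [U]
    linear_combination (ext g t) * this
  have hUc : Continuous U := continuous_iff_continuousAt.2 fun t => (hU t).continuousAt
  let u : E := mkE (fun s => U s) (hUc.comp continuous_subtype_val)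
  have hJ : u - c1 u = Jop (g - (α : ℂ) • u) := by
    ext s
    rw [J_of_deriv (f := U) (f' := fun t => ext g t - α * U t) hU (fun s => by simp [u]) s (by fun_prop)]
    simp [u, pm1]
  refine ⟨u, ?_, hJ⟩
  have hg0 : Jop g p1 = 0 := by
    rw [hg, map_sub, meanE_eq]
    simp only [E.sub_apply, Jop_cst]; simp [p1]; ring
  have h2 := congrArg (fun v : E => v p1) hJ
  have h3 : u p1 = u pm1 := by
    have : W (-1) = 0 := by simp [W]
    simp only [u, p1, pm1, mkE_apply, U, this]
    simpa using hq
  rw [map_sub, map_smul] at h2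
  simp only [E.sub_apply, c1_apply, h3, E.smul_apply, hg0] at h2
  have h4 : Jop u p1 = 0 := by
    have : (α : ℂ) ≠ 0 := by exact_mod_cast hα
    simpa [this] using h2
  ext s; simp [h4]
def Sop (α : ℝ) : E →L[ℂ] E :=
  LinearMap.mkContinuous
    { toFun := fun e => (Sol.exists α e).choose
      map_add' := fun e f => Sol.unique (Sol.exists α (e + f)).choose_spec
        ((Sol.exists α e).choose_spec.add (Sol.exists α f).choose_spec)
      map_smul' := fun c e => Sol.unique (Sol.exists α (c • e)).choose_spec
        ((Sol.exists α e).choose_spec.smul c) }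
    16 (fun e => (Sol.exists α e).choose_spec.bound2)
lemma Sop_sol α e : Sol α e (Sop α e) := (Sol.exists α e).choose_spec
lemma Sop_eq {α} {e u} (h : Sol α e u) : Sop α e = u := (Sop_sol α e).unique h
lemma Sop_norm α : ‖Sop α‖ ≤ 16 := LinearMap.mkContinuous_norm_le _ (by norm_num) _
lemma Sop_norm1 α : |α| * ‖Sop α‖ ≤ 2 := by
  rcases eq_or_ne α 0 with rfl | hα
  · simp
  have h0 := abs_pos.2 hα
  have : ‖Sop α‖ ≤ 2 / |α| := by
    refine ContinuousLinearMap.opNorm_le_bound _ (by positivity) fun e => ?_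
    have := (Sop_sol α e).bound1
    rw [div_mul_eq_mul_div, le_div_iff₀ h0]; linarith
  rwa [le_div_iff₀ h0, mul_comm] at this
lemma Sop_resolvent α β : Sop α - Sop β = ((β - α : ℝ) : ℂ) • (Sop α ∘L Sop β) := by
  ext1 e
  have h1 := Sop_sol α e
  have h2 := Sop_sol β e
  have h3 := Sop_sol α (Sop β e)
  simp only [_root_.sub_apply, _root_.smul_apply,
    ContinuousLinearMap.comp_apply]
  have h4 : Sol α e (Sop β e + ((β - α : ℝ) : ℂ) • Sop α (Sop β e)) := by
    refine ⟨by rw [map_add, map_smul, h2.1, h3.1]; simp, ?_⟩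
    rw [map_add, map_smul]
    have e1 : Sop β e + ((β - α : ℝ) : ℂ) • Sop α (Sop β e) -
      (c1 (Sop β e) + ((β - α : ℝ) : ℂ) • c1 (Sop α (Sop β e))) =
      (Sop β e - c1 (Sop β e)) + ((β - α : ℝ) : ℂ) • (Sop α (Sop β e) - c1 (Sop α (Sop β e))) := by
      rw [smul_sub]; abel
    rw [e1, h2.2, h3.2, h2.1, ← map_smul Jop, ← map_add Jop]
    congr 1
    ext s
    simp
    ring
  rw [h1.unique h4]; abel
lemma Sop_lip α β : ‖Sop α - Sop β‖ ≤ 256 * |α - β| := by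
  rw [Sop_resolvent, norm_smul, Complex.norm_real, norm_eq_abs, abs_sub_comm]
  have h1 := Sop_norm α; have h2 := Sop_norm β
  have h3 := (Sop α).opNorm_comp_le (Sop β)
  have : ‖Sop α ∘L Sop β‖ ≤ 256 := h3.trans (by nlinarith [norm_nonneg (Sop α), norm_nonneg (Sop β)])
  nlinarith [abs_nonneg (α - β)]
lemma Sop_cont : Continuous Sop := by
  have : LipschitzWith 256 Sop := LipschitzWith.of_dist_le_mul fun a b => by
    rw [dist_eq_norm, Real.dist_eq]; exact Sop_lip a b
  exact this.continuous
def negII (s : II) : II := ⟨-s, by have := s.2; simp only [mem_Icc] at *; constructor <;> linarith⟩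
lemma negII_cont : Continuous negII := (continuous_subtype_val.neg).subtype_mk _
def theta (e : E) : E := mkE (fun s => star (e (negII s))) (continuous_star.comp (e.cont.comp negII_cont))
@[simp] lemma theta_apply (e : E) (s : II) : theta e s = star (e (negII s)) := rfl
end
section
lemma p1_neg : negII p1 = pm1 := rfl
lemma pm1_neg : negII pm1 = p1 := by apply Subtype.ext; simp [negII, pm1, p1]
lemma negII_negII (s : II) : negII (negII s) = s := by apply Subtype.ext; simp [negII]
@[simp] lemma theta_theta (e : E) : theta (theta e) = e := by ext s; simp [negII_negII]
@[simp] lemma theta_add (e f : E) : theta (e + f) = theta e + theta f := by ext s; simp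
@[simp] lemma theta_sub (e f : E) : theta (e - f) = theta e - theta f := by ext s; simp
@[simp] lemma theta_neg (e : E) : theta (-e) = -theta e := by ext s; simp
@[simp] lemma theta_mul (e f : E) : theta (e * f) = theta e * theta f := by ext s; simp
@[simp] lemma theta_smul (c : ℂ) (e : E) : theta (c • e) = (star c) • theta e := by ext s; simp
@[simp] lemma theta_zero : theta 0 = 0 := by ext s; simp
@[simp] lemma theta_one : theta 1 = 1 := by ext s; simp
@[simp] lemma theta_cst (z : ℂ) : theta (cst z) = cst (star z) := by ext s; simp
lemma theta_norm (e : E) : ‖theta e‖ = ‖e‖ := by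
  have h : ∀ e : E, ‖theta e‖ ≤ ‖e‖ := fun e => E.norm_le (norm_nonneg _) fun s => by
    rw [theta_apply, norm_star]; exact e.le_norm _
  exact le_antisymm (h e) (by simpa using h (theta e))
lemma Jop_theta e (s : II) : Jop (theta e) s = star (Jop e p1 - Jop e (negII s)) := by
  have h1 : Jop e p1 - Jop e (negII s) = ∫ t in (-s : ℝ)..1, ext e t := by
    simp only [Jop_apply, p1, negII]
    rw [intervalIntegral.integral_interval_sub_left (ext_ii _ _ _) (ext_ii _ _ _)]
  rw [h1, Jop_apply]
  have h2 := intervalIntegral.integral_comp_neg (f := ext e) (a := -1) (b := (s : ℝ))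
  rw [neg_neg] at h2
  rw [← h2]
  have h3 : ∀ t, ext (theta e) t = (starRingEnd ℂ) (ext e (-t)) := by
    intro t
    simp only [ext, theta_apply]
    congr 2
    apply Subtype.ext
    simp only [negII, coe_projIcc]
    rcases le_total t 1 with h | h <;> rcases le_total (-1) t with h' | h'
    · rw [min_eq_right h, max_eq_right h', min_eq_right (by linarith), max_eq_right (by linarith)]
    · rw [min_eq_right h, max_eq_left h', min_eq_left (by linarith), max_eq_right (by linarith)]; simp
    · rw [min_eq_left h, max_eq_right (by linarith), min_eq_right (by linarith), max_eq_left (by linarith)]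
    · linarith
  simp_rw [h3]
  rw [intervalIntegral.integral_of_le (by linarith [s.2.1]),
    intervalIntegral.integral_of_le (by linarith [s.2.1]), integral_conj]
  rfl
lemma meanE_theta e : meanE (theta e) = theta (meanE e) := by
  ext s
  rw [theta_apply, meanE_apply, meanE_apply, Jop_theta, p1_neg]
  simp
lemma trE_theta e : trE (theta e) = theta (trE e) := by
  ext s
  rw [theta_apply, trE_apply, trE_apply, theta_apply, theta_apply, p1_neg, pm1_neg]
  simp; ring
lemma Sop_theta α e : theta (Sop α e) = - Sop (-α) (theta e) := by
  have h := Sop_sol α e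
  have : Sol (-α) (theta e) (-theta (Sop α e)) := by
    set u := Sop α e
    refine ⟨by rw [map_neg, meanE_theta, h.1]; simp, ?_⟩
    have e1 : theta e - meanE (theta e) - ((-α : ℝ) : ℂ) • (-theta u)
        = theta (e - meanE e - (α : ℂ) • u) := by
      rw [meanE_theta]; ext s; simp
    rw [e1]
    ext s
    have hp := h.per
    rw [Jop_theta, ← h.2]
    simp only [E.sub_apply, E.neg_apply, theta_apply, c1_apply, pm1_neg]
    rw [hp]; simp; ring
  rw [Sop_eq this, neg_neg]
def sE : E := mkE (fun s => ((s : ℝ) : ℂ)) (by fun_prop)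
def isE : E := Complex.I • sE
@[simp] lemma sE_apply (s : II) : sE s = ((s : ℝ) : ℂ) := rfl
@[simp] lemma isE_apply (s : II) : isE s = Complex.I * ((s : ℝ) : ℂ) := rfl
@[simp] lemma theta_isE : theta isE = isE := by
  ext s; simp [negII]
lemma sE_norm : ‖sE‖ ≤ 1 := E.norm_le (by norm_num) fun s => by
  simp only [sE_apply, Complex.norm_real, norm_eq_abs]; exact abs_le.2 s.2
lemma isE_norm : ‖isE‖ ≤ 1 := by rw [isE, norm_smul, Complex.norm_I, one_mul]; exact sE_norm
lemma meanE_sE : meanE sE = 0 := by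
  ext s
  rw [meanE_apply, J_of_deriv (f := fun t => (t : ℂ) ^ 2 / 2) (f' := fun t => (t : ℂ)) (e := sE) _
    (fun s => rfl) p1 (by fun_prop)]
  · simp [p1]
  · intro t
    have := ((Complex.ofRealCLM.hasDerivAt (x := t)).pow 2).div_const 2
    refine this.congr_deriv ?_
    simp
def dR (α : ℝ) : ℝ := if α = 0 then 1 / 3 else (α * cosh α - sinh α) / (α ^ 2 * sinh α)
lemma Sop_sE_p1 (α : ℝ) : Sop α sE p1 = dR α := by
  unfold dR
  split_ifs with h
  · subst h
    have hd : ∀ t : ℝ, HasDerivAt (fun t : ℝ => (t : ℂ) ^ 2 / 2 - 1 / 6) (t : ℂ) t := by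
      intro t
      refine ((((Complex.ofRealCLM.hasDerivAt (x := t)).pow 2).div_const 2).sub_const (1 / 6)).congr_deriv ?_
      simp
    have hd3 : ∀ t : ℝ, HasDerivAt (fun t : ℝ => (t : ℂ) ^ 3 / 6 - t / 6) ((t : ℂ) ^ 2 / 2 - 1 / 6) t := by
      intro t
      refine ((((Complex.ofRealCLM.hasDerivAt (x := t)).pow 3).div_const 6).sub
        ((Complex.ofRealCLM.hasDerivAt (x := t)).div_const 6)).congr_deriv ?_
      simp; ring
    have : Sol 0 sE (mkE (fun s => ((s : ℝ) : ℂ) ^ 2 / 2 - 1 / 6) (by fun_prop)) := by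
      constructor
      · ext s
        rw [meanE_apply, J_of_deriv hd3 (fun s => rfl) p1 (by fun_prop)]
        simp [p1]; norm_num
      · rw [meanE_sE]
        ext s
        rw [J_of_deriv hd (fun s => by simp) s (by fun_prop)]
        simp [pm1]
    rw [Sop_eq this]; simp [p1]; norm_num
  · have hs : sinh α ≠ 0 := by rwa [Ne, Real.sinh_eq_zero]
    have hα : (α : ℂ) ≠ 0 := by exact_mod_cast h
    have hsc : (Complex.sinh α) ≠ 0 := by rw [← Complex.ofReal_sinh]; exact_mod_cast hs
    let U : ℝ → ℂ := fun t => t / α - 1 / α ^ 2 + Complex.exp (-(α * t)) / (α * Complex.sinh α)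
    have he : ∀ t : ℝ, HasDerivAt (fun t : ℝ => Complex.exp (-(α * t))) (Complex.exp (-(α * t)) * (-α)) t := by
      intro t
      have h0 : HasDerivAt (fun t : ℝ => (-(α * t) : ℂ)) (-α) t := by
        have := ((Complex.ofRealCLM.hasDerivAt (x := t)).const_mul (α : ℂ)).neg
        simp only [Complex.ofRealCLM_apply, Complex.ofReal_one, mul_one] at this
        exact this
      exact h0.cexp
    have hU : ∀ t : ℝ, HasDerivAt U ((t : ℂ) - α * U t) t := by
      intro t
      refine ((((Complex.ofRealCLM.hasDerivAt (x := t)).div_const (α : ℂ)).sub_const (1 / (α : ℂ) ^ 2)).add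
        ((he t).div_const (α * Complex.sinh α))).congr_deriv ?_
      simp only [U, Complex.ofRealCLM_apply, Complex.ofReal_one]; field_simp; ring
    have hUc : Continuous U := continuous_iff_continuousAt.2 fun t => (hU t).continuousAt
    let u : E := mkE (fun s => U s) (hUc.comp continuous_subtype_val)
    have hper : U 1 = U (-1) := by
      simp only [U]
      have := Complex.two_sinh (x := (α : ℂ))
      have h2 : Complex.exp (-(α * ((-1 : ℝ) : ℂ))) = Complex.exp (α : ℂ) := by simp
      have h3 : Complex.exp (-(α * ((1 : ℝ) : ℂ))) = Complex.exp (-α : ℂ) := by simp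
      rw [h2, h3]
      field_simp
      push_cast
      linear_combination (α : ℂ) * this
    have hJ : u - c1 u = Jop (sE - meanE sE - (α : ℂ) • u) := by
      rw [meanE_sE, sub_zero]
      ext s
      rw [J_of_deriv (f := U) (f' := fun t => (t : ℂ) - α * U t) hU (fun s => by simp [u]) s (by fun_prop)]
      simp [u, pm1]
    have hm : meanE u = 0 := by
      have h2 := congrArg (fun v : E => v p1) hJ
      have h5 : Jop sE p1 = 0 := by
        have := congrArg (fun v : E => v p1) meanE_sE
        simpa using this
      have h3 : u p1 = u pm1 := hper
      rw [map_sub, map_sub, meanE_sE, map_smul] at h2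
      simp only [E.sub_apply, c1_apply, h3, E.smul_apply, h5] at h2
      have h4 : Jop u p1 = 0 := by simpa [hα] using h2
      ext s; simp [h4]
    rw [Sop_eq ⟨hm, hJ⟩]
    show U 1 = _
    simp only [U]
    have h3 : Complex.exp (-(α * ((1 : ℝ) : ℂ))) = Complex.cosh α - Complex.sinh α := by
      rw [Complex.cosh_sub_sinh]; simp
    rw [h3]
    push_cast
    field_simp; ring
lemma trE_Sop α e : trE (Sop α e) = cst (Sop α e p1) := by
  ext s
  rw [trE_apply, ← (Sop_sol α e).per, cst_apply]; ring
lemma dR_lip (α β : ℝ) : |dR α - dR β| ≤ 256 * |α - β| := by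
  have : ‖(dR α : ℂ) - dR β‖ ≤ 256 * |α - β| := by
    rw [← Sop_sE_p1, ← Sop_sE_p1]
    have h1 := E.le_norm ((Sop α - Sop β) sE) p1
    have h2 := ((Sop α - Sop β).le_opNorm sE)
    have h3 := Sop_lip α β
    have := sE_norm
    simp only [_root_.sub_apply, E.sub_apply] at h1 h2
    nlinarith [norm_nonneg (Sop α - Sop β)]
  rwa [← Complex.ofReal_sub, Complex.norm_real] at this
lemma dR_cont : Continuous dR := by
  have : LipschitzWith 256 dR := LipschitzWith.of_dist_le_mul fun a b => by
    rw [Real.dist_eq, Real.dist_eq]; exact dR_lip a b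
  exact this.continuous
lemma dR_zero : dR 0 = 1 / 3 := by simp [dR]
lemma dR_neg α : dR (-α) = dR α := by
  unfold dR; simp only [neg_eq_zero]; split_ifs
  · rfl
  · rw [cosh_neg, sinh_neg]
    rw [show -α * cosh α - -sinh α = -(α * cosh α - sinh α) by ring,
      show (-α) ^ 2 * -sinh α = -(α ^ 2 * sinh α) by ring, neg_div_neg_eq]
lemma acosh_ge {α} (h : 0 ≤ α) : α ^ 3 / 3 ≤ α * cosh α - sinh α := by
  have hd : ∀ x : ℝ, HasDerivAt (fun x => x * cosh x - sinh x - x ^ 3 / 3) (x * sinh x - x ^ 2) x := by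
    intro x
    have := (((hasDerivAt_id x).mul (hasDerivAt_cosh x)).sub (hasDerivAt_sinh x)).sub
      (((hasDerivAt_id x).pow 3).div_const 3)
    refine this.congr_deriv ?_
    simp
  have hm : MonotoneOn (fun x => x * cosh x - sinh x - x ^ 3 / 3) (Ici 0) := by
    refine monotoneOn_of_deriv_nonneg (convex_Ici 0)
      (continuous_iff_continuousAt.2 fun x => (hd x).continuousAt).continuousOn
      (fun x _ => (hd x).differentiableAt.differentiableWithinAt) fun x hx => ?_
    rw [interior_Ici] at hx
    rw [(hd x).deriv]
    have : x ≤ sinh x := self_le_sinh_iff.2 (le_of_lt hx)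
    have hx' : 0 < x := hx
    nlinarith
  have := hm (mem_Ici.2 le_rfl) (mem_Ici.2 h) h
  simp at this
  linarith
def dlow : ℝ := 1 / (3 * cosh 2)
lemma dlow_pos : 0 < dlow := by unfold dlow; have := cosh_pos 2; positivity
lemma dR_low α : dlow ≤ (1 + |α|) * dR α := by
  have hcosh := one_le_cosh 2
  have hl : dlow ≤ 1 / 3 := by
    unfold dlow; apply one_div_le_one_div_of_le <;> linarith
  have main : ∀ α : ℝ, 0 < α → dlow ≤ (1 + α) * dR α := by
    intro α hα
    have hs : 0 < sinh α := sinh_pos_iff.2 hα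
    have e : dR α = (α * cosh α - sinh α) / (α ^ 2 * sinh α) := by simp [dR, hα.ne']
    rcases le_total α 2 with h2 | h2
    · have h3 := acosh_ge hα.le
      have h4 : dlow ≤ dR α := by
        rw [e, le_div_iff₀ (by positivity)]
        have h5 : sinh α ≤ α * cosh 2 := by
          have : cosh α ≤ cosh 2 := by rw [cosh_le_cosh, abs_of_pos hα, abs_of_pos two_pos]; exact h2
          have : 0 ≤ α ^ 3 / 3 := by positivity
          nlinarith
        calc dlow * (α ^ 2 * sinh α) ≤ dlow * (α ^ 2 * (α * cosh 2)) := by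
              have := dlow_pos; gcongr
          _ = α ^ 3 / 3 := by unfold dlow; field_simp
          _ ≤ _ := h3
      have := dlow_pos
      nlinarith
    · have h4 : 1 / (2 * α) ≤ dR α := by
        rw [e, div_le_div_iff₀ (by positivity) (by positivity)]
        have : sinh α ≤ cosh α := (sinh_lt_cosh α).le
        nlinarith [mul_nonneg hα.le (sub_nonneg.2 h2), mul_le_mul_of_nonneg_left this (by positivity : 0 ≤ 2 * α ^ 2), mul_nonneg (mul_nonneg hα.le hs.le) (sub_nonneg.2 h2)]
      calc dlow ≤ 1 / 2 := by linarith
        _ = α * (1 / (2 * α)) := by field_simp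
        _ ≤ (1 + α) * dR α := by
          have : 0 < 1 / (2 * α) := by positivity
          nlinarith
  rcases lt_trichotomy α 0 with h | h | h
  · rw [abs_of_neg h, ← dR_neg]; exact main _ (by linarith)
  · subst h; simp [dR]; linarith
  · rw [abs_of_pos h]; exact main _ h
lemma dR_pos α : 0 < dR α := by
  have := dR_low α; have := dlow_pos
  by_contra h; push Not at h
  nlinarith [abs_nonneg α]
lemma dR_le (α : ℝ) : dR α ≤ 16 := by
  have h1 := E.le_norm (Sop α sE) p1
  rw [Sop_sE_p1, Complex.norm_real, norm_eq_abs] at h1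
  have := (Sop α).le_opNorm sE
  have := Sop_norm α; have := sE_norm; have := le_abs_self (dR α)
  nlinarith [norm_nonneg (Sop α), norm_nonneg sE]
end
section
open MeasureTheory FourierTransform
abbrev L := Lp E 1 (volume : Measure ℝ)
def kk (κ : ℝ) : ℝ := -(2 * π * κ)
@[fun_prop] lemma kk_cont : Continuous kk := by unfold kk; fun_prop
lemma kk_neg κ : kk (-κ) = -kk κ := by unfold kk; ring
lemma kk_sub a b : kk (a - b) = kk a - kk b := by unfold kk; ring
abbrev Sym := ℝ → E →L[ℂ] E
def BCs (M : Sym) : Prop := Continuous M ∧ ∃ C, ∀ k, ‖M k‖ ≤ C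
lemma Lint (f : L) : Integrable f := L1.integrable_coeFn f
lemma sym_int {M} (h : BCs M) {f} (hf : Integrable f) :
    Integrable (fun κ => M (kk κ) (f κ)) := by
  obtain ⟨hc, C, hC⟩ := h
  refine (hf.norm.const_mul C).mono' ?_ (ae_of_all _ fun κ => ?_)
  · have h1 : AEStronglyMeasurable (fun κ => M (kk κ)) volume :=
      (hc.comp kk_cont).aestronglyMeasurable
    exact isBoundedBilinearMap_apply.continuous.comp_aestronglyMeasurable
      (h1.prodMk hf.aestronglyMeasurable)
  · exact ((M (kk κ)).le_opNorm _).trans (mul_le_mul_of_nonneg_right (hC _) (norm_nonneg _))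
lemma Lnorm (f : L) : ‖f‖ = ∫ κ, ‖f κ‖ := L1.norm_eq_integral_norm f
lemma toL1_norm {f : ℝ → E} (hf : Integrable f) : ‖hf.toL1 f‖ = ∫ κ, ‖f κ‖ := by
  rw [Lnorm]; refine integral_congr_ae ?_
  filter_upwards [hf.coeFn_toL1] with κ h; rw [h]
open Classical in
def op (M : Sym) : L →L[ℂ] L :=
  if h : BCs M then
    LinearMap.mkContinuous
      { toFun := fun f => (sym_int h (Lint f)).toL1 _
        map_add' := fun f g => by
          rw [← Integrable.toL1_add]
          apply (Integrable.toL1_eq_toL1_iff _ _ _ _).2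
          filter_upwards [Lp.coeFn_add f g] with κ hk
          simp only [hk, Pi.add_apply, map_add]
        map_smul' := fun c f => by
          rw [RingHom.id_apply, ← Integrable.toL1_smul]
          apply (Integrable.toL1_eq_toL1_iff _ _ _ _).2
          filter_upwards [Lp.coeFn_smul c f] with κ hk
          simp [hk] } h.2.choose
      (fun f => by
        rw [LinearMap.coe_mk, AddHom.coe_mk, toL1_norm, Lnorm, ← integral_const_mul]
        refine integral_mono (sym_int h (Lint f)).norm ((Lint f).norm.const_mul _) fun κ => ?_
        exact ((M (kk κ)).le_opNorm _).trans
          (mul_le_mul_of_nonneg_right (h.2.choose_spec _) (norm_nonneg _)))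
  else 0
lemma op_coe {M} (h : BCs M) (f : L) : (op M f : ℝ → E) =ᵐ[volume] fun κ => M (kk κ) (f κ) := by
  have : op M f = (sym_int h (Lint f)).toL1 _ := by
    unfold op; rw [dif_pos h]; rfl
  rw [this]; exact Integrable.coeFn_toL1 _
lemma op_norm_le {M} (hc : Continuous M) {C} (hC : ∀ k, ‖M k‖ ≤ C) : ‖op M‖ ≤ C := by
  have h : BCs M := ⟨hc, C, hC⟩
  refine ContinuousLinearMap.opNorm_le_bound _ ((norm_nonneg _).trans (hC 0)) fun f => ?_
  rw [Lnorm, Lnorm, ← integral_const_mul]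
  refine integral_mono_ae (Lint _).norm ((Lint f).norm.const_mul _) ?_
  filter_upwards [op_coe h f] with κ hk
  rw [hk]
  exact ((M (kk κ)).le_opNorm _).trans (mul_le_mul_of_nonneg_right (hC _) (norm_nonneg _))
def evs (M : Sym) (f : L) (X : ℝ) : E := 𝓕 (fun κ => M (kk κ) (f κ)) X
lemma evs_op {M N} (h : BCs N) (f : L) X :
    evs M (op N f) X = evs (fun k => M k ∘L N k) f X := by
  unfold evs
  rw [fourier_eq, fourier_eq]
  refine integral_congr_ae ?_
  filter_upwards [op_coe h f] with κ hk
  simp [hk]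
lemma fint {f : ℝ → E} (hf : Integrable f) (X : ℝ) :
    Integrable fun v : ℝ => (𝐞 (-(inner ℝ v X)) : Circle) • f v :=
  (Real.fourierIntegral_convergent_iff X).2 hf
lemma evs_add {M : Sym} (h : BCs M) (f g : L) (X : ℝ) : evs M (f + g) X = evs M f X + evs M g X := by
  unfold evs
  rw [fourier_eq, fourier_eq, fourier_eq, ← integral_add (fint (sym_int h (Lint f)) X) (fint (sym_int h (Lint g)) X)]
  refine integral_congr_ae ?_
  filter_upwards [Lp.coeFn_add f g] with κ hk
  simp only [hk, Pi.add_apply, map_add, smul_add]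
lemma evs_smul (M : Sym) (c : ℂ) (f : L) (X : ℝ) : evs M (c • f) X = c • evs M f X := by
  unfold evs
  rw [fourier_eq, fourier_eq, ← integral_smul]
  refine integral_congr_ae ?_
  filter_upwards [Lp.coeFn_smul c f] with κ hk
  simp only [hk, Pi.smul_apply, map_smul]
  rw [smul_comm]
lemma evs_add_sym {M N : Sym} (h : BCs M) (h' : BCs N) (f : L) (X : ℝ) :
    evs (fun k => M k + N k) f X = evs M f X + evs N f X := by
  unfold evs
  rw [fourier_eq, fourier_eq, fourier_eq, ← integral_add (fint (sym_int h (Lint f)) X) (fint (sym_int h' (Lint f)) X)]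
  refine integral_congr_ae (ae_of_all _ fun κ => ?_)
  simp
lemma evs_smul_sym {M : Sym} (c : ℂ) (f : L) (X : ℝ) :
    evs (fun k => c • M k) f X = c • evs M f X := by
  unfold evs
  rw [fourier_eq, fourier_eq, ← integral_smul]
  refine integral_congr_ae (ae_of_all _ fun κ => ?_)
  simp only [_root_.smul_apply]
  rw [smul_comm]
lemma evs_clm {M : Sym} (h : BCs M) (A : E →L[ℂ] E) (f : L) (X : ℝ) :
    evs (fun k => A ∘L M k) f X = A (evs M f X) := by
  unfold evs
  rw [fourier_eq, fourier_eq, ← A.integral_comp_comm (fint (sym_int h (Lint f)) X)]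
  refine integral_congr_ae (ae_of_all _ fun κ => ?_)
  simp only [ContinuousLinearMap.comp_apply, Circle.smul_def, map_smul]
lemma evs_norm {M : Sym} (hc : Continuous M) {C : ℝ} (hC : ∀ k, ‖M k‖ ≤ C) (f : L) (X : ℝ) :
    ‖evs M f X‖ ≤ C * ‖f‖ := by
  have h : BCs M := ⟨hc, C, hC⟩
  unfold evs
  rw [fourier_eq, Lnorm, ← integral_const_mul]
  refine (norm_integral_le_integral_norm _).trans ?_
  refine integral_mono (fint (sym_int h (Lint f)) X).norm ((Lint f).norm.const_mul _) fun κ => ?_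
  simp only [Circle.norm_smul]
  exact ((M (kk κ)).le_opNorm _).trans (mul_le_mul_of_nonneg_right (hC _) (norm_nonneg _))
def Dsym (M : Sym) : Sym := fun k => (Complex.I * k : ℂ) • M k
lemma evs_deriv {M : Sym} (h : BCs M) (h' : BCs (Dsym M)) (f : L) (X : ℝ) :
    HasDerivAt (evs M f) (evs (Dsym M) f X) X := by
  have h1 := sym_int h (Lint f)
  have h2 := sym_int h' (Lint f)
  have e : (fun κ => Dsym M (kk κ) (f κ)) = fun κ : ℝ => (-2 * π * Complex.I * κ) • (M (kk κ) (f κ)) := by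
    funext κ
    simp only [Dsym, _root_.smul_apply, kk]
    congr 1; push_cast; ring
  have h3 : Integrable fun κ : ℝ => κ • (M (kk κ) (f κ)) := by
    rw [e] at h2
    have h4 := h2.smul ((-2 * π * Complex.I : ℂ)⁻¹)
    refine h4.congr (ae_of_all _ fun κ => ?_)
    simp only [Pi.smul_apply, smul_smul]
    have : (-2 * π * Complex.I : ℂ) ≠ 0 := by simp [Real.pi_ne_zero]
    rw [← mul_assoc, inv_mul_cancel₀ this, one_mul]
    rfl
  have := Real.hasDerivAt_fourier h1 h3 X
  unfold evs
  rw [e]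
  exact this
lemma evs_tendsto M (f : L) : Tendsto (evs M f) (cocompact ℝ) (nhds 0) := by
  have := tendsto_integral_exp_inner_smul_cocompact (V := ℝ) (fun κ => M (kk κ) (f κ))
  exact this
lemma BCs.contDiff_aux : ∀ (n : ℕ) (M : Sym), (∀ j ≤ n, BCs (Dsym^[j] M)) → ∀ f : L, ContDiff ℝ n (evs M f)
  | 0, M, h, f => by
    have h0 := h 0 le_rfl
    refine contDiff_zero.2 ?_
    exact VectorFourier.fourierIntegral_continuous Real.continuous_fourierChar (by exact continuous_inner) (sym_int h0 (Lint f))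
  | n + 1, M, h, f => by
    have hd := evs_deriv (h 0 (by omega)) (h 1 (by omega)) f
    have : (((n + 1 : ℕ) : ℕ) : WithTop ℕ∞) = (n : WithTop ℕ∞) + 1 := by push_cast; rfl
    rw [this, contDiff_succ_iff_deriv]
    refine ⟨fun X => (hd X).differentiableAt, by simp, ?_⟩
    have e : deriv (evs M f) = evs (Dsym M) f := funext fun X => (hd X).deriv
    rw [e]
    refine BCs.contDiff_aux n (Dsym M) (fun j hj => ?_) f
    have := h (j + 1) (by omega)
    rwa [Function.iterate_succ_apply] at this
end
section
open MeasureTheory FourierTransform Convolution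
structure Wt (w : ℝ → ℝ) : Prop where
  cont : Continuous w
  ge : ∀ k, (1 + |k|) ^ 3 ≤ w k
  le : ∀ k, w k ≤ (1 + |k|) ^ 4
  even : ∀ k, w (-k) = w k
  sub : ∀ k l, w k ≤ w l * w (k - l)
lemma Wt.one_le {w} (h : Wt w) k : 1 ≤ w k :=
  (one_le_pow₀ (by linarith [abs_nonneg k])).trans (h.ge k)
lemma Wt.pos {w} (h : Wt w) k : 0 < w k := by linarith [h.one_le k]
def sc (m : ℝ → ℂ) : Sym := fun k => m k • ContinuousLinearMap.id ℂ E
@[simp] lemma sc_apply (m : ℝ → ℂ) (k : ℝ) (e : E) : sc m k e = m k • e := rfl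
lemma sc_cont {m : ℝ → ℂ} (h : Continuous m) : Continuous (sc m) := h.smul continuous_const
lemma sc_norm {m : ℝ → ℂ} k : ‖sc m k‖ ≤ ‖m k‖ := by
  rw [sc, norm_smul]
  exact mul_le_of_le_one_right (norm_nonneg _) ContinuousLinearMap.norm_id_le
def wi (w : ℝ → ℝ) (k : ℝ) : ℂ := (((w k)⁻¹ : ℝ) : ℂ)
lemma wi_norm {w} (h : Wt w) k : ‖wi w k‖ ≤ ((1 + |k|) ^ 3)⁻¹ := by
  rw [wi, Complex.norm_real, norm_of_nonneg (inv_nonneg.2 (h.pos k).le)]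
  exact inv_anti₀ (by positivity) (h.ge k)
lemma wi_norm1 {w} (h : Wt w) k : ‖wi w k‖ ≤ 1 :=
  (wi_norm h k).trans (inv_le_one_of_one_le₀ (one_le_pow₀ (by linarith [abs_nonneg k])))
lemma wi_cont {w} (h : Wt w) : Continuous (wi w) :=
  Complex.continuous_ofReal.comp (h.cont.inv₀ fun k => (h.pos k).ne')
lemma BCs.wi {w} (h : Wt w) : BCs (sc (wi w)) :=
  ⟨sc_cont (wi_cont h), 1, fun k => (sc_norm k).trans (wi_norm1 h k)⟩
def ev (w : ℝ → ℝ) (f : L) (X : ℝ) : E := evs (sc (wi w)) f X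
def fw (w : ℝ → ℝ) (f : L) (κ : ℝ) : E := sc (wi w) (kk κ) (f κ)
lemma fw_int {w} (h : Wt w) (f : L) : Integrable (fw w f) := sym_int (BCs.wi h) (Lint f)
def Lmul : E →L[ℂ] E →L[ℂ] E := ContinuousLinearMap.mul ℂ E
def cvf (w : ℝ → ℝ) (f g : L) (κ : ℝ) : E := ((w (kk κ) : ℝ) : ℂ) • (fw w f ⋆[Lmul] fw w g) κ
lemma cvf_bound {w} (h : Wt w) (f g : L) :
    ∀ᵐ κ, ‖cvf w f g κ‖ ≤ ((fun κ => ‖f κ‖) ⋆[ContinuousLinearMap.mul ℝ ℝ] fun κ => ‖g κ‖) κ := by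
  have h1 := (Lint f).norm.ae_convolution_exists (ContinuousLinearMap.mul ℝ ℝ) (Lint g).norm
  filter_upwards [h1] with κ hκ
  rw [cvf, norm_smul, convolution_def, convolution_def, Complex.norm_real, norm_of_nonneg (h.pos _).le]
  have : ‖∫ t, Lmul (fw w f t) (fw w g (κ - t))‖ ≤ ∫ t, (w (kk κ))⁻¹ * ((ContinuousLinearMap.mul ℝ ℝ) ‖f t‖) ‖g (κ - t)‖ := by
    refine norm_integral_le_of_norm_le (hκ.const_mul _) (ae_of_all _ fun t => ?_)
    simp only [Lmul, ContinuousLinearMap.mul_apply', fw, sc_apply]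
    refine (norm_mul_le _ _).trans ?_
    rw [norm_smul, norm_smul, wi, wi, Complex.norm_real, Complex.norm_real,
      norm_of_nonneg (inv_nonneg.2 (h.pos _).le), norm_of_nonneg (inv_nonneg.2 (h.pos _).le)]
    have e : (w (kk t))⁻¹ * (w (kk (κ - t)))⁻¹ ≤ (w (kk κ))⁻¹ := by
      rw [← mul_inv]
      refine inv_anti₀ (h.pos _) ?_
      rw [kk_sub]; exact h.sub _ _
    calc _ = ((w (kk t))⁻¹ * (w (kk (κ - t)))⁻¹) * (‖f t‖ * ‖g (κ - t)‖) := by ring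
      _ ≤ _ := mul_le_mul_of_nonneg_right e (by positivity)
  rw [integral_const_mul] at this
  calc _ ≤ w (kk κ) * ((w (kk κ))⁻¹ * ∫ t, ((ContinuousLinearMap.mul ℝ ℝ) ‖f t‖) ‖g (κ - t)‖) :=
        mul_le_mul_of_nonneg_left this (h.pos _).le
    _ = _ := by rw [← mul_assoc, mul_inv_cancel₀ (h.pos _).ne', one_mul]
lemma cvf_int {w} (h : Wt w) (f g : L) : Integrable (cvf w f g) := by
  refine ((Lint f).norm.integrable_convolution (ContinuousLinearMap.mul ℝ ℝ) (Lint g).norm).mono' ?_ (cvf_bound h f g)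
  exact (Complex.continuous_ofReal.comp (h.cont.comp kk_cont)).aestronglyMeasurable.smul
    ((fw_int h f).integrable_convolution Lmul (fw_int h g)).aestronglyMeasurable
open Classical in
def cv (w : ℝ → ℝ) (f g : L) : L := if h : Wt w then (cvf_int h f g).toL1 _ else 0
lemma cv_coe {w} (h : Wt w) (f g : L) : (cv w f g : ℝ → E) =ᵐ[volume] cvf w f g := by
  rw [cv, dif_pos h]; exact Integrable.coeFn_toL1 _
lemma cv_norm {w} (h : Wt w) (f g : L) : ‖cv w f g‖ ≤ ‖f‖ * ‖g‖ := by
  rw [Lnorm, Lnorm f, Lnorm g]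
  have e := integral_convolution (μ := volume) (ν := volume) (ContinuousLinearMap.mul ℝ ℝ) (Lint f).norm (Lint g).norm
  simp only [ContinuousLinearMap.mul_apply'] at e
  rw [← e]
  refine integral_mono_ae (Lint _).norm ((Lint f).norm.integrable_convolution (ContinuousLinearMap.mul ℝ ℝ) (Lint g).norm) ?_
  filter_upwards [cv_coe h f g, cvf_bound h f g] with κ h1 h2
  simp only [h1]; exact h2
lemma fw_sub {w} (f g : L) : fw w (f - g) =ᵐ[volume] fw w f - fw w g := by
  filter_upwards [Lp.coeFn_sub f g] with κ hk
  simp only [fw, hk, Pi.sub_apply, map_sub]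
lemma conv_congr {f f' g g' : ℝ → E} (h1 : f =ᵐ[volume] f') (h2 : g =ᵐ[volume] g') (κ : ℝ) :
    (f ⋆[Lmul] g) κ = (f' ⋆[Lmul] g') κ := by
  rw [convolution_def, convolution_def]
  refine integral_congr_ae ?_
  have := (quasiMeasurePreserving_sub_left volume κ).ae h2
  filter_upwards [h1, this] with t a b
  rw [a, b]
lemma cv_sub_left {w : ℝ → ℝ} (h : Wt w) (f f' g : L) : cv w (f - f') g = cv w f g - cv w f' g := by
  refine Lp.ext ?_
  filter_upwards [cv_coe h f g, cv_coe h f' g, cv_coe h (f - f') g, Lp.coeFn_sub (cv w f g) (cv w f' g),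
    (fw_int h f).ae_convolution_exists Lmul (fw_int h g), (fw_int h f').ae_convolution_exists Lmul (fw_int h g)]
    with κ h1 h2 h3 h4 h5 h6
  rw [h3, h4, Pi.sub_apply, h1, h2, cvf, cvf, cvf, ← smul_sub, conv_congr (fw_sub f f') (ae_eq_refl _)]
  congr 1
  rw [convolution_def, convolution_def, convolution_def, ← integral_sub h5 h6]
  simp
lemma cv_sub_right {w : ℝ → ℝ} (h : Wt w) (f g g' : L) : cv w f (g - g') = cv w f g - cv w f g' := by
  refine Lp.ext ?_
  filter_upwards [cv_coe h f g, cv_coe h f g', cv_coe h f (g - g'), Lp.coeFn_sub (cv w f g) (cv w f g'),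
    (fw_int h f).ae_convolution_exists Lmul (fw_int h g), (fw_int h f).ae_convolution_exists Lmul (fw_int h g')]
    with κ h1 h2 h3 h4 h5 h6
  rw [h3, h4, Pi.sub_apply, h1, h2, cvf, cvf, cvf, ← smul_sub, conv_congr (ae_eq_refl _) (fw_sub g g')]
  congr 1
  rw [convolution_def, convolution_def, convolution_def, ← integral_sub h5 h6]
  simp
lemma ev_cv {w} (h : Wt w) (f g : L) X : ev w (cv w f g) X = ev w f X * ev w g X := by
  have := Real.fourier_bilin_convolution_eq Lmul (fw_int h f) (fw_int h g) X
  have e : Lmul (𝓕 (fw w f) X) (𝓕 (fw w g) X) = ev w f X * ev w g X := rfl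
  rw [← e, ← this, ev, evs, fourier_eq, fourier_eq]
  refine integral_congr_ae ?_
  filter_upwards [cv_coe h f g] with κ hk
  simp only [hk, cvf, sc_apply, wi, smul_smul]
  rw [← Complex.ofReal_mul, inv_mul_cancel₀ (h.pos _).ne', Complex.ofReal_one, one_smul]
def Herm (f : L) : Prop := ∀ᵐ κ : ℝ, theta (f κ) = f (-κ)
def HS (M : Sym) : Prop := ∀ k e, theta (M k e) = M (-k) (theta e)
lemma ae_neg {p : ℝ → Prop} (h : ∀ᵐ κ : ℝ, p κ) : ∀ᵐ κ : ℝ, p (-κ) :=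
  (Measure.measurePreserving_neg (volume : Measure ℝ)).quasiMeasurePreserving.ae h
lemma Herm.op {M} (hM : BCs M) (hs : HS M) {f : L} (hf : Herm f) : Herm (op M f) := by
  have h1 := op_coe hM f
  filter_upwards [h1, ae_neg h1, hf] with κ a b c
  rw [a, b, hs, c, kk_neg]
lemma Herm.add {f g : L} (hf : Herm f) (hg : Herm g) : Herm (f + g) := by
  have h1 := Lp.coeFn_add f g
  filter_upwards [h1, ae_neg h1, hf, hg] with κ a b c d
  simp only [a, b, Pi.add_apply, theta_add, c, d]
lemma Herm.smul (r : ℝ) {f : L} (hf : Herm f) : Herm ((r : ℂ) • f) := by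
  have h1 := Lp.coeFn_smul (r : ℂ) f
  filter_upwards [h1, ae_neg h1, hf] with κ a b c
  simp only [a, b, Pi.smul_apply, theta_smul, c, Complex.star_def, Complex.conj_ofReal]
lemma Herm.zero : Herm 0 := by
  have h1 := Lp.coeFn_zero E 1 (volume : Measure ℝ)
  filter_upwards [h1, ae_neg h1] with κ a b
  rw [a, b]; simp
def thetaR : E →L[ℝ] E :=
  LinearMap.mkContinuous
    { toFun := theta, map_add' := theta_add
      map_smul' := fun c e => by ext s; simp } 1 (fun e => by simp [theta_norm])
@[simp] lemma thetaR_apply (e : E) : thetaR e = theta e := rfl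
@[fun_prop] lemma theta_cont : Continuous theta := thetaR.continuous
lemma Herm.cv {w} (h : Wt w) {f g : L} (hf : Herm f) (hg : Herm g) : Herm (cv w f g) := by
  have hfw : ∀ {f : L}, Herm f → ∀ᵐ κ : ℝ, theta (fw w f κ) = fw w f (-κ) := by
    intro f hf
    filter_upwards [hf] with κ hk
    simp only [fw, sc_apply, theta_smul, hk, wi, kk_neg, h.even, Complex.star_def, Complex.conj_ofReal]
  have h1 := cv_coe h f g
  filter_upwards [h1, ae_neg h1, (fw_int h f).ae_convolution_exists Lmul (fw_int h g)] with κ a b hc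
  rw [a, b, cvf, cvf, theta_smul, kk_neg, h.even, Complex.star_def, Complex.conj_ofReal]
  congr 1
  rw [convolution_def, convolution_def]
  conv_rhs => rw [← integral_neg_eq_self]
  rw [← thetaR_apply, ← thetaR.integral_comp_comm hc]
  refine integral_congr_ae ?_
  filter_upwards [hfw hf, (quasiMeasurePreserving_sub_left volume κ).ae (hfw hg)] with t c d
  simp only [thetaR_apply, Lmul, ContinuousLinearMap.mul_apply', theta_mul, c, d]
  congr 2; ring
lemma evs_theta {M : Sym} (hM : BCs M) (hs : HS M) {f : L} (hf : Herm f) (X : ℝ) :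
    theta (evs M f X) = evs M f X := by
  unfold evs
  rw [fourier_eq]
  conv_rhs => rw [← integral_neg_eq_self]
  rw [← thetaR_apply, ← thetaR.integral_comp_comm (fint (sym_int hM (Lint f)) X)]
  refine integral_congr_ae ?_
  filter_upwards [hf] with κ hk
  simp only [thetaR_apply, Circle.smul_def, theta_smul, kk_neg, inner_neg_left, neg_neg]
  rw [hs, hk]
  congr 1
  rw [AddChar.map_neg_eq_inv, Circle.coe_inv_eq_conj]; simp
lemma HS.wi {w} (h : Wt w) : HS (sc (wi w)) := fun k e => by
  simp only [sc_apply, theta_smul, Bore.wi, h.even, Complex.star_def, Complex.conj_ofReal]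
lemma ev_theta {w} (h : Wt w) {f : L} (hf : Herm f) X :
    theta (ev w f X) = ev w f X := evs_theta (BCs.wi h) (HS.wi h) hf X
lemma Herm.closed : IsClosed {f : L | Herm f} := by
  refine isClosed_of_closure_subset fun f hf => ?_
  rw [Metric.mem_closure_iff] at hf
  have hi : Integrable (fun κ => theta (f κ) - f (-κ)) :=
    (thetaR.integrable_comp (Lint f)).sub ((Lint f).comp_neg)
  have key : ∫ κ, ‖theta (f κ) - f (-κ)‖ = 0 := by
    refine le_antisymm (le_of_forall_pos_le_add fun δ hδ => ?_) (integral_nonneg fun _ => norm_nonneg _)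
    obtain ⟨g, hg, hd⟩ := hf (δ / 2) (by positivity)
    rw [dist_eq_norm] at hd
    have hb : ∀ᵐ κ : ℝ, ‖theta (f κ) - f (-κ)‖ ≤ ‖(f - g : L) κ‖ + ‖(f - g : L) (-κ)‖ := by
      have h1 := Lp.coeFn_sub f g
      filter_upwards [h1, ae_neg h1, hg] with κ a b c
      rw [a, b, Pi.sub_apply, Pi.sub_apply]
      calc _ = ‖theta (f κ - g κ) - (f (-κ) - g (-κ))‖ := by rw [theta_sub, c]; congr 1; abel
        _ ≤ ‖theta (f κ - g κ)‖ + _ := norm_sub_le _ _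
        _ = _ := by rw [theta_norm]
    have hn := (Lint (f - g)).norm
    have := integral_mono_ae hi.norm (hn.add (hn.comp_neg)) hb
    simp only [Pi.add_apply] at this
    rw [integral_add hn (hn.comp_neg), integral_neg_eq_self (fun κ => ‖(f - g : L) κ‖), ← Lnorm] at this
    linarith
  have := (integral_eq_zero_iff_of_nonneg (fun _ => norm_nonneg _) hi.norm).1 key
  show Herm f
  filter_upwards [this] with κ hk
  simpa [sub_eq_zero] using hk
end
section
open MeasureTheory FourierTransform Convolution SchwartzMap
def Sf (X : ℝ) : ℝ := 1 - tanh X ^ 2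
lemma tanh_hd X : HasDerivAt tanh (Sf X) X := by
  have h := (hasDerivAt_sinh X).div (hasDerivAt_cosh X) (cosh_pos X).ne'
  have e : tanh = fun x => sinh x / cosh x := funext tanh_eq_sinh_div_cosh
  have e' : sinh / cosh = tanh := by rw [e]; rfl
  rw [e'] at h
  refine h.congr_deriv ?_
  rw [Sf, tanh_eq_sinh_div_cosh]
  field_simp [(cosh_pos X).ne']
lemma Sf_eq X : Sf X = 1 / cosh X ^ 2 := by
  rw [Sf, tanh_eq_sinh_div_cosh]
  have := cosh_sq X
  have h := (cosh_pos X).ne'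
  field_simp; linarith
lemma Sf_pos X : 0 < Sf X := by rw [Sf_eq]; have := cosh_pos X; positivity
lemma Sf_le X : Sf X ≤ 1 := by rw [Sf]; nlinarith [sq_nonneg (tanh X)]
lemma tanh_abs X : |tanh X| ≤ 1 := by
  rw [← sq_le_one_iff_abs_le_one]; have := Sf_pos X; rw [Sf] at this; linarith
lemma Sf_hd X : HasDerivAt Sf (-2 * tanh X * Sf X) X := by
  have h := ((tanh_hd X).pow 2).const_sub 1
  refine (h.congr_deriv ?_)
  simp
lemma Sf_decay X : Sf X ≤ 4 * exp (-|X|) := by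
  rw [Sf_eq]
  have h1 : exp |X| ≤ 2 * cosh X := by
    rw [← cosh_abs, cosh_eq]; linarith [exp_pos (-|X|)]
  have h2 := one_le_cosh X
  have h3 : 0 < exp |X| := exp_pos _
  rw [exp_neg, div_le_iff₀ (by positivity)]
  have : exp |X| ≤ 4 * cosh X ^ 2 := by nlinarith
  calc (1 : ℝ) = (exp |X|)⁻¹ * exp |X| := by field_simp
    _ ≤ (exp |X|)⁻¹ * (4 * cosh X ^ 2) := mul_le_mul_of_nonneg_left this (by positivity)
    _ = _ := by ring
open Polynomial in
lemma Sf_iter n (q : ℂ[X]) : ∃ p : ℂ[X],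
    iteratedDeriv n (fun X => ((Sf X : ℝ) : ℂ) * q.eval ((tanh X : ℝ) : ℂ)) =
      fun X => ((Sf X : ℝ) : ℂ) * p.eval ((tanh X : ℝ) : ℂ) := by
  induction n generalizing q with
  | zero => exact ⟨q, by simp⟩
  | succ n ih =>
    obtain ⟨p, hp⟩ := ih (-2 * Polynomial.X * q + (1 - Polynomial.X ^ 2) * derivative q)
    refine ⟨p, ?_⟩
    rw [iteratedDeriv_succ', ← hp]
    congr 1
    funext X
    have h1 := (Sf_hd X).ofReal_comp
    have h2 := (q.hasDerivAt ((tanh X : ℝ) : ℂ)).comp X ((tanh_hd X).ofReal_comp)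
    have h3 := h1.mul h2
    refine h3.deriv.trans ?_
    simp [Sf]; ring
open Polynomial in
lemma Sf_smooth : ContDiff ℝ (⊤ : ℕ∞) (fun X => ((Sf X : ℝ) : ℂ)) := by
  have : (fun X => ((Sf X : ℝ) : ℂ)) = fun X => (1 : ℂ) - (Complex.ofRealCLM (sinh X / cosh X)) ^ 2 := by
    funext X; simp [Sf, tanh_eq_sinh_div_cosh]
  rw [this]
  refine contDiff_const.sub (ContDiff.pow (Complex.ofRealCLM.contDiff.comp ?_) 2)
  exact contDiff_sinh.div contDiff_cosh fun x => (cosh_pos x).ne'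
lemma exp_decay k : ∃ C : ℝ, ∀ x : ℝ, |x| ^ k * exp (-|x|) ≤ C := by
  refine ⟨k.factorial, fun x => ?_⟩
  have := pow_div_factorial_le_exp |x| (abs_nonneg x) k
  rw [exp_neg]
  have hf : (0 : ℝ) < k.factorial := by positivity
  rw [div_le_iff₀ hf] at this
  calc _ ≤ (exp |x| * k.factorial) * (exp |x|)⁻¹ := mul_le_mul_of_nonneg_right this (by positivity)
    _ = _ := by field_simp
def Ssch : 𝓢(ℝ, ℂ) where
  toFun := fun X => ((Sf X : ℝ) : ℂ)
  smooth' := Sf_smooth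
  decay' := fun k n => by
    obtain ⟨p, hp⟩ := Sf_iter n 1
    simp only [Polynomial.eval_one, mul_one] at hp
    obtain ⟨C, hC⟩ := exp_decay k
    have hc : ∃ B, ∀ z ∈ Metric.closedBall (0 : ℂ) 1, ‖p.eval z‖ ≤ B :=
      (isCompact_closedBall (0 : ℂ) 1).exists_bound_of_continuousOn p.continuous.continuousOn
    obtain ⟨B, hB⟩ := hc
    refine ⟨4 * C * B, fun x => ?_⟩
    rw [norm_iteratedFDeriv_eq_norm_iteratedDeriv, hp, norm_mul, Complex.norm_real, Real.norm_eq_abs, Real.norm_eq_abs,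
      abs_of_pos (Sf_pos x)]
    have h1 := hB ((tanh x : ℝ) : ℂ) (by
      rw [mem_closedBall_zero_iff, Complex.norm_real]; exact tanh_abs x)
    have h2 := mul_le_mul_of_nonneg_left (Sf_decay x) (pow_nonneg (abs_nonneg x) k)
    have h3 : |x| ^ k * Sf x ≤ 4 * C := by linarith [hC x]
    rw [← mul_assoc]
    exact mul_le_mul h3 h1 (norm_nonneg _) ((mul_nonneg (pow_nonneg (abs_nonneg x) k) (Sf_pos x).le).trans h3)
def sh : 𝓢(ℝ, ℂ) := 𝓕⁻ Ssch
lemma sh_four X : 𝓕 (sh : ℝ → ℂ) X = ((Sf X : ℝ) : ℂ) := by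
  have : 𝓕 sh = Ssch := FourierTransform.fourier_fourierInv_eq Ssch
  rw [← fourier_coe, this]; rfl
lemma sh_conj κ : star (sh κ) = sh (-κ) := by
  have e : (sh : ℝ → ℂ) = 𝓕⁻ (Ssch : ℝ → ℂ) := by rw [sh, fourierInv_coe]
  rw [e, Real.fourierInv_eq, Real.fourierInv_eq, Complex.star_def, ← integral_conj]
  refine integral_congr_ae (ae_of_all _ fun v => ?_)
  simp only [Circle.smul_def, smul_eq_mul, map_mul, inner_neg_right]
  rw [AddChar.map_neg_eq_inv, Circle.coe_inv_eq_conj]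
  congr 1
  exact Complex.conj_ofReal _
def shK : ℝ := ∫ κ, (1 + |kk κ|) ^ 6 * ‖sh κ‖
lemma sh_int : Integrable fun κ => (1 + |kk κ|) ^ 6 * ‖sh κ‖ := by
  have h := (sh.integrable_pow_mul volume 6).const_mul ((2 * π + 1) ^ 6 * 2 ^ 6)
  have h' := (sh.integrable_pow_mul volume 0).const_mul ((2 * π + 1) ^ 6 * 2 ^ 6)
  refine (h.add h').mono' (by have := sh.continuous; exact (by fun_prop : Continuous fun κ => (1 + |kk κ|) ^ 6 * ‖sh κ‖).aestronglyMeasurable) (ae_of_all _ fun κ => ?_)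
  have hn : 0 ≤ (1 + |kk κ|) ^ 6 * ‖sh κ‖ := by positivity
  rw [norm_of_nonneg hn]
  simp only [Pi.add_apply, pow_zero, one_mul, Real.norm_eq_abs]
  have e : |kk κ| = 2 * π * |κ| := by rw [kk, abs_neg, abs_mul, abs_of_pos (by positivity : 0 < 2 * π)]
  have hp := pi_pos
  have ha := abs_nonneg κ
  have h1 : (1 + |kk κ|) ^ 6 ≤ ((2 * π + 1) * (1 + |κ|)) ^ 6 := by
    refine pow_le_pow_left₀ (by positivity) ?_ 6
    rw [e]; nlinarith
  have h2 : (1 + |κ|) ^ 6 ≤ 2 ^ 6 * (|κ| ^ 6 + 1) := by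
    rcases le_total |κ| 1 with h | h
    · have : (1 + |κ|) ^ 6 ≤ 2 ^ 6 := pow_le_pow_left₀ (by positivity) (by linarith) 6
      nlinarith [pow_nonneg ha 6]
    · have : (1 + |κ|) ^ 6 ≤ (2 * |κ|) ^ 6 := pow_le_pow_left₀ (by positivity) (by linarith) 6
      rw [mul_pow] at this; linarith
  rw [mul_pow] at h1
  have h3 := h1.trans (mul_le_mul_of_nonneg_left h2 (by positivity))
  calc _ ≤ _ := mul_le_mul_of_nonneg_right h3 (norm_nonneg _)
    _ = _ := by ring
def Pm (m : ℝ → ℂ) : Prop := Continuous m ∧ ∃ C, ∀ k, ‖m k‖ ≤ C * (1 + |k|) ^ 6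
def Sfun (m : ℝ → ℂ) (κ : ℝ) : E := (m (kk κ) * sh κ) • (1 : E)
lemma oneE_norm : ‖(1 : E)‖ ≤ 1 := E.norm_le (by norm_num) fun s => by simp
lemma Sfun_norm {m : ℝ → ℂ} {C} (h : ∀ k, ‖m k‖ ≤ C * (1 + |k|) ^ 6) κ :
    ‖Sfun m κ‖ ≤ C * ((1 + |kk κ|) ^ 6 * ‖sh κ‖) := by
  rw [Sfun, norm_smul, norm_mul]
  calc _ ≤ ‖m (kk κ)‖ * ‖sh κ‖ * 1 := mul_le_mul_of_nonneg_left oneE_norm (by positivity)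
    _ ≤ C * (1 + |kk κ|) ^ 6 * ‖sh κ‖ * 1 := by gcongr; exact h _
    _ = _ := by ring
lemma Sfun_int {m : ℝ → ℂ} (h : Pm m) : Integrable (Sfun m) := by
  obtain ⟨hc, C, hC⟩ := h
  refine (sh_int.const_mul C).mono' ?_ (ae_of_all _ (Sfun_norm hC))
  have := sh.continuous
  exact (((hc.comp kk_cont).mul this).smul continuous_const).aestronglyMeasurable
open Classical in
def Srep (m : ℝ → ℂ) : L := if h : Pm m then (Sfun_int h).toL1 _ else 0
lemma Srep_coe {m : ℝ → ℂ} (h : Pm m) : (Srep m : ℝ → E) =ᵐ[volume] Sfun m := by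
  rw [Srep, dif_pos h]; exact Integrable.coeFn_toL1 _
lemma Srep_norm {m : ℝ → ℂ} (hc : Continuous m) {C} (h : ∀ k, ‖m k‖ ≤ C * (1 + |k|) ^ 6) :
    ‖Srep m‖ ≤ C * shK := by
  rw [Lnorm, shK, ← integral_const_mul]
  refine integral_mono_ae (Lint _).norm (sh_int.const_mul C) ?_
  filter_upwards [Srep_coe ⟨hc, C, h⟩] with κ hk
  rw [hk]; exact Sfun_norm h κ
lemma Srep_herm {m : ℝ → ℂ} (h : Pm m) (hs : ∀ k, star (m k) = m (-k)) : Herm (Srep m) := by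
  have h1 := Srep_coe h
  filter_upwards [h1, ae_neg h1] with κ a b
  rw [a, b, Sfun, Sfun, theta_smul, theta_one, star_mul', hs, sh_conj, kk_neg]
lemma evs_Srep {n m n' m' : ℝ → ℂ} (h : Pm m) (h' : Pm m') (e : ∀ k, n k * m k = n' k * m' k) X :
    evs (sc n) (Srep m) X = evs (sc n') (Srep m') X := by
  unfold evs
  rw [fourier_eq, fourier_eq]
  refine integral_congr_ae ?_
  filter_upwards [Srep_coe h, Srep_coe h'] with κ a b
  simp only [a, b, Sfun, sc_apply, smul_smul, ← mul_assoc, e]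
lemma Pm_one : Pm 1 := ⟨continuous_const, 1, fun k => by
  simp only [Pi.one_apply, norm_one, one_mul]; exact one_le_pow₀ (by linarith [abs_nonneg k])⟩
lemma evs_one X : evs (sc 1) (Srep 1) X = ((Sf X : ℝ) : ℂ) • (1 : E) := by
  rw [← sh_four X]
  unfold evs
  rw [fourier_eq, fourier_eq, ← integral_smul_const]
  refine integral_congr_ae ?_
  filter_upwards [Srep_coe Pm_one] with κ a
  simp [a, Sfun, sc_apply]
lemma evs_Srep_one {n m : ℝ → ℂ} (h : Pm m) (e : ∀ k, n k * m k = 1) X :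
    evs (sc n) (Srep m) X = ((Sf X : ℝ) : ℂ) • (1 : E) := by
  rw [evs_Srep h Pm_one (n' := 1) (by simpa using e), evs_one]
lemma cubic_inv_bound (k : ℝ) : |k| * ((1 + |k|) ^ 3)⁻¹ ≤ 1 := by
  rw [← div_eq_mul_inv, div_le_one (by positivity)]
  have := abs_nonneg k
  nlinarith [pow_nonneg this 3, pow_nonneg this 2]
lemma evs_Srep_ik {n m : ℝ → ℂ} (h : Pm m) (e : ∀ k, n k * m k = Complex.I * k) (X : ℝ) :
    evs (sc n) (Srep m) X = ((-2 * tanh X * Sf X : ℝ) : ℂ) • (1 : E) := by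
  let q : ℝ → ℂ := fun k => (((1 + |k|) ^ 3 : ℝ) : ℂ)
  let qi : ℝ → ℂ := fun k => ((((1 + |k|) ^ 3)⁻¹ : ℝ) : ℂ)
  have hpos : ∀ k : ℝ, 0 < (1 + |k|) ^ 3 := fun k => by positivity
  have hq : Pm q := ⟨by fun_prop, 1, fun k => by
    rw [Complex.norm_real, norm_of_nonneg (hpos k).le, one_mul]
    exact pow_le_pow_right₀ (by linarith [abs_nonneg k]) (by norm_num)⟩
  have hqq : ∀ k, qi k * q k = 1 := fun k => by
    simp only [qi, q]; rw [← Complex.ofReal_mul, inv_mul_cancel₀ (hpos k).ne', Complex.ofReal_one]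
  have hqc : Continuous qi := Complex.continuous_ofReal.comp (Continuous.inv₀ (by fun_prop) fun k => (hpos k).ne')
  have hqn : ∀ k, ‖qi k‖ = ((1 + |k|) ^ 3)⁻¹ := fun k => by
    simp only [qi]; rw [Complex.norm_real, norm_of_nonneg (inv_nonneg.2 (hpos k).le)]
  have hb : BCs (sc qi) := ⟨sc_cont hqc, 1, fun k => (sc_norm k).trans (by
    rw [hqn]; exact inv_le_one_of_one_le₀ (one_le_pow₀ (by linarith [abs_nonneg k])))⟩
  have hD : Dsym (sc qi) = sc (fun k => Complex.I * k * qi k) := by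
    funext k; simp [Dsym, sc, smul_smul]
  have hb' : BCs (Dsym (sc qi)) := by
    rw [hD]
    refine ⟨sc_cont (by fun_prop), 1, fun k => (sc_norm k).trans ?_⟩
    rw [norm_mul, hqn, norm_mul, Complex.norm_I, one_mul, Complex.norm_real, Real.norm_eq_abs]
    exact cubic_inv_bound k
  have h1 := evs_deriv hb hb' (Srep q) X
  have h2 : evs (sc qi) (Srep q) = fun X => ((Sf X : ℝ) : ℂ) • (1 : E) := funext (evs_Srep_one hq hqq)
  rw [h2, hD] at h1
  have h3 := ((Sf_hd X).ofReal_comp).smul_const (1 : E)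
  rw [← h1.unique h3]
  refine evs_Srep h hq (fun k => ?_) X
  rw [e]; linear_combination (-Complex.I * k) * hqq k
end
section
open MeasureTheory
def ph (δ k : ℝ) : ℝ := |k| / (1 + δ * |k|)
lemma ph_nonneg {δ} (hδ : 0 ≤ δ) k : 0 ≤ ph δ k := by
  have := abs_nonneg k; unfold ph; positivity
lemma ph_le {δ} (hδ : 0 ≤ δ) k : ph δ k ≤ |k| := by
  have := abs_nonneg k
  unfold ph; exact div_le_self this (by nlinarith [mul_nonneg hδ this])
lemma ph_cont {δ} (hδ : 0 ≤ δ) : Continuous (ph δ) := by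
  unfold ph
  refine Continuous.div (by fun_prop) (by fun_prop) fun k => ?_
  have := mul_nonneg hδ (abs_nonneg k); linarith
lemma ph_sub {δ} (hδ : 0 ≤ δ) k l : ph δ k ≤ ph δ l + ph δ (k - l) := by
  unfold ph
  have hk : |k| ≤ |l| + |k - l| := by
    calc |k| = |l + (k - l)| := by ring_nf
      _ ≤ _ := abs_add_le _ _
  generalize hw : |k| = x at *; generalize hx : |l| = y at *; generalize hz : |k - l| = z at *
  have hx0 : 0 ≤ x := hw ▸ abs_nonneg _
  have hy0 : 0 ≤ y := hx ▸ abs_nonneg _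
  have hz0 : 0 ≤ z := hz ▸ abs_nonneg _
  have h1 : x / (1 + δ * x) ≤ (y + z) / (1 + δ * (y + z)) := by
      rw [div_le_div_iff₀ (by positivity) (by positivity)]; nlinarith
  have h2 : y / (1 + δ * (y + z)) ≤ y / (1 + δ * y) :=
      div_le_div_of_nonneg_left hy0 (by positivity) (by nlinarith)
  have h3 : z / (1 + δ * (y + z)) ≤ z / (1 + δ * z) :=
      div_le_div_of_nonneg_left hz0 (by positivity) (by nlinarith)
  rw [add_div] at h1; linarith
def W0 (k : ℝ) : ℝ := (1 + |k|) ^ 3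
def W1 (δ k : ℝ) : ℝ := (1 + |k|) ^ 3 * (1 + ph δ k)
lemma base_sub (k l : ℝ) : 1 + |k| ≤ (1 + |l|) * (1 + |k - l|) := by
  have hk : |k| ≤ |l| + |k - l| := by
    calc |k| = |l + (k - l)| := by ring_nf
      _ ≤ _ := abs_add_le _ _
  nlinarith [mul_nonneg (abs_nonneg l) (abs_nonneg (k - l))]
lemma W1_le {δ} (hδ : 0 ≤ δ) k : W1 δ k ≤ (1 + |k|) ^ 4 := by
  unfold W1; rw [pow_succ (1 + |k|) 3]
  have := ph_le hδ k
  gcongr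
lemma Wt0 : Wt W0 where
  cont := by unfold W0; fun_prop
  ge := fun k => le_rfl
  le := fun k => pow_le_pow_right₀ (by linarith [abs_nonneg k]) (by norm_num)
  even := fun k => by simp [W0]
  sub := fun k l => by
    unfold W0; rw [← mul_pow]
    exact pow_le_pow_left₀ (by positivity) (base_sub k l) 3
lemma Wt1 {δ : ℝ} (hδ : 0 ≤ δ) : Wt (W1 δ) where
  cont := by have := ph_cont hδ; unfold W1; fun_prop
  ge := fun k => le_mul_of_one_le_right (by positivity) (by linarith [ph_nonneg hδ k])
  le := W1_le hδ
  even := fun k => by simp [W1, ph]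
  sub := fun k l => by
    unfold W1
    have h1 : (1 + |k|) ^ 3 ≤ ((1 + |l|) * (1 + |k - l|)) ^ 3 := pow_le_pow_left₀ (by positivity) (base_sub k l) 3
    have h2 : 1 + ph δ k ≤ (1 + ph δ l) * (1 + ph δ (k - l)) := by
      nlinarith [ph_sub hδ k l, mul_nonneg (ph_nonneg hδ l) (ph_nonneg hδ (k - l))]
    calc _ ≤ ((1 + |l|) * (1 + |k - l|)) ^ 3 * ((1 + ph δ l) * (1 + ph δ (k - l))) :=
          mul_le_mul h1 h2 (by linarith [ph_nonneg hδ k]) (by positivity)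
      _ = _ := by ring
def Ks (m : ℝ → ℂ) (a : ℝ) : Sym := fun k => (m k * Complex.I) • Sop (a * k)
def cs (B : E →L[ℂ] E) : Sym := fun _ => B
lemma Ks_cont {m : ℝ → ℂ} (hm : Continuous m) a : Continuous (Ks m a) :=
  (hm.mul continuous_const).smul (Sop_cont.comp (continuous_const.mul continuous_id))
lemma Ks_norm {m : ℝ → ℂ} {a} k : ‖Ks m a k‖ ≤ 16 * ‖m k‖ := by
  rw [Ks, norm_smul, norm_mul, Complex.norm_I, mul_one, mul_comm]
  exact mul_le_mul_of_nonneg_right (Sop_norm _) (norm_nonneg _)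
def Nm (n : ℝ → ℂ) : Prop := Continuous n ∧ ∃ C, ∀ k, ‖n k‖ ≤ C * ((1 + |k|) ^ 3)⁻¹
lemma Nm.wi {w} (h : Wt w) : Nm (wi w) := ⟨wi_cont h, 1, fun k => by rw [one_mul]; exact wi_norm h k⟩
lemma Nm.C0 {n : ℝ → ℂ} (h : Nm n) : ∃ C, ∀ k, ‖n k‖ ≤ C ∧ |k| * ‖n k‖ ≤ C ∧ |k| ^ 2 * ‖n k‖ ≤ C ∧ |k| ^ 3 * ‖n k‖ ≤ C := by
  obtain ⟨hc, C, hC⟩ := h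
  refine ⟨C, fun k => ?_⟩
  have hC0 : 0 ≤ C := by
    have := (norm_nonneg _).trans (hC 0); simpa using this
  have key : ∀ j ≤ 3, |k| ^ j * ‖n k‖ ≤ C := by
    intro j hj
    calc |k| ^ j * ‖n k‖ ≤ (1 + |k|) ^ 3 * (C * ((1 + |k|) ^ 3)⁻¹) := by
          refine mul_le_mul ?_ (hC k) (norm_nonneg _) (by positivity)
          calc |k| ^ j ≤ (1 + |k|) ^ j := pow_le_pow_left₀ (abs_nonneg k) (by linarith) j
            _ ≤ _ := pow_le_pow_right₀ (by linarith [abs_nonneg k]) hj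
      _ = C := by field_simp
  exact ⟨by simpa using key 0 (by norm_num), by simpa using key 1 (by norm_num), key 2 (by norm_num), key 3 le_rfl⟩
def ikm (n : ℝ → ℂ) : ℝ → ℂ := fun k => Complex.I * k * n k
lemma ikm_norm (n : ℝ → ℂ) k : ‖ikm n k‖ = |k| * ‖n k‖ := by
  rw [ikm, norm_mul, norm_mul, Complex.norm_I, one_mul, Complex.norm_real, Real.norm_eq_abs]
lemma ikm_cont {n : ℝ → ℂ} (h : Continuous n) : Continuous (ikm n) := by unfold ikm; fun_prop
lemma BCs.sc {m : ℝ → ℂ} (hm : Continuous m) {C} (h : ∀ k, ‖m k‖ ≤ C) : BCs (sc m) :=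
  ⟨sc_cont hm, C, fun k => (sc_norm k).trans (h k)⟩
lemma BCs.Ks {m : ℝ → ℂ} (hm : Continuous m) {C} (h : ∀ k, ‖m k‖ ≤ C) a : BCs (Ks m a) :=
  ⟨Ks_cont hm a, 16 * C, fun k => (Ks_norm k).trans (by linarith [h k])⟩
lemma BCs.cs (B : E →L[ℂ] E) : BCs (cs B) := ⟨continuous_const, ‖B‖, fun _ => le_rfl⟩
lemma Nm.BCs {n : ℝ → ℂ} (h : Nm n) : BCs (Bore.sc n) :=
  let ⟨_, hC⟩ := h.C0; BCs.sc h.1 fun k => (hC k).1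
lemma Nm.BCs1 {n : ℝ → ℂ} (h : Nm n) : Bore.BCs (Bore.sc (ikm n)) :=
  let ⟨_, hC⟩ := h.C0; BCs.sc (ikm_cont h.1) fun k => by rw [ikm_norm]; exact (hC k).2.1
lemma Nm.BCsK {n : ℝ → ℂ} (h : Nm n) a : Bore.BCs (Bore.Ks n a) :=
  let ⟨_, hC⟩ := h.C0; BCs.Ks h.1 (fun k => (hC k).1) a
lemma Nm.BCsK1 {n : ℝ → ℂ} (h : Nm n) a : Bore.BCs (Bore.Ks (ikm n) a) :=
  let ⟨_, hC⟩ := h.C0; BCs.Ks (ikm_cont h.1) (fun k => by rw [ikm_norm]; exact (hC k).2.1) a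
lemma Dsym_sc (n : ℝ → ℂ) : Dsym (sc n) = sc (ikm n) := by funext k; simp [Dsym, sc, ikm, smul_smul]
lemma Dsym_Ks (n : ℝ → ℂ) a : Dsym (Ks n a) = Ks (ikm n) a := by
  funext k; simp [Dsym, Ks, ikm, smul_smul, mul_assoc]
lemma sc_deriv {n : ℝ → ℂ} (h : Nm n) (f : L) X :
    HasDerivAt (evs (sc n) f) (evs (sc (ikm n)) f X) X := by
  have := evs_deriv h.BCs (by rw [Dsym_sc]; exact h.BCs1) f X
  rwa [Dsym_sc] at this
lemma Ks_deriv {n : ℝ → ℂ} (h : Nm n) a (f : L) X :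
    HasDerivAt (evs (Ks n a) f) (evs (Ks (ikm n) a) f X) X := by
  have := evs_deriv (h.BCsK a) (by rw [Dsym_Ks]; exact h.BCsK1 a) f X
  rwa [Dsym_Ks] at this
lemma Ks_mean {n : ℝ → ℂ} (h : Nm n) (a : ℝ) (f : L) (X : ℝ) : meanE (evs (Ks n a) f X) = 0 := by
  rw [← evs_clm (h.BCsK a)]
  have : (fun k => meanE ∘L Ks n a k) = fun k => (0 : ℂ) • Ks n a k := by
    funext k; ext1 e
    simp only [ContinuousLinearMap.comp_apply, Ks, _root_.smul_apply, map_smul, (Sop_sol (a * k) e).1, smul_zero]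
    simp
  rw [this, evs_smul_sym, zero_smul]
lemma Ks_eq {n : ℝ → ℂ} (h : Nm n) (a : ℝ) (f : L) (X : ℝ) :
    evs (Ks n a) f X - c1 (evs (Ks n a) f X) = Jop (Complex.I • (evs (sc n) f X - meanE (evs (sc n) f X))
      + (Complex.I * a) • evs (Ks (ikm n) a) f X) := by
  have hB : BCs (fun k => (ContinuousLinearMap.id ℂ E - meanE) ∘L sc n k) := by
    obtain ⟨hc, C, hC⟩ := h.BCs
    refine ⟨continuous_const.clm_comp hc, ‖ContinuousLinearMap.id ℂ E - meanE‖ * C, fun k => ?_⟩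
    exact (ContinuousLinearMap.opNorm_comp_le _ _).trans (mul_le_mul_of_nonneg_left (hC k) (norm_nonneg _))
  have hI : ∀ {M : Sym} (c : ℂ), BCs M → BCs (fun k => c • M k) := fun {M} c ⟨hc, C, hC⟩ =>
    ⟨hc.const_smul c, ‖c‖ * C, fun k => by rw [norm_smul]; exact mul_le_mul_of_nonneg_left (hC k) (norm_nonneg _)⟩
  have e1 : evs (Ks n a) f X - c1 (evs (Ks n a) f X) = evs (fun k => (ContinuousLinearMap.id ℂ E - c1) ∘L Ks n a k) f X := by
    rw [evs_clm (h.BCsK a)]; simp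
  have e2 : evs (sc n) f X - meanE (evs (sc n) f X) = evs (fun k => (ContinuousLinearMap.id ℂ E - meanE) ∘L sc n k) f X := by
    rw [evs_clm h.BCs]; simp
  rw [e1, e2, ← evs_smul_sym, ← evs_smul_sym, ← evs_add_sym (hI _ hB) (hI _ (h.BCsK1 a))]
  rw [← evs_clm]
  · congr 1
    funext k; ext1 e
    have := (Sop_sol (a * k) e).2
    simp only [ContinuousLinearMap.comp_apply, Ks, _root_.smul_apply, _root_.sub_apply, _root_.add_apply, sc_apply,
      ContinuousLinearMap.id_apply, map_smul]
    rw [this, ← map_smul Jop]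
    congr 1
    simp only [smul_sub, smul_smul, ikm]
    have hI2 : Complex.I * Complex.I = -1 := Complex.I_mul_I
    have e3 : Complex.I * a * (Complex.I * k * n k * Complex.I) = -(n k * Complex.I * ((a * k : ℝ) : ℂ)) := by
      push_cast; linear_combination (a * k * n k * Complex.I) * hI2
    rw [e3, mul_comm (n k) Complex.I]; module
  · obtain ⟨hc, C, hC⟩ := hI Complex.I hB
    obtain ⟨hc', C', hC'⟩ := hI (Complex.I * a) (h.BCsK1 a)
    exact ⟨hc.add hc', C + C', fun k => (norm_add_le _ _).trans (add_le_add (hC k) (hC' k))⟩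
lemma evs_op_sc {n m : ℝ → ℂ} (h : BCs (sc m)) (f : L) X :
    evs (sc n) (op (sc m) f) X = evs (sc fun k => n k * m k) f X := by
  rw [evs_op h]; congr 1; funext k; ext1 e; simp [smul_smul, mul_comm]
lemma evs_op_Ks {n m : ℝ → ℂ} {a} (h : BCs (Ks m a)) (f : L) X :
    evs (sc n) (op (Ks m a) f) X = evs (Ks (fun k => n k * m k) a) f X := by
  rw [evs_op h]; congr 1; funext k; ext1 e; simp only [ContinuousLinearMap.comp_apply, Ks, sc_apply, _root_.smul_apply, smul_smul, mul_assoc]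
lemma evs_op_cs {n : ℝ → ℂ} (hn : BCs (sc n)) (B : E →L[ℂ] E) (f : L) X :
    evs (sc n) (op (cs B) f) X = B (evs (sc n) f X) := by
  rw [evs_op (BCs.cs B), ← evs_clm hn]; congr 1; funext k; ext1 e; simp [cs]
def mI : E →L[ℂ] E := Lmul isE
@[simp] lemma mI_apply (e : E) : mI e = isE * e := rfl
lemma Ks_tr {n : ℝ → ℂ} (a : ℝ) (hn : BCs (Ks n a)) (hn' : BCs (sc n)) (f : L) (X : ℝ) :
    trE (evs (Ks n a) (op (cs mI) (op (cs trE) f)) X) = trE (evs (sc fun k => -(n k * dR (a * k))) f X) := by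
  have hd : BCs (sc fun k => -(n k * dR (a * k))) := by
    obtain ⟨hc, C, hC⟩ := hn'
    have hcn : Continuous n := by
      have : n = fun k => sc n k 1 p1 := by funext k; simp
      rw [this]
      exact (evalE p1).continuous.comp (hc.clm_apply continuous_const)
    have hnn : ∀ k, ‖n k‖ ≤ C := fun k => by
      have h1 : ‖sc n k 1 p1‖ ≤ C := (E.le_norm _ _).trans (((sc n k).le_opNorm 1).trans (by
        calc _ ≤ ‖sc n k‖ * 1 := mul_le_mul_of_nonneg_left oneE_norm (norm_nonneg _)
          _ ≤ C := by rw [mul_one]; exact hC k))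
      simpa using h1
    refine BCs.sc (C := C * 16) (hcn.mul (Complex.continuous_ofReal.comp (dR_cont.comp (continuous_const.mul continuous_id)))).neg fun k => ?_
    rw [norm_neg, norm_mul, Complex.norm_real, norm_of_nonneg (dR_pos _).le]
    exact mul_le_mul (hnn k) (dR_le _) (dR_pos _).le ((norm_nonneg _).trans (hnn k))
  have hop : ∀ B : E →L[ℂ] E, BCs (fun k => Ks n a k ∘L B) := fun B => by
    obtain ⟨hc, C, hC⟩ := hn
    exact ⟨hc.clm_comp continuous_const, C * ‖B‖, fun k => (ContinuousLinearMap.opNorm_comp_le _ _).trans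
      (mul_le_mul_of_nonneg_right (hC k) (norm_nonneg _))⟩
  rw [evs_op (BCs.cs _), evs_op (BCs.cs _), ← evs_clm hd, ← evs_clm]
  · congr 1; funext k; ext1 e
    have h1 : trE e = cst ((1 / 2) * (e p1 + e pm1)) := by ext s; simp
    have h2 : isE * cst ((1 / 2) * (e p1 + e pm1)) = (Complex.I * ((1 / 2) * (e p1 + e pm1))) • sE := by
      ext s; simp; ring
    simp only [ContinuousLinearMap.comp_apply, cs, mI_apply, Ks, _root_.smul_apply, sc_apply, map_smul]
    rw [h1, h2, map_smul, map_smul, trE_Sop, Sop_sE_p1]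
    ext s
    simp
    linear_combination (n k * ((1 / 2) * (e p1 + e pm1)) * dR (a * k)) * Complex.I_mul_I
  · have := hop (mI ∘L trE)
    exact this
end
section
open MeasureTheory
lemma evs_zero {M : Sym} (X : ℝ) : evs M (0 : L) X = 0 := by
  have := evs_smul M 0 (0 : L) X
  simpa using this
lemma ev_add {w} (h : Wt w) (f g : L) X : ev w (f + g) X = ev w f X + ev w g X := evs_add (BCs.wi h) f g X
lemma ev_smul (w : ℝ → ℝ) (c : ℂ) (f : L) (X : ℝ) : ev w (c • f) X = c • ev w f X := evs_smul _ c f X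
lemma ev_sub {w : ℝ → ℝ} (h : Wt w) (f g : L) (X : ℝ) : ev w (f - g) X = ev w f X - ev w g X := by
  have : f - g = f + (-1 : ℂ) • g := by module
  rw [this, ev_add h, ev_smul]; module
lemma ev_norm {w} (h : Wt w) (f : L) X : ‖ev w f X‖ ≤ ‖f‖ := by
  have := evs_norm (sc_cont (wi_cont h)) (fun k => (sc_norm k).trans (wi_norm1 h k)) f X
  rw [one_mul] at this; exact this
def Sr (w : ℝ → ℝ) : L := Srep fun k => (w k : ℂ)
def SFr (w : ℝ → ℝ) : L := Srep fun k => (-1 / 2 : ℂ) * (Complex.I * k * (w k : ℂ))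
lemma Wt.bd6 {w} (h : Wt w) k : ‖(w k : ℂ)‖ ≤ 1 * (1 + |k|) ^ 6 := by
  rw [Complex.norm_real, norm_of_nonneg (h.pos k).le, one_mul]
  exact (h.le k).trans (pow_le_pow_right₀ (by linarith [abs_nonneg k]) (by norm_num))
lemma Wt.bd6' {w} (h : Wt w) k : ‖(-1 / 2 : ℂ) * (Complex.I * k * (w k : ℂ))‖ ≤ 1 * (1 + |k|) ^ 6 := by
  rw [norm_mul, norm_mul, norm_mul, Complex.norm_I, one_mul, Complex.norm_real, Complex.norm_real,
    norm_of_nonneg (h.pos k).le, one_mul, Real.norm_eq_abs]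
  have h1 : ‖(-1 / 2 : ℂ)‖ ≤ 1 := by norm_num
  have h2 : |k| * w k ≤ (1 + |k|) * (1 + |k|) ^ 4 := mul_le_mul (by linarith) (h.le k) (h.pos k).le (by positivity)
  have h3 : (1 + |k|) * (1 + |k|) ^ 4 ≤ (1 + |k|) ^ 6 := by
    rw [← pow_succ']; exact pow_le_pow_right₀ (by linarith [abs_nonneg k]) (by norm_num)
  calc _ ≤ 1 * (|k| * w k) := mul_le_mul_of_nonneg_right h1 (mul_nonneg (abs_nonneg k) (h.pos k).le)
    _ ≤ _ := by linarith
lemma Wt.contC {w} (h : Wt w) : Continuous fun k => (w k : ℂ) := Complex.continuous_ofReal.comp h.cont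
lemma Wt.Pm {w} (h : Wt w) : Pm fun k => (w k : ℂ) := ⟨h.contC, 1, h.bd6⟩
lemma Wt.Pm' {w} (h : Wt w) : Bore.Pm fun k => (-1 / 2 : ℂ) * (Complex.I * k * (w k : ℂ)) :=
  ⟨by have := h.contC; fun_prop, 1, h.bd6'⟩
lemma wi_mul {w} (h : Wt w) k : wi w k * (w k : ℂ) = 1 := by
  rw [wi, ← Complex.ofReal_mul, inv_mul_cancel₀ (h.pos k).ne', Complex.ofReal_one]
lemma ev_Sr {w} (h : Wt w) X : ev w (Sr w) X = ((Sf X : ℝ) : ℂ) • (1 : E) :=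
  evs_Srep_one h.Pm (wi_mul h) X
lemma ev_SFr {w : ℝ → ℝ} (h : Wt w) (X : ℝ) : ev w (SFr w) X = ((tanh X * Sf X : ℝ) : ℂ) • (1 : E) := by
  have h1 : evs (sc fun k => (-2 : ℂ) * wi w k) (SFr w) X = _ := evs_Srep_ik h.Pm' (fun k => by
    linear_combination (Complex.I * k) * wi_mul h k) X
  have h2 : evs (sc fun k => (-2 : ℂ) * wi w k) (SFr w) X = (-2 : ℂ) • ev w (SFr w) X := by
    rw [ev, ← evs_smul_sym]; congr 1; funext k; simp [sc, smul_smul]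
  have h3 : ev w (SFr w) X = (-1 / 2 : ℂ) • ((-2 : ℂ) • ev w (SFr w) X) := by rw [smul_smul]; norm_num
  rw [h3, ← h2, h1, smul_smul]; congr 1; push_cast; ring
lemma Sr_herm {w} (h : Wt w) : Herm (Sr w) := Srep_herm h.Pm fun k => by simp [h.even]
lemma SFr_herm {w} (h : Wt w) : Herm (SFr w) := Srep_herm h.Pm' fun k => by
  simp [h.even]
lemma Sr_norm {w} (h : Wt w) : ‖Sr w‖ ≤ shK := by
  have := Srep_norm h.contC h.bd6; rw [one_mul] at this; exact this
lemma SFr_norm {w} (h : Wt w) : ‖SFr w‖ ≤ shK := by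
  have := Srep_norm h.Pm'.1 h.bd6'; rw [one_mul] at this; exact this
abbrev A := L × L
def EV (w : ℝ → ℝ) (u : A) (X : ℝ) : E := ev w u.1 X + ((tanh X : ℝ) : ℂ) • ev w u.2 X
lemma EV_add {w} (h : Wt w) u v X : EV w (u + v) X = EV w u X + EV w v X := by
  simp only [EV, Prod.fst_add, Prod.snd_add, ev_add h]; module
lemma EV_sub {w} (h : Wt w) u v X : EV w (u - v) X = EV w u X - EV w v X := by
  simp only [EV, Prod.fst_sub, Prod.snd_sub, ev_sub h]; module
lemma EV_smul (w : ℝ → ℝ) (c : ℂ) (u : A) (X : ℝ) : EV w (c • u) X = c • EV w u X := by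
  simp only [EV, Prod.smul_fst, Prod.smul_snd, ev_smul]; module
lemma EV_inl w (f : L) X : EV w (f, 0) X = ev w f X := by simp [EV, ev, evs_zero]
def mulA (w : ℝ → ℝ) (u v : A) : A :=
  (cv w u.1 v.1 + cv w u.2 v.2 - cv w (Sr w) (cv w u.2 v.2), cv w u.1 v.2 + cv w u.2 v.1)
lemma FS_id X : ((tanh X : ℝ) : ℂ) * ((tanh X : ℝ) : ℂ) = 1 - ((Sf X : ℝ) : ℂ) := by
  rw [Sf]; push_cast; ring
lemma EV_mulA {w} (h : Wt w) u v X : EV w (mulA w u v) X = EV w u X * EV w v X := by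
  simp only [EV, mulA, ev_add h, ev_sub h, ev_cv h, ev_Sr h]
  have := FS_id X
  generalize ((tanh X : ℝ) : ℂ) = t at *
  have hs : ((Sf X : ℝ) : ℂ) = 1 - t * t := by rw [this]; ring
  rw [hs]
  generalize ev w u.1 X = p; generalize ev w u.2 X = q; generalize ev w v.1 X = r; generalize ev w v.2 X = z
  simp only [smul_mul_assoc, one_mul, add_mul, mul_add, mul_smul_comm]
  module
def FA (w : ℝ → ℝ) (u : A) : A := (u.2 - cv w (Sr w) u.2, u.1)
lemma EV_FA {w} (h : Wt w) u X : EV w (FA w u) X = ((tanh X : ℝ) : ℂ) • EV w u X := by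
  simp only [EV, FA, ev_sub h, ev_cv h, ev_Sr h, smul_add, smul_smul, FS_id, smul_mul_assoc, one_mul, sub_smul, one_smul]
  abel
def SL (w : ℝ → ℝ) (u : A) : L := cv w (Sr w) u.1 + cv w (SFr w) u.2
lemma ev_SL {w} (h : Wt w) u X : ev w (SL w u) X = ((Sf X : ℝ) : ℂ) • EV w u X := by
  simp only [EV, SL, ev_add h, ev_cv h, ev_Sr h, ev_SFr h, smul_add, smul_smul, smul_mul_assoc, one_mul]
  push_cast; rw [mul_comm]
def csA (B : E →L[ℂ] E) (u : A) : A := (op (cs B) u.1, op (cs B) u.2)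
lemma ev_cs {w} (h : Wt w) (B : E →L[ℂ] E) (f : L) X : ev w (op (cs B) f) X = B (ev w f X) :=
  evs_op_cs (BCs.wi h) B f X
lemma EV_csA {w} (h : Wt w) (B : E →L[ℂ] E) u X : EV w (csA B u) X = B (EV w u X) := by
  simp only [EV, csA, ev_cs h, map_add, map_smul]
def scA (m : ℝ → ℂ) (u : A) : A := (op (sc m) u.1, op (sc m) u.2)
def iph (δ k : ℝ) : ℂ := (((1 + ph δ k)⁻¹ : ℝ) : ℂ)
def dph (δ k : ℝ) : ℂ := ((δ * (1 + ph δ k) : ℝ) : ℂ)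
section
variable {δ : ℝ} (hδ : 0 ≤ δ)
include hδ
lemma ph1_pos k : 0 < 1 + ph δ k := by linarith [ph_nonneg hδ k]
lemma iph_cont : Continuous (iph δ) := Complex.continuous_ofReal.comp
  ((continuous_const.add (ph_cont hδ)).inv₀ fun k => (ph1_pos hδ k).ne')
lemma iph_norm k : ‖iph δ k‖ ≤ 1 := by
  rw [iph, Complex.norm_real, norm_of_nonneg (inv_nonneg.2 (ph1_pos hδ k).le)]
  exact inv_le_one_of_one_le₀ (by linarith [ph_nonneg hδ k])
lemma dph_cont : Continuous (dph δ) := Complex.continuous_ofReal.comp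
  (continuous_const.mul (continuous_const.add (ph_cont hδ)))
lemma dph_norm k : ‖dph δ k‖ ≤ 1 + δ := by
  rw [dph, Complex.norm_real, norm_of_nonneg (mul_nonneg hδ (ph1_pos hδ k).le)]
  have : δ * ph δ k ≤ 1 := by
    unfold ph; have := mul_nonneg hδ (abs_nonneg k)
    rw [← mul_div_assoc, div_le_one (by positivity)]; linarith
  linarith
lemma wi_iph k : wi W0 k * iph δ k = wi (W1 δ) k := by
  simp only [wi, iph, W0, W1]; push_cast; rw [mul_inv]
lemma wi_dph k : wi (W1 δ) k * dph δ k = (δ : ℂ) * wi W0 k := by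
  have := (ph1_pos hδ k).ne'
  have h2 : (1 + |k|) ^ 3 ≠ 0 := by positivity
  simp only [wi, dph, W0, W1]; rw [← Complex.ofReal_mul, ← Complex.ofReal_mul]; congr 1; field_simp
lemma EV_inc u X : EV W0 (scA (iph δ) u) X = EV (W1 δ) u X := by
  have : ∀ f, ev W0 (op (sc (iph δ)) f) X = ev (W1 δ) f X := fun f => by
    rw [ev, evs_op_sc (BCs.sc (iph_cont hδ) (iph_norm hδ))]; simp only [wi_iph hδ]; rfl
  simp only [EV, scA, this]
lemma EV_up (u : A) (X : ℝ) : EV (W1 δ) (scA (dph δ) u) X = (δ : ℂ) • EV W0 u X := by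
  have : ∀ f, ev (W1 δ) (op (sc (dph δ)) f) X = (δ : ℂ) • ev W0 f X := fun f => by
    rw [ev, evs_op_sc (BCs.sc (dph_cont hδ) (dph_norm hδ)), ev, ← evs_smul_sym]
    simp only [wi_dph hδ]; congr 1; funext k; simp [sc, smul_smul]
  simp only [EV, scA, this]; module
end
lemma Ks_normT {a δ} (ha : 0 < a) (hδ : 0 ≤ δ) k : ‖Ks (ikm (iph δ)) (a * δ) k‖ ≤ 16 + 2 / a := by
  rw [Ks, norm_smul, norm_mul, Complex.norm_I, mul_one, ikm_norm, iph, Complex.norm_real,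
    norm_of_nonneg (inv_nonneg.2 (ph1_pos hδ k).le)]
  have h1 : |k| * (1 + ph δ k)⁻¹ ≤ 1 + δ * |k| := by
    rw [← div_eq_mul_inv, div_le_iff₀ (ph1_pos hδ k), ph]
    have h0 := abs_nonneg k
    have h2 : 0 < 1 + δ * |k| := by positivity
    rw [mul_add, mul_div_cancel₀ _ h2.ne']; linarith
  have h2 := Sop_norm1 (a * δ * k)
  rw [abs_mul, abs_mul, abs_of_pos ha, abs_of_nonneg hδ] at h2
  calc _ ≤ (1 + δ * |k|) * ‖Sop (a * δ * k)‖ := mul_le_mul_of_nonneg_right h1 (norm_nonneg _)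
    _ = ‖Sop (a * δ * k)‖ + (a * δ * |k| * ‖Sop (a * δ * k)‖) / a := by field_simp
    _ ≤ _ := add_le_add (Sop_norm _) (by gcongr)
lemma Ks_normD {a δ : ℝ} (ha : 0 < a) (hδ : 0 ≤ δ) (k : ℝ) : ‖Ks (ikm fun _ => (δ : ℂ)) (a * δ) k‖ ≤ 16 + 2 / a := by
  rw [Ks, norm_smul, norm_mul, Complex.norm_I, mul_one, ikm_norm, Complex.norm_real, norm_of_nonneg hδ]
  have h2 := Sop_norm1 (a * δ * k)
  rw [abs_mul, abs_mul, abs_of_pos ha, abs_of_nonneg hδ] at h2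
  calc _ = (a * δ * |k| * ‖Sop (a * δ * k)‖) / a := by field_simp
    _ ≤ 2 / a := by gcongr
    _ ≤ _ := by linarith
def K1 (a δ : ℝ) (f : L) : L := op (Ks (iph δ) (a * δ)) f
def T1 (a δ : ℝ) (f : L) : L := op (Ks (ikm (iph δ)) (a * δ)) f
def K0 (a δ : ℝ) (f : L) : L := op (Ks 1 (a * δ)) f
def D0 (a δ : ℝ) (f : L) : L := op (Ks (ikm fun _ => (δ : ℂ)) (a * δ)) f
def KA (a δ : ℝ) (u : A) : A :=
  (K1 a δ u.1 + ((a * δ : ℝ) : ℂ) • K0 a δ (cv W0 (Sr W0) (K1 a δ u.2)), K1 a δ u.2)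
def TA (a δ : ℝ) (u : A) : A :=
  (T1 a δ u.1 + cv W0 (Sr W0) (K1 a δ u.2) + (a : ℂ) • D0 a δ (cv W0 (Sr W0) (K1 a δ u.2)), T1 a δ u.2)
section
variable {a δ : ℝ} (ha : 0 < a) (hδ : 0 ≤ δ)
include hδ
lemma ev_K1 (f : L) : ev W0 (K1 a δ f) = evs (Ks (wi (W1 δ)) (a * δ)) f := by
  funext X
  rw [ev, K1, evs_op_Ks (BCs.Ks (iph_cont hδ) (iph_norm hδ) _)]; simp only [wi_iph hδ]
omit hδ in
lemma ev_K0 (f : L) : ev W0 (K0 a δ f) = evs (Ks (wi W0) (a * δ)) f := by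
  funext X
  rw [ev, K0, evs_op_Ks (BCs.Ks (m := 1) (C := 1) continuous_const (by simp) _)]; simp only [Pi.one_apply, mul_one]
include ha
lemma BCsT : BCs (Ks (ikm (iph δ)) (a * δ)) := ⟨Ks_cont (ikm_cont (iph_cont hδ)) _, _, Ks_normT ha hδ⟩
lemma BCsD : BCs (Ks (ikm fun _ => (δ : ℂ)) (a * δ)) := ⟨Ks_cont (ikm_cont continuous_const) _, _, Ks_normD ha hδ⟩
lemma ev_T1 (f : L) X : ev W0 (T1 a δ f) X = evs (Ks (ikm (wi (W1 δ))) (a * δ)) f X := by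
  rw [ev, T1, evs_op_Ks (BCsT ha hδ)]
  congr 2; funext k; rw [ikm, ikm, ← wi_iph hδ]; ring
lemma ev_D0 (f : L) X : ev W0 (D0 a δ f) X = (δ : ℂ) • evs (Ks (ikm (wi W0)) (a * δ)) f X := by
  rw [ev, D0, evs_op_Ks (BCsD ha hδ), ← evs_smul_sym]
  congr 1; funext k; simp only [Ks, smul_smul, ikm]; congr 1; ring
lemma KA_deriv u X : HasDerivAt (EV W0 (KA a δ u)) (EV W0 (TA a δ u) X) X := by
  have e : EV W0 (KA a δ u) = fun X => (evs (Ks (wi (W1 δ)) (a * δ)) u.1 X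
      + ((a * δ : ℝ) : ℂ) • evs (Ks (wi W0) (a * δ)) (cv W0 (Sr W0) (K1 a δ u.2)) X)
      + ((tanh X : ℝ) : ℂ) • evs (Ks (wi (W1 δ)) (a * δ)) u.2 X := by
    funext X
    simp only [EV, KA, ev_add Wt0, ev_smul, ev_K1 hδ, ev_K0]
  rw [e]
  have h1 := Ks_deriv (Nm.wi (Wt1 hδ)) (a * δ) u.1 X
  have h2 := (Ks_deriv (Nm.wi Wt0) (a * δ) (cv W0 (Sr W0) (K1 a δ u.2)) X).const_smul ((a * δ : ℝ) : ℂ)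
  have h3 := ((tanh_hd X).ofReal_comp).smul (Ks_deriv (Nm.wi (Wt1 hδ)) (a * δ) u.2 X)
  refine ((h1.add h2).add h3).congr_deriv ?_
  simp only [EV, TA, ev_add Wt0, ev_smul, ev_T1 ha hδ, ev_D0 ha hδ, ev_cv Wt0, ev_Sr Wt0, ev_K1 hδ, smul_mul_assoc, one_mul]
  push_cast; module
omit ha in
lemma KA_mean u X : meanE (EV W0 (KA a δ u) X) = 0 := by
  simp only [EV, KA, ev_add Wt0, ev_smul, ev_K1 hδ, ev_K0, map_add, map_smul, Ks_mean (Nm.wi Wt0), Ks_mean (Nm.wi (Wt1 hδ)),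
    smul_zero, add_zero]
lemma KA_eq u X : EV W0 (KA a δ u) X - c1 (EV W0 (KA a δ u) X) =
    Jop (Complex.I • (EV (W1 δ) u X - meanE (EV (W1 δ) u X)) + (Complex.I * ((a * δ : ℝ) : ℂ)) • EV W0 (TA a δ u) X) := by
  have h1 := Ks_eq (Nm.wi (Wt1 hδ)) (a * δ) u.1 X
  have h2 := Ks_eq (Nm.wi Wt0) (a * δ) (cv W0 (Sr W0) (K1 a δ u.2)) X
  have h3 := Ks_eq (Nm.wi (Wt1 hδ)) (a * δ) u.2 X
  have h4 := Ks_mean (Nm.wi (Wt1 hδ)) (a * δ) u.2 X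
  have h5 : evs (sc (wi W0)) (cv W0 (Sr W0) (K1 a δ u.2)) X = ((Sf X : ℝ) : ℂ) • evs (Ks (wi (W1 δ)) (a * δ)) u.2 X := by
    have := ev_cv Wt0 (Sr W0) (K1 a δ u.2) X
    rw [ev_Sr Wt0, ev_K1 hδ, smul_mul_assoc, one_mul] at this; exact this
  rw [h5, map_smul, h4, smul_zero, sub_zero] at h2
  have e : ∀ (p q r : E) (t s : ℂ), (p + t • q + s • r) - c1 (p + t • q + s • r) = (p - c1 p) + t • (q - c1 q) + s • (r - c1 r) := by
    intros; simp only [map_add, map_smul]; module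
  simp only [EV, KA, TA, ev_add Wt0, ev_smul, ev_K1 hδ, ev_K0, ev_T1 ha hδ, ev_D0 ha hδ, ev_cv Wt0, ev_Sr Wt0, smul_mul_assoc, one_mul]
  rw [e, h1, h2, h3, ← map_smul Jop, ← map_smul Jop, ← map_add Jop, ← map_add Jop]
  congr 1
  simp only [map_add, map_smul, ev]
  push_cast; module
end
end
section
open MeasureTheory
class HV (V : Type) [NormedAddCommGroup V] [NormedSpace ℂ V] where
  Hm : V → Prop
  add : ∀ {u v}, Hm u → Hm v → Hm (u + v)
  smul : ∀ (r : ℝ) {u}, Hm u → Hm ((r : ℂ) • u)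
  closed : IsClosed {u | Hm u}
  zero : Hm 0
open HV
instance : HV L := ⟨Herm, Herm.add, Herm.smul, Herm.closed, Herm.zero⟩
variable {V W Z : Type} [NormedAddCommGroup V] [NormedSpace ℂ V] [HV V] [NormedAddCommGroup W] [NormedSpace ℂ W] [HV W]
  [NormedAddCommGroup Z] [NormedSpace ℂ Z] [HV Z]
instance : HV (V × W) := ⟨fun u => Hm u.1 ∧ Hm u.2, fun h k => ⟨add h.1 k.1, add h.2 k.2⟩,
  fun r _ h => ⟨smul r h.1, smul r h.2⟩, (closed.preimage continuous_fst).inter (closed.preimage continuous_snd), zero, zero⟩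
lemma Hm_sub {u v : V} (h : Hm u) (k : Hm v) : Hm (u - v) := by
  have := add h (smul (-1) k)
  convert this using 1; push_cast; module
def Ok (ε : ℝ) : Prop := 0 < |ε| ∧ |ε| ≤ 1
def Ul (T : ℝ → V → W) : Prop := ∃ C, 0 ≤ C ∧ ∀ ε, Ok ε → (∀ u v, T ε (u - v) = T ε u - T ε v) ∧
  (∀ u, ‖T ε u‖ ≤ C * ‖u‖) ∧ ∀ u, Hm u → Hm (T ε u)
def Us (T : ℝ → V → W) : Prop := ∃ C, 0 ≤ C ∧ ∀ ε, Ok ε → (∀ u v, T ε (u - v) = T ε u - T ε v) ∧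
  (∀ u, ‖T ε u‖ ≤ C * |ε| * ‖u‖) ∧ ∀ u, Hm u → Hm (T ε u)
def G (j : ℕ) (f : ℝ → V → W) : Prop := (∀ ε, Ok ε → ∀ u, Hm u → Hm (f ε u)) ∧
  ∀ R, ∃ M, 0 ≤ M ∧ ∀ ε, Ok ε → ∀ u v, ‖u‖ ≤ R → ‖v‖ ≤ R →
    ‖f ε u‖ ≤ M ∧ ‖f ε u - f ε v‖ ≤ M * |ε| ^ j * ‖u - v‖
lemma Ul.comp {S : ℝ → W → Z} {T : ℝ → V → W} (hS : Ul S) (hT : Ul T) : Ul fun ε u => S ε (T ε u) := by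
  obtain ⟨C, h0, h⟩ := hS; obtain ⟨D, k0, k⟩ := hT
  refine ⟨C * D, by positivity, fun ε o => ⟨fun u v => ?_, fun u => ?_, fun u hu => (h ε o).2.2 _ ((k ε o).2.2 _ hu)⟩⟩
  · beta_reduce; rw [(k ε o).1, (h ε o).1]
  · rw [mul_assoc]; exact ((h ε o).2.1 _).trans (mul_le_mul_of_nonneg_left ((k ε o).2.1 u) h0)
lemma Ul.add {S T : ℝ → V → W} (hS : Ul S) (hT : Ul T) : Ul fun ε u => S ε u + T ε u := by
  obtain ⟨C, h0, h⟩ := hS; obtain ⟨D, k0, k⟩ := hT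
  refine ⟨C + D, by positivity, fun ε o => ⟨fun u v => ?_, fun u => ?_, fun u hu => HV.add ((h ε o).2.2 _ hu) ((k ε o).2.2 _ hu)⟩⟩
  · beta_reduce; rw [(k ε o).1, (h ε o).1]; abel
  · rw [add_mul]; exact (norm_add_le _ _).trans (add_le_add ((h ε o).2.1 u) ((k ε o).2.1 u))
lemma Ul.smul {T : ℝ → V → W} {r : ℝ → ℝ} {C : ℝ} (hr : ∀ ε, Ok ε → |r ε| ≤ C) (hT : Ul T) :
    Ul fun ε u => ((r ε : ℝ) : ℂ) • T ε u := by
  obtain ⟨D, k0, k⟩ := hT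
  refine ⟨|C| * D, by positivity, fun ε o => ⟨fun u v => ?_, fun u => ?_, fun u hu => HV.smul _ ((k ε o).2.2 _ hu)⟩⟩
  · beta_reduce; rw [(k ε o).1, smul_sub]
  · rw [norm_smul, Complex.norm_real, Real.norm_eq_abs, mul_assoc]
    exact mul_le_mul ((hr ε o).trans (le_abs_self C)) ((k ε o).2.1 u) (norm_nonneg _) (abs_nonneg _)
lemma Ul.csmul {T : ℝ → V → W} (r : ℝ) (hT : Ul T) : Ul fun ε u => (r : ℂ) • T ε u :=
  Ul.smul (r := fun _ => r) (fun _ _ => le_rfl) hT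
lemma Ul.sub {S T : ℝ → V → W} (hS : Ul S) (hT : Ul T) : Ul fun ε u => S ε u - T ε u := by
  have := hS.add (hT.csmul (-1))
  convert this using 3; push_cast; module
lemma Ul.pair {S : ℝ → V → W} {T : ℝ → V → Z} (hS : Ul S) (hT : Ul T) : Ul fun ε u => (S ε u, T ε u) := by
  obtain ⟨C, h0, h⟩ := hS; obtain ⟨D, k0, k⟩ := hT
  refine ⟨C + D, by positivity, fun ε o => ⟨fun u v => ?_, fun u => ?_, fun u hu => ⟨(h ε o).2.2 _ hu, (k ε o).2.2 _ hu⟩⟩⟩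
  · beta_reduce; rw [(k ε o).1, (h ε o).1]; rfl
  · rw [Prod.norm_def]
    have := norm_nonneg u
    exact max_le (((h ε o).2.1 u).trans (by nlinarith)) (((k ε o).2.1 u).trans (by nlinarith))
lemma Ul.id : Ul fun (_ : ℝ) (u : V) => u := ⟨1, zero_le_one, fun _ _ => ⟨fun _ _ => rfl, fun u => by simp, fun _ h => h⟩⟩
lemma Ul.fst : Ul fun (_ : ℝ) (u : V × W) => u.1 := ⟨1, zero_le_one, fun _ _ => ⟨fun _ _ => rfl, fun u => by
  rw [one_mul]; exact norm_fst_le u, fun _ h => h.1⟩⟩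
lemma Ul.snd : Ul fun (_ : ℝ) (u : V × W) => u.2 := ⟨1, zero_le_one, fun _ _ => ⟨fun _ _ => rfl, fun u => by
  rw [one_mul]; exact norm_snd_le u, fun _ h => h.2⟩⟩
lemma G.zero1 {f : ℝ → V → W} (hf : G 1 f) : G 0 f := ⟨hf.1, fun R => by
  obtain ⟨M, m0, hM⟩ := hf.2 R
  refine ⟨M, m0, fun ε o u v hu hv => ⟨(hM ε o u v hu hv).1, (hM ε o u v hu hv).2.trans ?_⟩⟩
  have := o.2
  rw [pow_zero, pow_one]; gcongr⟩
lemma G.add {j} {f g : ℝ → V → W} (hf : G j f) (hg : G j g) : G j fun ε u => f ε u + g ε u :=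
  ⟨fun ε o u h => HV.add (hf.1 ε o u h) (hg.1 ε o u h), fun R => by
  obtain ⟨M, m0, hM⟩ := hf.2 R; obtain ⟨N, n0, hN⟩ := hg.2 R
  refine ⟨M + N, by positivity, fun ε o u v hu hv => ?_⟩
  obtain ⟨a, b⟩ := hM ε o u v hu hv; obtain ⟨c, d⟩ := hN ε o u v hu hv
  refine ⟨(norm_add_le _ _).trans (add_le_add a c), ?_⟩
  rw [add_sub_add_comm, add_mul, add_mul]; exact (norm_add_le _ _).trans (add_le_add b d)⟩
lemma G.lin {j} {f : ℝ → V → W} {T : ℝ → W → Z} (hf : G j f) (hT : Ul T) : G j fun ε u => T ε (f ε u) := by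
  obtain ⟨C, h0, h⟩ := hT
  refine ⟨fun ε o u hu => (h ε o).2.2 _ (hf.1 ε o u hu), fun R => ?_⟩
  obtain ⟨M, m0, hM⟩ := hf.2 R
  refine ⟨C * M, by positivity, fun ε o u v hu hv => ?_⟩
  obtain ⟨a, b⟩ := hM ε o u v hu hv
  refine ⟨((h ε o).2.1 _).trans (by gcongr), ?_⟩
  rw [← (h ε o).1, mul_assoc C, mul_assoc C]; exact ((h ε o).2.1 _).trans (by gcongr)
lemma G.slin {f : ℝ → V → W} {T : ℝ → W → Z} (hf : G 0 f) (hT : Us T) : G 1 fun ε u => T ε (f ε u) := by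
  obtain ⟨C, h0, h⟩ := hT
  refine ⟨fun ε o u hu => (h ε o).2.2 _ (hf.1 ε o u hu), fun R => ?_⟩
  obtain ⟨M, m0, hM⟩ := hf.2 R
  refine ⟨C * M, by positivity, fun ε o u v hu hv => ?_⟩
  obtain ⟨a, b⟩ := hM ε o u v hu hv
  have e1 := o.2
  have e0 := abs_nonneg ε
  refine ⟨((h ε o).2.1 _).trans ?_, ?_⟩
  · calc C * |ε| * ‖f ε u‖ ≤ C * 1 * M := by gcongr
      _ = _ := by ring
  · rw [← (h ε o).1]; refine ((h ε o).2.1 _).trans ?_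
    calc C * |ε| * ‖f ε u - f ε v‖ ≤ C * |ε| * (M * |ε| ^ 0 * ‖u - v‖) := by gcongr
      _ = _ := by ring
lemma G.smul {j : ℕ} {f : ℝ → V → W} {r : ℝ → ℝ} {C : ℝ} (hr : ∀ ε, Ok ε → |r ε| ≤ C) (hf : G j f) :
    G j fun ε u => ((r ε : ℝ) : ℂ) • f ε u := hf.lin (T := fun ε u => ((r ε : ℝ) : ℂ) • u) (Ul.smul hr Ul.id)
lemma G.csmul {j : ℕ} {f : ℝ → V → W} (r : ℝ) (hf : G j f) : G j fun ε u => (r : ℂ) • f ε u :=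
  G.smul (r := fun _ => r) (fun _ _ => le_rfl) hf
lemma Us.eps {r : ℝ → ℝ} {C : ℝ} (hr : ∀ ε, Ok ε → |r ε| ≤ C * |ε|) : Us fun ε (u : V) => ((r ε : ℝ) : ℂ) • u :=
  ⟨|C|, abs_nonneg C, fun ε o => ⟨fun u v => smul_sub _ _ _, fun u => by
    rw [norm_smul, Complex.norm_real, Real.norm_eq_abs]
    exact mul_le_mul_of_nonneg_right ((hr ε o).trans (mul_le_mul_of_nonneg_right (le_abs_self C) (abs_nonneg _))) (norm_nonneg _),
    fun u hu => HV.smul _ hu⟩⟩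
lemma G.ssmul {f : ℝ → V → W} {r : ℝ → ℝ} {C : ℝ} (hr : ∀ ε, Ok ε → |r ε| ≤ C * |ε|) (hf : G 0 f) :
    G 1 fun ε u => ((r ε : ℝ) : ℂ) • f ε u := hf.slin (Us.eps hr)
lemma G.eps {f : ℝ → V → W} (hf : G 0 f) : G 1 fun ε u => (ε : ℂ) • f ε u :=
  G.ssmul (r := fun ε => ε) (C := 1) (fun ε _ => by simp) hf
lemma G.sub {j} {f g : ℝ → V → W} (hf : G j f) (hg : G j g) : G j fun ε u => f ε u - g ε u := by
  have := hf.add (hg.csmul (-1))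
  convert this using 3; push_cast; module
lemma G.pair {j} {f : ℝ → V → W} {g : ℝ → V → Z} (hf : G j f) (hg : G j g) : G j fun ε u => (f ε u, g ε u) :=
  ⟨fun ε o u h => ⟨hf.1 ε o u h, hg.1 ε o u h⟩, fun R => by
  obtain ⟨M, m0, hM⟩ := hf.2 R; obtain ⟨N, n0, hN⟩ := hg.2 R
  refine ⟨M + N, by positivity, fun ε o u v hu hv => ?_⟩
  obtain ⟨a, b⟩ := hM ε o u v hu hv; obtain ⟨c, d⟩ := hN ε o u v hu hv
  have h1 := mul_nonneg (mul_nonneg m0 (pow_nonneg (abs_nonneg ε) j)) (norm_nonneg (u - v))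
  have h2 := mul_nonneg (mul_nonneg n0 (pow_nonneg (abs_nonneg ε) j)) (norm_nonneg (u - v))
  refine ⟨max_le (a.trans (by linarith)) (c.trans (by linarith)), ?_⟩
  rw [add_mul, add_mul, Prod.mk_sub_mk]
  exact max_le (b.trans (by linarith)) (d.trans (by linarith))⟩
lemma G.fst {j} {f : ℝ → V → W × Z} (hf : G j f) : G j fun ε u => (f ε u).1 := hf.lin Ul.fst
lemma G.snd {j} {f : ℝ → V → W × Z} (hf : G j f) : G j fun ε u => (f ε u).2 := hf.lin Ul.snd
lemma G.of_ul {T : ℝ → V → W} (hT : Ul T) : G 0 T := by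
  obtain ⟨C, h0, h⟩ := hT
  refine ⟨fun ε o => (h ε o).2.2, fun R => ⟨C * |R| + C, by positivity, fun ε o u v hu hv => ⟨?_, ?_⟩⟩⟩
  · refine ((h ε o).2.1 u).trans ?_
    have : C * ‖u‖ ≤ C * |R| := by gcongr; exact hu.trans (le_abs_self R)
    linarith
  · rw [← (h ε o).1, pow_zero, mul_one]; refine ((h ε o).2.1 _).trans ?_
    gcongr; have : 0 ≤ C * |R| := by positivity
    linarith
lemma G.const {j} {c : ℝ → W} {C} (hc : ∀ ε, Ok ε → Hm (c ε) ∧ ‖c ε‖ ≤ C) : G j fun ε (_ : V) => c ε :=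
  ⟨fun ε o _ _ => (hc ε o).1, fun R => ⟨|C|, abs_nonneg _, fun ε o u v _ _ => ⟨(hc ε o).2.trans (le_abs_self C), by
    rw [sub_self, norm_zero]; positivity⟩⟩⟩
def Ub (B : ℝ → V → W → Z) : Prop := ∃ C, 0 ≤ C ∧ ∀ ε, Ok ε → (∀ u v w, B ε (u - v) w = B ε u w - B ε v w) ∧
  (∀ u v w, B ε u (v - w) = B ε u v - B ε u w) ∧ (∀ u v, ‖B ε u v‖ ≤ C * (‖u‖ * ‖v‖)) ∧ ∀ u v, Hm u → Hm v → Hm (B ε u v)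
lemma G.bil {Y : Type} [NormedAddCommGroup Y] [NormedSpace ℂ Y] [HV Y] {j} {B : ℝ → W → Z → Y} (hB : Ub B)
    {f : ℝ → V → W} {g : ℝ → V → Z} (hf : G j f) (hg : G j g) : G j fun ε u => B ε (f ε u) (g ε u) := by
  obtain ⟨C, h0, h⟩ := hB
  refine ⟨fun ε o u hu => (h ε o).2.2.2 _ _ (hf.1 ε o u hu) (hg.1 ε o u hu), fun R => ?_⟩
  obtain ⟨M, m0, hM⟩ := hf.2 R; obtain ⟨N, n0, hN⟩ := hg.2 R
  refine ⟨2 * (C * (M * N)), by positivity, fun ε o u v hu hv => ?_⟩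
  obtain ⟨a, b⟩ := hM ε o u v hu hv; obtain ⟨c, d⟩ := hN ε o u v hu hv
  have a' := (hM ε o v u hv hu).1
  have nn := (h ε o).2.2.1
  constructor
  · refine (nn _ _).trans ?_
    have : C * (‖f ε u‖ * ‖g ε u‖) ≤ C * (M * N) := by gcongr
    have : 0 ≤ C * (M * N) := by positivity
    linarith
  · have e : B ε (f ε u) (g ε u) - B ε (f ε v) (g ε v) = B ε (f ε u - f ε v) (g ε u) + B ε (f ε v) (g ε u - g ε v) := by
      rw [(h ε o).1, (h ε o).2.1]; abel
    rw [e]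
    have h1 : ‖B ε (f ε u - f ε v) (g ε u)‖ ≤ C * ((M * |ε| ^ j * ‖u - v‖) * N) := (nn _ _).trans (by gcongr)
    have h2 : ‖B ε (f ε v) (g ε u - g ε v)‖ ≤ C * (M * (N * |ε| ^ j * ‖u - v‖)) := (nn _ _).trans (by gcongr)
    refine (norm_add_le _ _).trans ((add_le_add h1 h2).trans (le_of_eq (by ring)))
def FamS (M : ℝ → Sym) : Prop := ∃ C, ∀ ε, Ok ε → Continuous (M ε) ∧ (∀ k, ‖M ε k‖ ≤ C) ∧ HS (M ε)
lemma Ul.op {M : ℝ → Sym} (h : FamS M) : Ul fun ε (f : L) => op (M ε) f := by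
  obtain ⟨C, h⟩ := h
  refine ⟨|C|, abs_nonneg C, fun ε o => ⟨fun u v => map_sub _ _ _, fun u => ?_, fun u hu => ?_⟩⟩
  · exact ((Bore.op (M ε)).le_opNorm u).trans (mul_le_mul_of_nonneg_right
      (op_norm_le (h ε o).1 fun k => ((h ε o).2.1 k).trans (le_abs_self C)) (norm_nonneg _))
  · exact Herm.op ⟨(h ε o).1, C, (h ε o).2.1⟩ (h ε o).2.2 hu
lemma Us.op {M : ℝ → Sym} {C} (h : ∀ ε, Ok ε → Continuous (M ε) ∧ (∀ k, ‖M ε k‖ ≤ C * |ε|) ∧ HS (M ε)) :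
    Us fun ε (f : L) => op (M ε) f := by
  refine ⟨|C|, abs_nonneg C, fun ε o => ⟨fun u v => map_sub _ _ _, fun u => ?_, fun u hu => ?_⟩⟩
  · exact ((Bore.op (M ε)).le_opNorm u).trans (mul_le_mul_of_nonneg_right
      (op_norm_le (h ε o).1 fun k => ((h ε o).2.1 k).trans (mul_le_mul_of_nonneg_right (le_abs_self C) (abs_nonneg _))) (norm_nonneg _))
  · exact Herm.op ⟨(h ε o).1, _, (h ε o).2.1⟩ (h ε o).2.2 hu
lemma HS.sc {m : ℝ → ℂ} (h : ∀ k, star (m k) = m (-k)) : HS (sc m) := fun k e => by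
  simp only [sc_apply, theta_smul, h]
lemma HS.Ks {m : ℝ → ℂ} (h : ∀ k, star (m k) = m (-k)) a : HS (Ks m a) := fun k e => by
  simp only [Bore.Ks, _root_.smul_apply, theta_smul, star_mul, h, Sop_theta, mul_neg]
  simp only [smul_neg, Complex.star_def, Complex.conj_I, neg_mul, neg_smul, neg_neg, mul_comm]
lemma HS.cs {B : E →L[ℂ] E} (h : ∀ e, theta (B e) = B (theta e)) : HS (cs B) := fun _ e => h e
lemma Fam.cs {B : E →L[ℂ] E} (h : ∀ e, theta (B e) = B (theta e)) : FamS fun _ => cs B :=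
  ⟨‖B‖, fun _ _ => ⟨continuous_const, fun _ => le_rfl, HS.cs h⟩⟩
lemma Fam.sc {m : ℝ → ℝ → ℂ} {C} (h : ∀ ε, Ok ε → Continuous (m ε) ∧ (∀ k, ‖m ε k‖ ≤ C) ∧ ∀ k, star (m ε k) = m ε (-k)) :
    FamS fun ε => sc (m ε) :=
  ⟨C, fun ε o => ⟨sc_cont (h ε o).1, fun k => (sc_norm k).trans ((h ε o).2.1 k), HS.sc (h ε o).2.2⟩⟩
lemma Ul.pm {T : ℝ → L → L} (h : Ul T) : Ul fun ε (u : A) => ((T ε u.1, T ε u.2) : A) :=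
  (h.comp (T := fun _ (u : A) => u.1) Ul.fst).pair (h.comp (T := fun _ (u : A) => u.2) Ul.snd)
lemma Ul.csA {B : E →L[ℂ] E} (h : ∀ e, theta (B e) = B (theta e)) : Ul fun _ (u : A) => csA B u := (Ul.op (Fam.cs h)).pm
lemma Ul.scA {m : ℝ → ℝ → ℂ} {C} (h : ∀ ε, Ok ε → Continuous (m ε) ∧ (∀ k, ‖m ε k‖ ≤ C) ∧ ∀ k, star (m ε k) = m ε (-k)) :
    Ul fun ε (u : A) => scA (m ε) u := (Ul.op (Fam.sc h)).pm
def WF (w : ℝ → ℝ → ℝ) : Prop := ∀ ε, Ok ε → Wt (w ε)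
lemma Ub.cv {w : ℝ → ℝ → ℝ} (h : WF w) : Ub fun ε (f g : L) => cv (w ε) f g :=
  ⟨1, zero_le_one, fun ε o => ⟨cv_sub_left (h ε o), cv_sub_right (h ε o), fun u v => by rw [one_mul]; exact cv_norm (h ε o) u v,
    fun _ _ hu hv => Herm.cv (h ε o) hu hv⟩⟩
lemma Ub.left {B : ℝ → V → W → Z} (h : Ub B) {c : ℝ → V} {C} (hc : ∀ ε, Ok ε → Hm (c ε) ∧ ‖c ε‖ ≤ C) :
    Ul fun ε u => B ε (c ε) u := by
  obtain ⟨D, d0, h⟩ := h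
  refine ⟨D * |C|, by positivity, fun ε o => ⟨(h ε o).2.1 _, fun u => ((h ε o).2.2.1 _ _).trans ?_, fun u hu => (h ε o).2.2.2 _ _ (hc ε o).1 hu⟩⟩
  rw [mul_assoc]; gcongr; exact (hc ε o).2.trans (le_abs_self C)
lemma Ul.S {w : ℝ → ℝ → ℝ} (h : WF w) : Ul fun ε (f : L) => cv (w ε) (Sr (w ε)) f :=
  (Ub.cv h).left fun ε o => ⟨Sr_herm (h ε o), Sr_norm (h ε o)⟩
lemma Ul.SF {w : ℝ → ℝ → ℝ} (h : WF w) : Ul fun ε (f : L) => cv (w ε) (SFr (w ε)) f :=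
  (Ub.cv h).left fun ε o => ⟨SFr_herm (h ε o), SFr_norm (h ε o)⟩
lemma Ul.FA {w : ℝ → ℝ → ℝ} (h : WF w) : Ul fun ε (u : A) => FA (w ε) u :=
  ((Ul.sub (S := fun _ (u : A) => u.2) Ul.snd ((Ul.S h).comp Ul.snd))).pair Ul.fst
lemma Ul.SL {w : ℝ → ℝ → ℝ} (h : WF w) : Ul fun ε (u : A) => SL (w ε) u :=
  ((Ul.S h).comp (T := fun _ (u : A) => u.1) Ul.fst).add ((Ul.SF h).comp (T := fun _ (u : A) => u.2) Ul.snd)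
lemma G.mulA {j : ℕ} {w : ℝ → ℝ → ℝ} (h : WF w) {f g : ℝ → V → A} (hf : G j f) (hg : G j g) :
    G j fun ε u => mulA (w ε) (f ε u) (g ε u) := by
  have b := Ub.cv h
  exact (((G.bil b hf.fst hg.fst).add (G.bil b hf.snd hg.snd)).sub ((G.bil b hf.snd hg.snd).lin (Ul.S h))).pair
    ((G.bil b hf.fst hg.snd).add (G.bil b hf.snd hg.fst))
lemma theta_trE' e : theta (trE e) = trE (theta e) := by first | exact trE_theta e | exact (trE_theta e).symm
lemma theta_meanE' e : theta (meanE e) = meanE (theta e) := by first | exact meanE_theta e | exact (meanE_theta e).symm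
lemma theta_mI e : theta (mI e) = mI (theta e) := by rw [mI_apply, mI_apply, theta_mul, theta_isE]
section
variable {lam a : ℝ} (hl : 0 < lam) (ha : 0 < a)
include hl
lemma dnn ε : 0 ≤ lam * |ε| := by positivity
lemma WF1 : WF fun ε => W1 (lam * |ε|) := fun ε _ => Wt1 (dnn hl ε)
omit hl in
lemma WF0 : WF fun _ => W0 := fun _ _ => Wt0
lemma Ul.inc : Ul fun ε (u : A) => Bore.scA (iph (lam * |ε|)) u := Ul.scA (C := 1) fun ε _ =>
  ⟨iph_cont (dnn hl ε), iph_norm (dnn hl ε), fun k => by simp [iph, ph]⟩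
lemma Ul.up : Ul fun ε (u : A) => Bore.scA (dph (lam * |ε|)) u := Ul.scA (C := 1 + lam) fun ε o =>
  ⟨dph_cont (dnn hl ε), fun k => (dph_norm (dnn hl ε) k).trans (by nlinarith [o.2]), fun k => by simp [dph, ph]⟩
include ha
lemma Ul.K1 : Ul fun ε (u : L) => Bore.K1 a (lam * |ε|) u := Ul.op ⟨16, fun ε _ =>
  ⟨Ks_cont (iph_cont (dnn hl ε)) _, fun k => (Ks_norm k).trans (by linarith [iph_norm (dnn hl ε) k]), HS.Ks (fun k => by simp [iph, ph]) _⟩⟩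
lemma Ul.K0 : Ul fun ε (u : L) => Bore.K0 a (lam * |ε|) u := Ul.op ⟨16, fun ε _ =>
  ⟨Ks_cont continuous_const _, fun k => (Ks_norm k).trans (by simp), HS.Ks (fun k => by simp) _⟩⟩
lemma Ul.T1 : Ul fun ε (u : L) => Bore.T1 a (lam * |ε|) u := Ul.op ⟨16 + 2 / a, fun ε _ =>
  ⟨Ks_cont (ikm_cont (iph_cont (dnn hl ε))) _, Ks_normT ha (dnn hl ε), HS.Ks (fun k => by simp [ikm, iph, ph]) _⟩⟩
lemma Ul.D0 : Ul fun ε (u : L) => Bore.D0 a (lam * |ε|) u := Ul.op ⟨16 + 2 / a, fun ε _ =>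
  ⟨Ks_cont (ikm_cont continuous_const) _, Ks_normD ha (dnn hl ε), HS.Ks (fun k => by simp [ikm]) _⟩⟩
lemma Ul.SK : Ul fun ε (u : L) => Bore.cv W0 (Sr W0) (Bore.K1 a (lam * |ε|) u) := (Ul.S WF0).comp (Ul.K1 hl ha)
lemma Ul.KA : Ul fun ε (u : A) => Bore.KA a (lam * |ε|) u :=
  Ul.pair (((Ul.K1 hl ha).comp Ul.fst).add (Ul.smul (r := fun ε => a * (lam * |ε|)) (C := a * lam) (fun ε o => by
    rw [abs_of_nonneg (mul_nonneg ha.le (dnn hl ε))]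
    have := mul_pos ha hl; nlinarith [o.2]) ((Ul.K0 hl ha).comp ((Ul.SK hl ha).comp Ul.snd)))) ((Ul.K1 hl ha).comp Ul.snd)
lemma Ul.TA : Ul fun ε (u : A) => Bore.TA a (lam * |ε|) u :=
  Ul.pair ((((Ul.T1 hl ha).comp Ul.fst).add ((Ul.SK hl ha).comp Ul.snd)).add (Ul.csmul a
    ((Ul.D0 hl ha).comp ((Ul.SK hl ha).comp Ul.snd)))) ((Ul.T1 hl ha).comp Ul.snd)
end
lemma EV_norm {w} (h : Wt w) u X : ‖EV w u X‖ ≤ 2 * ‖u‖ := by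
  have h1 := (ev_norm h u.1 X).trans (norm_fst_le u)
  have h2 := (ev_norm h u.2 X).trans (norm_snd_le u)
  have h3 : ‖((tanh X : ℝ) : ℂ) • ev w u.2 X‖ ≤ 1 * ‖u‖ := by
    rw [norm_smul, Complex.norm_real, Real.norm_eq_abs]
    exact mul_le_mul (tanh_abs X) h2 (norm_nonneg _) zero_le_one
  refine (norm_add_le _ _).trans ?_; linarith
lemma EV_theta {w} (h : Wt w) {u} (hu : Hm u) X : theta (EV w u X) = EV w u X := by
  rw [EV, theta_add, theta_smul, ev_theta h hu.1, ev_theta h hu.2, Complex.star_def, Complex.conj_ofReal]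
lemma ev_contDiff {w} (h : Wt w) (f : L) : ContDiff ℝ 3 (ev w f) := by
  refine BCs.contDiff_aux 3 _ (fun j hj => ?_) f
  have e : ∀ j, Dsym^[j] (sc (wi w)) = sc (ikm^[j] (wi w)) := by
    intro j; induction j with
    | zero => rfl
    | succ n ih => rw [Function.iterate_succ_apply', ih, Dsym_sc, Function.iterate_succ_apply']
  have hc : ∀ j, Continuous (ikm^[j] (wi w)) := by
    intro j; induction j with
    | zero => exact wi_cont h
    | succ n ih => rw [Function.iterate_succ_apply']; exact ikm_cont ih
  obtain ⟨C, hC⟩ := (Nm.wi h).C0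
  rw [e]
  refine BCs.sc (C := C) (hc j) fun k => ?_
  have hn : ∀ j, ‖ikm^[j] (wi w) k‖ = |k| ^ j * ‖wi w k‖ := by
    intro j; induction j with
    | zero => simp
    | succ n ih => rw [Function.iterate_succ_apply', ikm_norm, ih]; ring
  rw [hn]
  interval_cases j
  · simpa using (hC k).1
  · simpa using (hC k).2.1
  · exact (hC k).2.2.1
  · exact (hC k).2.2.2
lemma tanh_cd {n : ℕ∞} : ContDiff ℝ n tanh := by
  have : tanh = fun x => sinh x / cosh x := by funext x; exact tanh_eq_sinh_div_cosh x
  rw [this]; exact contDiff_sinh.div contDiff_cosh fun x => (cosh_pos x).ne'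
lemma EV_contDiff {w} (h : Wt w) u : ContDiff ℝ 3 (EV w u) := by
  have h1 := ev_contDiff h u.1
  have h2 := ev_contDiff h u.2
  have h3 : ContDiff ℝ 3 fun X => ((tanh X : ℝ) : ℂ) := Complex.ofRealCLM.contDiff.comp (tanh_cd (n := 3))
  exact h1.add (h3.smul h2)
lemma EV_tendsto w u : Tendsto (EV w u) (cocompact ℝ) (nhds 0) := by
  have h1 := evs_tendsto (sc (wi w)) u.1
  have h2 : Tendsto (fun X => ((tanh X : ℝ) : ℂ) • ev w u.2 X) (cocompact ℝ) (nhds 0) := by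
    refine squeeze_zero_norm (a := fun X => ‖ev w u.2 X‖) (fun X => ?_) (by
      have := (evs_tendsto (sc (wi w)) u.2).norm; rw [norm_zero] at this; exact this)
    rw [norm_smul, Complex.norm_real, Real.norm_eq_abs]
    exact mul_le_of_le_one_left (norm_nonneg _) (tanh_abs X)
  have := h1.add h2; rw [add_zero] at this; exact this
lemma EV_hd {w} (h : Wt w) u X : HasDerivAt (EV w u) (deriv (EV w u) X) X :=
  ((EV_contDiff h u).differentiable (by norm_num) X).hasDerivAt
def at0 (e : E) : L := op (cs (Lmul e)) (Sr W0)
lemma ev_at0 e X : ev W0 (at0 e) X = ((Sf X : ℝ) : ℂ) • e := by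
  rw [at0, ev_cs Wt0, ev_Sr Wt0]; simp [Lmul]
lemma at0_norm e : ‖at0 e‖ ≤ ‖e‖ * shK := by
  refine ((op _).le_opNorm _).trans (mul_le_mul ?_ (Sr_norm Wt0) (norm_nonneg _) (norm_nonneg _))
  exact op_norm_le continuous_const fun k => ContinuousLinearMap.opNorm_mul_apply_le ℂ E e
lemma at0_sub e f : at0 (e - f) = at0 e - at0 f := by
  rw [at0, at0, at0]
  apply Lp.ext
  filter_upwards [op_coe (BCs.cs (Lmul (e - f))) (Sr W0), op_coe (BCs.cs (Lmul e)) (Sr W0), op_coe (BCs.cs (Lmul f)) (Sr W0),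
    Lp.coeFn_sub (op (cs (Lmul e)) (Sr W0)) (op (cs (Lmul f)) (Sr W0))] with k h1 h2 h3 h4
  rw [h1, h4, Pi.sub_apply, h2, h3]; simp [cs]
lemma at0_herm {e} (he : theta e = e) : Herm (at0 e) :=
  Herm.op (BCs.cs _) (HS.cs fun x => by simp only [Lmul, ContinuousLinearMap.mul_apply', theta_mul, he]) (Sr_herm Wt0)
lemma Ul.at0 : Ul fun _ (u : A) => at0 (EV W0 u 0) := by
  have hs : 0 ≤ shK := (norm_nonneg _).trans (Sr_norm Wt0)
  refine ⟨2 * shK, by positivity, fun ε _ => ⟨fun u v => ?_, fun u => ?_, fun u hu => at0_herm (EV_theta Wt0 hu 0)⟩⟩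
  · beta_reduce; rw [EV_sub Wt0, at0_sub]
  · refine (at0_norm _).trans ?_
    have := EV_norm Wt0 u 0
    nlinarith
end
section
open MeasureTheory
structure Pr where
  a : ℝ
  b : ℝ
  p : ℝ
  q : ℝ
  l : ℝ
  ha : 0 < a
  ha1 : a ≤ 1
  hb : 0 < b
  hb1 : b ≤ 1
  hp : 0 ≤ p
  hq : 0 ≤ q
  hpq : p + q = 3
  hl : 0 < l
section
variable (P : Pr) (δ : ℝ)
def DD (k : ℝ) : ℝ := P.p * dR (P.a * δ * k) + P.q * dR (P.b * δ * k)
def PP (k : ℝ) : ℝ := (4 + k ^ 2 * DD P δ k)⁻¹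
def pq (k : ℝ) : ℂ := (((1 + ph δ k) * PP P δ k : ℝ) : ℂ)
lemma DD_cont : Continuous (DD P δ) := by have := dR_cont; unfold DD; fun_prop
lemma DD_nonneg k : 0 ≤ DD P δ k :=
  add_nonneg (mul_nonneg P.hp (dR_pos _).le) (mul_nonneg P.hq (dR_pos _).le)
lemma DD_le k : DD P δ k ≤ 48 := by
  have := P.hp; have := P.hq; have := P.hpq
  unfold DD; nlinarith [dR_le (P.a * δ * k), dR_le (P.b * δ * k)]
lemma DD_neg k : DD P δ (-k) = DD P δ k := by simp only [DD, mul_neg, dR_neg]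
lemma PP_den k : 4 ≤ 4 + k ^ 2 * DD P δ k := by nlinarith [mul_nonneg (sq_nonneg k) (DD_nonneg P δ k)]
lemma PP_pos k : 0 < PP P δ k := inv_pos.2 (by linarith [PP_den P δ k])
lemma PP_cont : Continuous (PP P δ) :=
  (continuous_const.add ((continuous_pow 2).mul (DD_cont P δ))).inv₀ fun k => by
    exact (by linarith [PP_den P δ k] : (0:ℝ) < 4 + k ^ 2 * DD P δ k).ne'
lemma PP_id k : (4 + k ^ 2 * DD P δ k) * PP P δ k = 1 := mul_inv_cancel₀ (by linarith [PP_den P δ k])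
variable {δ} (hδ : 0 ≤ δ)
include hδ
lemma DD_lip k : |1 - DD P δ k| ≤ 768 * (δ * |k|) := by
  have key : ∀ a : ℝ, 0 < a → a ≤ 1 → |1 / 3 - dR (a * δ * k)| ≤ 256 * (δ * |k|) := fun a h0 h1 => by
    have := dR_lip 0 (a * δ * k)
    rw [dR_zero, zero_sub, abs_neg, abs_mul, abs_mul, abs_of_pos h0, abs_of_nonneg hδ] at this
    have h2 : 0 ≤ δ * |k| := mul_nonneg hδ (abs_nonneg k)
    nlinarith
  have e : 1 - DD P δ k = P.p * (1 / 3 - dR (P.a * δ * k)) + P.q * (1 / 3 - dR (P.b * δ * k)) := by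
    unfold DD; linear_combination (-1 / 3 : ℝ) * P.hpq
  rw [e]
  refine (abs_add_le _ _).trans ?_
  rw [abs_mul, abs_mul, abs_of_nonneg P.hp, abs_of_nonneg P.hq]
  have h1 := mul_le_mul_of_nonneg_left (key _ P.ha P.ha1) P.hp
  have h2 := mul_le_mul_of_nonneg_left (key _ P.hb P.hb1) P.hq
  calc _ ≤ (P.p + P.q) * (256 * (δ * |k|)) := by linarith
    _ = _ := by rw [P.hpq]; ring
lemma DD_low k : 3 * dlow / (1 + δ * |k|) ≤ DD P δ k := by
  have h2 : 0 ≤ δ * |k| := mul_nonneg hδ (abs_nonneg k)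
  have key : ∀ a : ℝ, 0 < a → a ≤ 1 → dlow / (1 + δ * |k|) ≤ dR (a * δ * k) := fun a h0 h1 => by
    have := dR_low (a * δ * k)
    rw [abs_mul, abs_mul, abs_of_pos h0, abs_of_nonneg hδ] at this
    rw [div_le_iff₀ (by positivity)]
    have := dR_pos (a * δ * k)
    nlinarith [mul_nonneg (mul_nonneg h2 (sub_nonneg.2 h1)) this.le]
  have h1 := mul_le_mul_of_nonneg_left (key _ P.ha P.ha1) P.hp
  have h3 := mul_le_mul_of_nonneg_left (key _ P.hb P.hb1) P.hq
  unfold DD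
  calc _ = (P.p + P.q) * (dlow / (1 + δ * |k|)) := by rw [P.hpq]; ring
    _ ≤ _ := by linarith
def pK (P : Pr) : ℝ := 3 + (3 + 2 * P.l) / (3 * dlow)
lemma PP_bd (hδ' : δ ≤ P.l) k : (1 + ph δ k) * (1 + |k|) * PP P δ k ≤ pK P := by
  have h0 := abs_nonneg k
  have h2 : 0 ≤ δ * |k| := mul_nonneg hδ h0
  have hd := dlow_pos
  have hl := P.hl
  have hD : 0 < 1 + δ * |k| := by positivity
  set z := |k| ^ 2 / (1 + δ * |k|) with hz
  have z0 : 0 ≤ z := by positivity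
  have h1 : |k| ≤ 1 + (1 + P.l) * z := by
    rw [hz, ← sub_nonneg]
    have : 1 + (1 + P.l) * (|k| ^ 2 / (1 + δ * |k|)) - |k| = (1 + δ * |k| + (1 + P.l) * |k| ^ 2 - |k| * (1 + δ * |k|)) / (1 + δ * |k|) := by
      field_simp
    rw [this]; apply div_nonneg _ hD.le
    nlinarith [mul_nonneg (sub_nonneg.2 hδ') (sq_nonneg |k|), sq_nonneg (|k| - 1)]
  have h3 : (1 + ph δ k) * (1 + |k|) ≤ 3 + (3 + 2 * P.l) * z := by
    have e1 : ph δ k * |k| = z := by rw [ph, hz]; ring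
    have := ph_le hδ k
    nlinarith
  have h4 : 3 * dlow * z ≤ k ^ 2 * DD P δ k := by
    have := mul_le_mul_of_nonneg_left (DD_low P hδ k) (sq_nonneg k)
    rw [← sq_abs] at this ⊢
    refine le_trans (le_of_eq ?_) this
    rw [hz]; ring
  have h5 : z ≤ k ^ 2 * DD P δ k / (3 * dlow) := by rw [le_div_iff₀ (by positivity)]; linarith
  have hp := PP_pos P δ k
  have h6 : (1 + ph δ k) * (1 + |k|) ≤ pK P * (4 + k ^ 2 * DD P δ k) := by
    refine h3.trans ?_
    have h7 := mul_le_mul_of_nonneg_left h5 (show 0 ≤ 3 + 2 * P.l by linarith)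
    have h8 : (3 + 2 * P.l) * (k ^ 2 * DD P δ k / (3 * dlow)) = (3 + 2 * P.l) / (3 * dlow) * (k ^ 2 * DD P δ k) := by ring
    have h9 : 0 ≤ (3 + 2 * P.l) / (3 * dlow) := by positivity
    have h10 := mul_nonneg (sq_nonneg k) (DD_nonneg P δ k)
    unfold pK; nlinarith
  calc _ ≤ pK P * (4 + k ^ 2 * DD P δ k) * PP P δ k := by gcongr
    _ = pK P := by rw [mul_assoc, PP_id, mul_one]
omit hδ in
lemma pK_nonneg : 0 ≤ pK P := by have := dlow_pos; have := P.hl; unfold pK; positivity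
lemma PP_bd1 (hδ' : δ ≤ P.l) k : |k| * PP P δ k ≤ pK P := by
  have := PP_bd P hδ hδ' k
  have h1 := ph_nonneg hδ k; have h2 := abs_nonneg k; have h3 := (PP_pos P δ k).le
  nlinarith [mul_nonneg (mul_nonneg h1 h2) h3, mul_nonneg h1 h3, mul_nonneg h2 h3]
lemma PP_diff (hδ' : δ ≤ P.l) k : |PP P δ k - (4 + k ^ 2)⁻¹| ≤ 768 * pK P * δ := by
  have h1 := PP_den P δ k
  have e : PP P δ k - (4 + k ^ 2)⁻¹ = (1 - DD P δ k) * PP P δ k * (k ^ 2 / (4 + k ^ 2)) := by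
    have h2 : 4 + k ^ 2 ≠ 0 := by positivity
    have := PP_id P δ k
    field_simp; linear_combination this
  rw [e, abs_mul, abs_mul, abs_of_pos (PP_pos P δ k), abs_of_nonneg (show 0 ≤ k ^ 2 / (4 + k ^ 2) by positivity)]
  have h3 : k ^ 2 / (4 + k ^ 2) ≤ 1 := by rw [div_le_one (by positivity)]; linarith
  have h4 := PP_bd1 P hδ hδ' k
  have h5 := DD_lip P hδ k
  have h6 := (PP_pos P δ k).le
  calc _ ≤ (768 * (δ * |k|)) * PP P δ k * 1 := by gcongr
    _ = 768 * δ * (|k| * PP P δ k) := by ring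
    _ ≤ 768 * δ * pK P := by gcongr
    _ = _ := by ring
lemma pq_cont : Continuous (pq P δ) := Complex.continuous_ofReal.comp
  ((continuous_const.add (ph_cont hδ)).mul (PP_cont P δ))
lemma pq_norm (hδ' : δ ≤ P.l) k : ‖pq P δ k‖ ≤ pK P := by
  have h1 := ph_nonneg hδ k; have h2 := abs_nonneg k; have h3 := (PP_pos P δ k).le
  rw [pq, Complex.norm_real, norm_of_nonneg (by positivity)]
  have := PP_bd P hδ hδ' k
  have : 0 ≤ (1 + ph δ k) * |k| * PP P δ k := by positivity
  linarith
lemma pq_norm1 (hδ' : δ ≤ P.l) k : ‖ikm (pq P δ) k‖ ≤ pK P := by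
  have h1 := ph_nonneg hδ k; have h2 := abs_nonneg k; have h3 := (PP_pos P δ k).le
  rw [ikm_norm, pq, Complex.norm_real, norm_of_nonneg (by positivity)]
  have := PP_bd P hδ hδ' k
  have : 0 ≤ (1 + ph δ k) * PP P δ k := by positivity
  linarith
omit hδ in
lemma pq_star k : star (pq P δ k) = pq P δ (-k) := by
  simp [pq, ph, PP, DD_neg]
lemma wi_pq k : wi (W1 δ) k * pq P δ k = wi W0 k * (PP P δ k : ℂ) := by
  have := (ph1_pos hδ k).ne'
  simp only [wi, pq, W0, W1]; rw [← Complex.ofReal_mul, ← Complex.ofReal_mul]; congr 1; field_simp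
omit hδ in
lemma PP_le k : PP P δ k ≤ 1 := inv_le_one_of_one_le₀ (by linarith [PP_den P δ k])
omit hδ in
lemma NmP : Nm fun k => wi W0 k * (PP P δ k : ℂ) :=
  ⟨(wi_cont Wt0).mul (Complex.continuous_ofReal.comp (PP_cont P δ)), 1, fun k => by
    rw [norm_mul, Complex.norm_real, norm_of_nonneg (PP_pos P δ k).le, one_mul]
    exact (mul_le_of_le_one_right (norm_nonneg _) (PP_le P k)).trans (wi_norm Wt0 k)⟩
end
section
variable (P : Pr) (δ : ℝ)
def bt1 (b : A) : L := op (sc (pq P δ)) (op (cs trE) b.2)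
def bt1' (b : A) : L := op (sc (ikm (pq P δ))) (op (cs trE) b.2)
def Cr (a : ℝ) (b : A) : L :=
  T1 a δ (op (cs mI) (cv (W1 δ) (Sr (W1 δ)) (bt1 P δ b))) + cv W0 (Sr W0) (K1 a δ (op (cs mI) (bt1' P δ b)))
    + (a : ℂ) • D0 a δ (cv W0 (Sr W0) (K1 a δ (op (cs mI) (bt1' P δ b))))
def C1 (b : A) : L := (P.p : ℂ) • Cr P δ P.a b + (P.q : ℂ) • Cr P δ P.b b
def f0 (b : A) : L := b.1 - C1 P δ b
def bt (b : A) : A := (op (sc (pq P δ)) (op (cs trE) (f0 P δ b)), bt1 P δ b)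
def bt' (b : A) : A := (op (sc (ikm (pq P δ))) (op (cs trE) (f0 P δ b)) + cv (W1 δ) (Sr (W1 δ)) (bt1 P δ b), bt1' P δ b)
def DT (u : A) : A := (P.p : ℂ) • TA P.a δ (csA mI u) + (P.q : ℂ) • TA P.b δ (csA mI u)
variable {δ} (hδ : 0 ≤ δ) (hδ' : δ ≤ P.l)
include hδ hδ'
lemma BCp : BCs (sc (pq P δ)) := BCs.sc (pq_cont P hδ) (pq_norm P hδ hδ')
lemma BCp' : BCs (sc (ikm (pq P δ))) := BCs.sc (ikm_cont (pq_cont P hδ)) (pq_norm1 P hδ hδ')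
lemma ev_pq (f : L) : ev (W1 δ) (op (sc (pq P δ)) f) = evs (sc fun k => wi W0 k * (PP P δ k : ℂ)) f := by
  funext X; rw [ev, evs_op_sc (BCp P hδ hδ')]; simp only [wi_pq P hδ]
lemma ev_pq' (f : L) X : ev (W1 δ) (op (sc (ikm (pq P δ))) f) X = evs (sc (ikm fun k => wi W0 k * (PP P δ k : ℂ))) f X := by
  rw [ev, evs_op_sc (BCp' P hδ hδ')]; congr 2; funext k; rw [ikm, ikm, ← wi_pq P hδ]; ring
lemma bt_deriv b X : HasDerivAt (EV (W1 δ) (bt P δ b)) (EV (W1 δ) (bt' P δ b) X) X := by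
  have e : EV (W1 δ) (bt P δ b) = fun X => evs (sc fun k => wi W0 k * (PP P δ k : ℂ)) (op (cs trE) (f0 P δ b)) X
     + ((tanh X : ℝ) : ℂ) • evs (sc fun k => wi W0 k * (PP P δ k : ℂ)) (op (cs trE) b.2) X := by
    funext X; simp only [EV, bt, bt1, ev_pq P hδ hδ']
  rw [e]
  have h3 := ((tanh_hd X).ofReal_comp).smul (sc_deriv (NmP P (δ := δ)) (op (cs trE) b.2) X)
  refine ((sc_deriv (NmP P) (op (cs trE) (f0 P δ b)) X).add h3).congr_deriv ?_
  simp only [EV, bt', bt1', bt1, ev_add (Wt1 hδ), ev_pq' P hδ hδ', ev_cv (Wt1 hδ), ev_Sr (Wt1 hδ), ev_pq P hδ hδ', smul_mul_assoc, one_mul]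
  module
lemma T_tr {a} (ha : 0 < a) (f : L) X :
    trE (ev W0 (T1 a δ (op (cs mI) (op (sc (ikm (pq P δ))) (op (cs trE) f)))) X) =
      trE (evs (sc fun k => wi W0 k * ((k ^ 2 * dR (a * δ * k) * PP P δ k : ℝ) : ℂ)) f X) := by
  have e : op (cs mI) (op (sc (ikm (pq P δ))) (op (cs trE) f)) = op (sc (ikm (pq P δ))) (op (cs mI) (op (cs trE) f)) := by
    apply Lp.ext
    have h1 := BCp' P hδ hδ'
    filter_upwards [op_coe (BCs.cs mI) (op (sc (ikm (pq P δ))) (op (cs trE) f)), op_coe h1 (op (cs trE) f),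
      op_coe h1 (op (cs mI) (op (cs trE) f)), op_coe (BCs.cs mI) (op (cs trE) f)] with k a b c d
    rw [a, b, c, d]; simp only [cs, sc_apply, map_smul]
  set n : ℝ → ℂ := ikm (ikm fun k => wi W0 k * (PP P δ k : ℂ)) with hn
  have hnc : Continuous n := ikm_cont (ikm_cont (NmP P).1)
  obtain ⟨C, hC⟩ := (NmP P (δ := δ)).C0
  have hnC : ∀ k, ‖n k‖ ≤ C := fun k => by
    rw [hn, ikm_norm, ikm_norm, ← mul_assoc, ← pow_two]; exact (hC k).2.2.1
  have h2 : ev W0 (T1 a δ (op (sc (ikm (pq P δ))) (op (cs mI) (op (cs trE) f)))) X = evs (Ks n (a * δ)) (op (cs mI) (op (cs trE) f)) X := by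
    rw [ev_T1 ha hδ, evs_op (BCp' P hδ hδ')]; congr 1; funext k; ext1 e
    simp only [ContinuousLinearMap.comp_apply, Ks, sc_apply, _root_.smul_apply, map_smul, smul_smul]
    congr 1; rw [hn, ikm, ikm, ikm, ikm, ← wi_pq P hδ]; ring
  rw [e, h2, Ks_tr (a * δ) (BCs.Ks hnc hnC _) (BCs.sc hnc hnC)]
  congr 2; congr 1; funext k; rw [hn, ikm, ikm]; push_cast
  linear_combination (-(k * k * (wi W0 k * PP P δ k)) * dR (a * δ * k)) * Complex.I_mul_I
lemma bt_comp (f : L) (X : ℝ) : (4 : ℂ) • ev (W1 δ) (op (sc (pq P δ)) (op (cs trE) f)) X +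
    (((P.p : ℂ) • trE (ev W0 (T1 P.a δ (op (cs mI) (op (sc (ikm (pq P δ))) (op (cs trE) f)))) X)) +
    ((P.q : ℂ) • trE (ev W0 (T1 P.b δ (op (cs mI) (op (sc (ikm (pq P δ))) (op (cs trE) f)))) X))) = trE (ev W0 f X) := by
  have hB : ∀ a, BCs (sc fun k => wi W0 k * ((k ^ 2 * dR (a * δ * k) * PP P δ k : ℝ) : ℂ)) := fun a => by
    obtain ⟨C, hC⟩ := (NmP P (δ := δ)).C0
    refine BCs.sc (C := C * 16) ?_ fun k => ?_
    · have := dR_cont; have := PP_cont P δ; have := wi_cont Wt0; fun_prop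
    · have := (hC k).2.2.1
      have h2 : ‖wi W0 k * ((k ^ 2 * dR (a * δ * k) * PP P δ k : ℝ) : ℂ)‖ = (|k| ^ 2 * ‖wi W0 k * (PP P δ k : ℂ)‖) * dR (a * δ * k) := by
        rw [norm_mul, norm_mul, Complex.norm_real, Complex.norm_real, norm_mul, norm_mul, norm_of_nonneg (dR_pos _).le, norm_pow, Real.norm_eq_abs]
        ring
      rw [h2]; exact mul_le_mul this (dR_le _) (dR_pos _).le ((by positivity : (0:ℝ) ≤ _).trans this)
  have hs : ∀ {M : Sym} (c : ℂ), BCs M → BCs (fun k => c • M k) := fun {M} c ⟨hc, C, hC⟩ =>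
    ⟨hc.const_smul c, ‖c‖ * C, fun k => by rw [norm_smul]; exact mul_le_mul_of_nonneg_left (hC k) (norm_nonneg _)⟩
  have ha : ∀ {M N : Sym}, BCs M → BCs N → BCs (fun k => M k + N k) := fun {M N} ⟨hc, C, hC⟩ ⟨hc', C', hC'⟩ =>
    ⟨hc.add hc', C + C', fun k => (norm_add_le _ _).trans (add_le_add (hC k) (hC' k))⟩
  rw [T_tr P hδ hδ' P.ha, T_tr P hδ hδ' P.hb, ev_pq P hδ hδ', evs_op_cs (NmP P).BCs, ← map_smul trE, ← map_smul trE, ← map_smul trE,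
    ← map_add trE, ← map_add trE]
  congr 1
  rw [← evs_smul_sym, ← evs_smul_sym, ← evs_smul_sym, ← evs_add_sym (hs _ (hB _)) (hs _ (hB _)),
    ← evs_add_sym (hs _ (NmP P).BCs) (ha (hs _ (hB _)) (hs _ (hB _))), ev]
  congr 1; funext k; ext1 e
  simp only [_root_.add_apply, _root_.smul_apply, sc_apply, smul_smul, ← add_smul]
  congr 1
  have := congrArg (fun x : ℝ => (x : ℂ)) (PP_id P δ k)
  simp only [DD] at this
  push_cast at this ⊢
  linear_combination (wi W0 k) * this
lemma bt_eq b X : (4 : ℂ) • EV (W1 δ) (bt P δ b) X + trE (EV W0 (DT P δ (bt' P δ b)) X) = trE (EV W0 b X) := by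
  have h0 := bt_comp P hδ hδ' (f0 P δ b) X
  have h1 := bt_comp P hδ hδ' b.2 X
  have hf : trE (ev W0 (f0 P δ b) X) = trE (ev W0 b.1 X) - ((P.p : ℂ) • trE (ev W0 (Cr P δ P.a b) X) + (P.q : ℂ) • trE (ev W0 (Cr P δ P.b b) X)) := by
    rw [f0, C1, ev_sub Wt0, ev_add Wt0, ev_smul, ev_smul]; simp only [map_sub, map_add, map_smul]
  have hT : ∀ a, EV W0 (TA a δ (csA mI (bt' P δ b))) X = ev W0 (T1 a δ (op (cs mI) (op (sc (ikm (pq P δ))) (op (cs trE) (f0 P δ b))))) X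
      + ev W0 (Cr P δ a b) X + ((tanh X : ℝ) : ℂ) • ev W0 (T1 a δ (op (cs mI) (op (sc (ikm (pq P δ))) (op (cs trE) b.2)))) X := fun a => by
    simp only [EV, TA, csA, bt', bt1', Cr, T1, map_add, ev_add Wt0, ev_smul]; abel
  rw [hf] at h0
  rw [DT, EV_add Wt0, EV_smul, EV_smul, hT, hT]
  simp only [EV, bt, bt1, map_add, map_smul]
  linear_combination (norm := module) h0 + ((tanh X : ℝ) : ℂ) • h1
end
lemma tr_Srep {m : ℝ → ℂ} (h : Pm m) : op (cs trE) (Srep m) = Srep m := by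
  apply Lp.ext
  filter_upwards [op_coe (BCs.cs trE) (Srep m), Srep_coe h] with k a b
  rw [a, b]; simp only [cs, Sfun, map_smul]; congr 1; ext s; simp; ring
def gm (P : Pr) (ε k : ℝ) : ℂ := ((-(1 - DD P (P.l * |ε|) k) / (2 * ε) : ℝ) : ℂ) * (Complex.I * k * (W0 k : ℂ))
def G0 (P : Pr) (ε : ℝ) : L := Srep (gm P ε)
lemma gm_bd P ε (h : Ok ε) k : ‖gm P ε k‖ ≤ 384 * P.l * (1 + |k|) ^ 6 := by
  have h1 := DD_lip P (dnn P.hl ε) k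
  have h0 := abs_nonneg k
  rw [gm, norm_mul, norm_mul, norm_mul, Complex.norm_I, one_mul, Complex.norm_real, Complex.norm_real, Complex.norm_real,
    norm_of_nonneg (Wt0.pos k).le, norm_div, norm_neg, Real.norm_eq_abs, Real.norm_eq_abs, Real.norm_eq_abs, abs_mul, abs_two]
  have h2 : |1 - DD P (P.l * |ε|) k| / (2 * |ε|) ≤ 384 * P.l * |k| := by
    have := h.1
    rw [div_le_iff₀ (by positivity)]; linarith
  have hl := P.hl
  calc _ ≤ (384 * P.l * |k|) * (|k| * W0 k) := by
        have := (Wt0.pos k).le; gcongr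
    _ ≤ (384 * P.l * (1 + |k|)) * ((1 + |k|) * (1 + |k|) ^ 4) := by
        have := Wt0.le k; have := (Wt0.pos k).le; gcongr <;> linarith
    _ = _ := by ring
lemma gm_cont P ε : Continuous (gm P ε) := by
  have := DD_cont P (P.l * |ε|); have := Wt0.contC; unfold gm; fun_prop
lemma G0_const P : ∀ ε, Ok ε → Herm (G0 P ε) ∧ ‖G0 P ε‖ ≤ 384 * P.l * shK := fun ε o =>
  ⟨Srep_herm ⟨gm_cont P ε, _, gm_bd P ε o⟩ fun k => by simp [gm, DD_neg, Wt0.even], Srep_norm (gm_cont P ε) (gm_bd P ε o)⟩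
lemma ev_G0 P {ε} (o : Ok ε) X :
    (ε : ℂ) • ev W0 (G0 P ε) X = ((tanh X * Sf X : ℝ) : ℂ) • (1 : E) +
      trE (EV W0 (DT P (P.l * |ε|) ((-1 / 2 : ℂ) • Sr (W1 (P.l * |ε|)), 0)) X) := by
  have hε : (ε : ℂ) ≠ 0 := by have := abs_pos.1 o.1; exact_mod_cast this
  set δ := P.l * |ε| with hd
  have hδ : 0 ≤ δ := dnn P.hl ε
  have w1 := Wt1 hδ
  obtain ⟨C, hC⟩ := (Nm.wi w1).C0
  have hB0 : ∀ a : ℝ, BCs (sc fun k => -(ikm (wi (W1 δ)) k * dR (a * k))) := fun a => by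
    refine BCs.sc (C := C * 16) ?_ fun k => ?_
    · have := dR_cont; have := ikm_cont (wi_cont w1); fun_prop
    · rw [norm_neg, norm_mul, Complex.norm_real, norm_of_nonneg (dR_pos _).le, ikm_norm]
      exact mul_le_mul (hC k).2.1 (dR_le _) (dR_pos _).le ((by positivity : (0:ℝ) ≤ _).trans (hC k).2.1)
  have hT : ∀ a, 0 < a → trE (EV W0 (TA a δ (csA mI ((-1 / 2 : ℂ) • Sr (W1 δ), 0))) X)
      = evs (sc fun k => -(ikm (wi (W1 δ)) k * dR (a * δ * k))) ((-1 / 2 : ℂ) • Sr (W1 δ)) X := fun a ha => by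
    have hz : ∀ w : ℝ → ℝ, cv W0 (Sr W0) (0 : L) = 0 := fun w => by
      have := cv_sub_right Wt0 (Sr W0) 0 0; simpa using this
    have e1 : EV W0 (TA a δ (csA mI ((-1 / 2 : ℂ) • Sr (W1 δ), 0))) X = (-1 / 2 : ℂ) • ev W0 (T1 a δ (op (cs mI) (Sr (W1 δ)))) X := by
      simp only [EV, TA, csA, T1, K1, D0, map_zero, hz W0, smul_zero, add_zero, map_smul, ev_smul]
      simp [ev, evs_zero]
    rw [e1, map_smul, ev_T1 ha hδ]
    nth_rw 1 [Sr]; rw [← tr_Srep w1.Pm, Ks_tr (a * δ) ((Nm.wi w1).BCsK1 _) (Nm.wi w1).BCs1, ← evs_op_cs (hB0 _), tr_Srep w1.Pm, ← evs_smul]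
    rfl
  have e2 := evs_Srep (n := fun k => (ε : ℂ) * wi W0 k) (n' := fun k => ((1 - DD P δ k : ℝ) : ℂ) * ((-1 / 2 : ℂ) * ikm (wi (W1 δ)) k))
    ⟨gm_cont P ε, _, gm_bd P ε o⟩ w1.Pm (fun k => by
      have h1 := wi_mul Wt0 k; have h2 := wi_mul w1 k
      rw [gm, ikm, ← hd]; push_cast
      field_simp
      linear_combination (k * (-(1 - (DD P δ k : ℂ)))) * (h1 - h2)) X
  have e3 : (ε : ℂ) • ev W0 (G0 P ε) X = evs (sc fun k => (ε : ℂ) * wi W0 k) (Srep (gm P ε)) X := by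
    rw [ev, ← evs_smul_sym]; congr 1; funext k; simp [sc, smul_smul]
  have e4 : ((tanh X * Sf X : ℝ) : ℂ) • (1 : E) = evs (sc (ikm (wi (W1 δ)))) ((-1 / 2 : ℂ) • Sr (W1 δ)) X := by
    rw [evs_smul, Sr, evs_Srep_ik w1.Pm (fun k => by rw [ikm]; linear_combination (Complex.I * k) * wi_mul w1 k), smul_smul]
    congr 1; push_cast; ring
  rw [DT, EV_add Wt0, EV_smul, EV_smul, map_add, map_smul, map_smul, hT _ P.ha, hT _ P.hb, e3, e2, e4]
  have hs : ∀ {M : Sym} (c : ℂ), BCs M → BCs (fun k => c • M k) := fun {M} c ⟨hc, C, hC⟩ =>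
    ⟨hc.const_smul c, ‖c‖ * C, fun k => by rw [norm_smul]; exact mul_le_mul_of_nonneg_left (hC k) (norm_nonneg _)⟩
  have ha : ∀ {M N : Sym}, BCs M → BCs N → BCs (fun k => M k + N k) := fun {M N} ⟨hc, C, hC⟩ ⟨hc', C', hC'⟩ =>
    ⟨hc.add hc', C + C', fun k => (norm_add_le _ _).trans (add_le_add (hC k) (hC' k))⟩
  rw [← evs_smul_sym, ← evs_smul_sym, ← evs_add_sym (hs _ (hB0 _)) (hs _ (hB0 _)), ← evs_add_sym (Nm.wi w1).BCs1
    (ha (hs _ (hB0 _)) (hs _ (hB0 _))), evs_smul, ← evs_smul_sym]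
  congr 1; funext k; ext1 e
  simp only [_root_.add_apply, _root_.smul_apply, sc_apply, smul_smul, ← add_smul]
  congr 1; simp only [DD]; push_cast; ring
section
variable (P : Pr)
lemma dle {ε} (o : Ok ε) : P.l * |ε| ≤ P.l := by nlinarith [o.2, P.hl]
lemma Ul.pq : Ul fun ε (f : L) => Bore.op (Bore.sc (Bore.pq P (P.l * |ε|))) (Bore.op (Bore.cs trE) f) :=
  (Ul.op (Fam.sc (C := pK P) fun ε o => ⟨pq_cont P (dnn P.hl ε), pq_norm P (dnn P.hl ε) (dle P o), pq_star P⟩)).comp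
    (Ul.op (Fam.cs theta_trE'))
lemma Ul.pq' : Ul fun ε (f : L) => Bore.op (Bore.sc (ikm (Bore.pq P (P.l * |ε|)))) (Bore.op (Bore.cs trE) f) :=
  (Ul.op (Fam.sc (C := pK P) fun ε o => ⟨ikm_cont (pq_cont P (dnn P.hl ε)), pq_norm1 P (dnn P.hl ε) (dle P o), fun k => by
    rw [ikm, ikm, ← pq_star]; simp⟩)).comp (Ul.op (Fam.cs theta_trE'))
lemma Ul.bt1 : Ul fun ε (b : A) => Bore.bt1 P (P.l * |ε|) b := (Ul.pq P).comp Ul.snd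
lemma Ul.bt1' : Ul fun ε (b : A) => Bore.bt1' P (P.l * |ε|) b := (Ul.pq' P).comp Ul.snd
lemma Ul.Cr {a} (ha : 0 < a) : Ul fun ε (b : A) => Bore.Cr P (P.l * |ε|) a b := by
  have m := Ul.op (Fam.cs theta_mI)
  have s := (Ul.SK P.hl ha).comp (m.comp (Ul.bt1' P))
  exact (((Ul.T1 P.hl ha).comp (m.comp ((Ul.S (WF1 P.hl)).comp (Ul.bt1 P)))).add s).add (((Ul.D0 P.hl ha).comp s).csmul a)
lemma Ul.C1 : Ul fun ε (b : A) => Bore.C1 P (P.l * |ε|) b := ((Ul.Cr P P.ha).csmul P.p).add ((Ul.Cr P P.hb).csmul P.q)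
lemma Ul.f0 : Ul fun ε (b : A) => Bore.f0 P (P.l * |ε|) b := Ul.sub (S := fun _ (b : A) => b.1) Ul.fst (Ul.C1 P)
lemma Ul.bt : Ul fun ε (b : A) => Bore.bt P (P.l * |ε|) b := ((Ul.pq P).comp (Ul.f0 P)).pair (Ul.bt1 P)
lemma Ul.bt' : Ul fun ε (b : A) => Bore.bt' P (P.l * |ε|) b :=
  (((Ul.pq' P).comp (Ul.f0 P)).add ((Ul.S (WF1 P.hl)).comp (Ul.bt1 P))).pair (Ul.bt1' P)
end
end
section
open MeasureTheory
def Fc (X : ℝ) : ℂ := ((tanh X : ℝ) : ℂ)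
lemma Fc_def X : ((tanh X : ℝ) : ℂ) = Fc X := rfl
lemma Sc_eq X : ((Sf X : ℝ) : ℂ) = 1 - Fc X * Fc X := by rw [Fc, FS_id]; ring
lemma hdF {u : ℝ → E} {u' : E} {X : ℝ} (h : HasDerivAt u u' X) :
    HasDerivAt (fun X => Fc X • u X) (Fc X • u' + (1 - Fc X * Fc X) • u X) X := by
  have := ((tanh_hd X).ofReal_comp).smul h
  rw [Sc_eq] at this; exact this
lemma hdS {u : ℝ → E} {u' : E} {X : ℝ} (h : HasDerivAt u u' X) :
    HasDerivAt (fun X => ((Sf X : ℝ) : ℂ) • u X) ((1 - Fc X * Fc X) • u' - (2 * Fc X * (1 - Fc X * Fc X)) • u X) X := by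
  refine (((Sf_hd X).ofReal_comp).smul h).congr_deriv ?_
  push_cast; rw [Sc_eq, Fc]; module
def m0 (k : ℝ) : ℂ := (((4 + k ^ 2)⁻¹ : ℝ) : ℂ)
lemma m0_cont : Continuous m0 := Complex.continuous_ofReal.comp
  (Continuous.inv₀ (by fun_prop) fun k => by positivity)
lemma m0_norm k : ‖m0 k‖ ≤ 1 := by
  rw [m0, Complex.norm_real, norm_of_nonneg (by positivity)]; exact inv_le_one_of_one_le₀ (by nlinarith [sq_nonneg k])
lemma m0_norm1 k : ‖ikm m0 k‖ ≤ 1 := by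
  rw [ikm_norm, m0, Complex.norm_real, norm_of_nonneg (by positivity), ← sq_abs, ← div_eq_mul_inv, div_le_one (by positivity)]
  nlinarith [sq_nonneg (|k| - 1)]
lemma BC0 : BCs (sc m0) := BCs.sc m0_cont m0_norm
lemma BC1 : BCs (sc (ikm m0)) := BCs.sc (ikm_cont m0_cont) m0_norm1
def p0 (f : L) : L := op (sc m0) f
def q0 (f : L) : L := op (sc (ikm m0)) f
lemma NmW {m : ℝ → ℂ} (h : Continuous m) (h1 : ∀ k, ‖m k‖ ≤ 1) : Nm fun k => wi W0 k * m k :=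
  ⟨(wi_cont Wt0).mul h, 1, fun k => by
    rw [norm_mul, one_mul]; exact (mul_le_of_le_one_right (norm_nonneg _) (h1 k)).trans (wi_norm Wt0 k)⟩
lemma p0_hd (f : L) X : HasDerivAt (ev W0 (p0 f)) (ev W0 (q0 f) X) X := by
  have e : ev W0 (p0 f) = evs (sc fun k => wi W0 k * m0 k) f := by funext X; rw [ev, p0, evs_op_sc BC0]
  rw [e]; refine (sc_deriv (NmW m0_cont m0_norm) f X).congr_deriv ?_
  rw [ev, q0, evs_op_sc BC1]; congr 2; funext k; simp only [ikm]; ring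
lemma q0_hd (f : L) X : HasDerivAt (ev W0 (q0 f)) ((4 : ℂ) • ev W0 (p0 f) X - ev W0 f X) X := by
  have e : ev W0 (q0 f) = evs (sc fun k => wi W0 k * ikm m0 k) f := by funext X; rw [ev, q0, evs_op_sc BC1]
  rw [e]; refine (sc_deriv (NmW (ikm_cont m0_cont) m0_norm1) f X).congr_deriv ?_
  have hB : BCs (sc fun k => 4 * m0 k - 1) := BCs.sc (C := 4 * 1 + 1) ((continuous_const.mul m0_cont).sub continuous_const) fun k =>
    (norm_sub_le _ _).trans (add_le_add (by rw [norm_mul]; simpa using m0_norm k) (by simp))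
  rw [← ev_smul, ← ev_sub Wt0]
  have : (4 : ℂ) • p0 f - f = op (sc fun k => 4 * m0 k - 1) f := by
    apply Lp.ext
    filter_upwards [Lp.coeFn_sub ((4 : ℂ) • p0 f) f, Lp.coeFn_smul (4 : ℂ) (p0 f), op_coe BC0 f, op_coe hB f] with k a b c d
    rw [a, Pi.sub_apply, b, Pi.smul_apply, p0, c, d]; simp only [sc_apply]; module
  rw [this, ev, evs_op_sc hB]; congr 2; funext k; simp only [ikm]
  have : (4 + (k : ℂ) ^ 2) * m0 k = 1 := by
    rw [m0]; norm_cast; exact mul_inv_cancel₀ (by positivity)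
  linear_combination (k * k * wi W0 k * m0 k) * Complex.I_mul_I - wi W0 k * this
def Pd (u : A) : L := (2 : ℂ) • cv W0 (SFr W0) (p0 u.2) - (2 : ℂ) • cv W0 (Sr W0) (q0 u.2)
def Pa (u : A) : A := (p0 u.1 - p0 (Pd u), p0 u.2)
def Pb (u : A) : A := (q0 u.1 - q0 (Pd u) + cv W0 (Sr W0) (p0 u.2), q0 u.2)
lemma Pa_hd (u : A) (X : ℝ) : HasDerivAt (EV W0 (Pa u)) (EV W0 (Pb u) X) X := by
  have e : EV W0 (Pa u) = fun X => ev W0 (p0 u.1) X - ev W0 (p0 (Pd u)) X + Fc X • ev W0 (p0 u.2) X := by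
    funext X; rw [EV, Pa, ev_sub Wt0]; rfl
  rw [e]; refine (((p0_hd _ X).sub (p0_hd _ X)).add (hdF (p0_hd _ X))).congr_deriv ?_
  simp only [EV, Pb, ev_sub Wt0, ev_add Wt0, ev_cv Wt0, ev_Sr Wt0, smul_mul_assoc, one_mul, Sc_eq, Fc_def]; module
lemma Pb_hd (u : A) (X : ℝ) : HasDerivAt (EV W0 (Pb u)) ((4 : ℂ) • EV W0 (Pa u) X - EV W0 u X) X := by
  have e : EV W0 (Pb u) = fun X => ev W0 (q0 u.1) X - ev W0 (q0 (Pd u)) X + ((Sf X : ℝ) : ℂ) • ev W0 (p0 u.2) X + Fc X • ev W0 (q0 u.2) X := by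
    funext X; simp only [EV, Pb, ev_sub Wt0, ev_add Wt0, ev_cv Wt0, ev_Sr Wt0, smul_mul_assoc, one_mul]; rfl
  rw [e]; refine ((((q0_hd _ X).sub (q0_hd _ X)).add (hdS (p0_hd _ X))).add (hdF (q0_hd _ X))).congr_deriv ?_
  have : ev W0 (Pd u) X = (2 * Fc X * (1 - Fc X * Fc X)) • ev W0 (p0 u.2) X - (2 * (1 - Fc X * Fc X)) • ev W0 (q0 u.2) X := by
    rw [Pd, ev_sub Wt0, ev_smul, ev_smul, ev_cv Wt0, ev_cv Wt0, ev_Sr Wt0, ev_SFr Wt0]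
    rw [Complex.ofReal_mul, Sc_eq, Fc_def, smul_mul_assoc, smul_mul_assoc, one_mul, one_mul]; module
  simp only [EV, Pa, this, ev_sub Wt0, Fc_def]; module
def SA (u : A) : A := (SL W0 u, 0)
lemma EV_SA u X : EV W0 (SA u) X = ((Sf X : ℝ) : ℂ) • EV W0 u X := by rw [SA, EV_inl, ev_SL Wt0]
local notation "Φ" => FA W0
def Qa (u : A) : A := (-1 / 3 : ℂ) • ((4 : ℂ) • Pa u + Pb (Φ u) - Φ (Pb u) - Φ (Pa (Φ u)))
def Qb (u : A) : A := (-1 / 3 : ℂ) • ((4 : ℂ) • Pb u + (4 : ℂ) • Pa (Φ u) - (4 : ℂ) • Φ (Pa u) - SA (Pb u) - SA (Pa (Φ u)) - Φ (Pb (Φ u)))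
def Qc (u : A) : A := (-1 / 3 : ℂ) • ((4 : ℂ) • Pb u + (4 : ℂ) • Pa (Φ u) - (4 : ℂ) • Φ (Pa u) - Pb (SA u) - Φ (Pb (Φ u)) + Φ (Pa (SA u)))
def Qd (u : A) : A := (-1 / 3 : ℂ) • ((16 : ℂ) • Pa u + (4 : ℂ) • Pb (Φ u) - (4 : ℂ) • SA (Pa u) - (4 : ℂ) • Φ (Pb u) - (4 : ℂ) • Pa (SA u)
  - SA (Pb (Φ u)) - (4 : ℂ) • Φ (Pa (Φ u)) + SA (Pa (SA u)) + Φ (Pb (SA u)))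
lemma EVF u X : EV W0 (Φ u) X = Fc X • EV W0 u X := EV_FA Wt0 u X
lemma Qa_hd (u : A) (X : ℝ) : HasDerivAt (EV W0 (Qa u)) (EV W0 (Qb u) X) X := by
  have e : EV W0 (Qa u) = fun X => (-1 / 3 : ℂ) • ((4 : ℂ) • EV W0 (Pa u) X + EV W0 (Pb (Φ u)) X - Fc X • EV W0 (Pb u) X - Fc X • EV W0 (Pa (Φ u)) X) := by
    funext X; simp only [Qa, EV_smul, EV_sub Wt0, EV_add Wt0, EVF]
  rw [e]
  refine ((((((Pa_hd u X).const_smul (4 : ℂ)).add (Pb_hd (Φ u) X)).sub (hdF (Pb_hd u X))).sub (hdF (Pa_hd (Φ u) X))).const_smul (-1 / 3 : ℂ)).congr_deriv ?_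
  simp only [Qb, EV_smul, EV_sub Wt0, EV_add Wt0, EVF, EV_SA, Sc_eq]; module
lemma Qb_hd (u : A) (X : ℝ) : HasDerivAt (EV W0 (Qb u)) (EV W0 u X + (4 - 2 * (1 - Fc X * Fc X)) • EV W0 (Qa u) X) X := by
  have e : EV W0 (Qb u) = fun X => (-1 / 3 : ℂ) • ((4 : ℂ) • EV W0 (Pb u) X + (4 : ℂ) • EV W0 (Pa (Φ u)) X - (4 : ℂ) • (Fc X • EV W0 (Pa u) X)
      - ((Sf X : ℝ) : ℂ) • EV W0 (Pb u) X - ((Sf X : ℝ) : ℂ) • EV W0 (Pa (Φ u)) X - Fc X • EV W0 (Pb (Φ u)) X) := by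
    funext X; simp only [Qb, EV_smul, EV_sub Wt0, EV_add Wt0, EVF, EV_SA]
  rw [e]
  refine ((((((((Pb_hd u X).const_smul (4 : ℂ)).add ((Pa_hd (Φ u) X).const_smul (4 : ℂ))).sub ((hdF (Pa_hd u X)).const_smul (4 : ℂ))).sub
    (hdS (Pb_hd u X))).sub (hdS (Pa_hd (Φ u) X))).sub (hdF (Pb_hd (Φ u) X))).const_smul (-1 / 3 : ℂ)).congr_deriv ?_
  simp only [Qa, EV_smul, EV_sub Wt0, EV_add Wt0, EVF]; module
lemma Qc_hd (u : A) (X : ℝ) : HasDerivAt (EV W0 (Qc u)) (EV W0 u X + EV W0 (Qd u) X) X := by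
  have e : EV W0 (Qc u) = fun X => (-1 / 3 : ℂ) • ((4 : ℂ) • EV W0 (Pb u) X + (4 : ℂ) • EV W0 (Pa (Φ u)) X - (4 : ℂ) • (Fc X • EV W0 (Pa u) X)
      - EV W0 (Pb (SA u)) X - Fc X • EV W0 (Pb (Φ u)) X + Fc X • EV W0 (Pa (SA u)) X) := by
    funext X; simp only [Qc, EV_smul, EV_sub Wt0, EV_add Wt0, EVF]
  rw [e]
  refine ((((((((Pb_hd u X).const_smul (4 : ℂ)).add ((Pa_hd (Φ u) X).const_smul (4 : ℂ))).sub ((hdF (Pa_hd u X)).const_smul (4 : ℂ))).sub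
    (Pb_hd (SA u) X)).sub (hdF (Pb_hd (Φ u) X))).add (hdF (Pa_hd (SA u) X))).const_smul (-1 / 3 : ℂ)).congr_deriv ?_
  simp only [Qd, EV_smul, EV_sub Wt0, EV_add Wt0, EVF, EV_SA, Sc_eq]; module
lemma Qd_hd (u : A) (X : ℝ) : HasDerivAt (EV W0 (Qd u)) ((4 - 2 * (1 - Fc X * Fc X)) • EV W0 (Qc u) X) X := by
  have e : EV W0 (Qd u) = fun X => (-1 / 3 : ℂ) • ((16 : ℂ) • EV W0 (Pa u) X + (4 : ℂ) • EV W0 (Pb (Φ u)) X - (4 : ℂ) • (((Sf X : ℝ) : ℂ) • EV W0 (Pa u) X)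
      - (4 : ℂ) • (Fc X • EV W0 (Pb u) X) - (4 : ℂ) • EV W0 (Pa (SA u)) X - ((Sf X : ℝ) : ℂ) • EV W0 (Pb (Φ u)) X
      - (4 : ℂ) • (Fc X • EV W0 (Pa (Φ u)) X) + ((Sf X : ℝ) : ℂ) • EV W0 (Pa (SA u)) X + Fc X • EV W0 (Pb (SA u)) X) := by
    funext X; simp only [Qd, EV_smul, EV_sub Wt0, EV_add Wt0, EVF, EV_SA]
  rw [e]
  refine (((((((((((Pa_hd u X).const_smul (16 : ℂ)).add ((Pb_hd (Φ u) X).const_smul (4 : ℂ))).sub ((hdS (Pa_hd u X)).const_smul (4 : ℂ))).sub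
    ((hdF (Pb_hd u X)).const_smul (4 : ℂ))).sub ((Pa_hd (SA u) X).const_smul (4 : ℂ))).sub (hdS (Pb_hd (Φ u) X))).sub
    ((hdF (Pa_hd (Φ u) X)).const_smul (4 : ℂ))).add (hdS (Pa_hd (SA u) X))).add (hdF (Pb_hd (SA u) X))).const_smul (-1 / 3 : ℂ)).congr_deriv ?_
  simp only [Qc, EV_smul, EV_sub Wt0, EV_add Wt0, EVF, EV_SA, Sc_eq]; module
def ww (u : A) : A := Qc u + (2 : ℂ) • Qa (Φ u)
def Rop (u : A) : A := Qd u + (2 : ℂ) • Qb (Φ u) - (2 : ℂ) • Φ (ww u)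
def vv (u : A) : A := Qb (ww u) - (2 : ℂ) • Φ (Qa (ww u))
lemma ww_hd u X : HasDerivAt (EV W0 (ww u)) (EV W0 u X + EV W0 (Rop u) X + (2 * Fc X) • EV W0 (ww u) X) X := by
  have e : EV W0 (ww u) = fun X => EV W0 (Qc u) X + (2 : ℂ) • EV W0 (Qa (Φ u)) X := by
    funext X; simp only [ww, EV_smul, EV_add Wt0]
  have e2 := congrFun e X; beta_reduce at e2
  rw [e]; refine ((Qc_hd u X).add ((Qa_hd (Φ u) X).const_smul (2 : ℂ))).congr_deriv ?_
  simp only [Rop, EV_smul, EV_sub Wt0, EV_add Wt0, EVF, e2]; module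
lemma Rop_hd (u : A) (X : ℝ) : HasDerivAt (EV W0 (Rop u)) ((-2 * Fc X) • EV W0 (Rop u) X) X := by
  have e : EV W0 (Rop u) = fun X => EV W0 (Qd u) X + (2 : ℂ) • EV W0 (Qb (Φ u)) X - (2 : ℂ) • (Fc X • EV W0 (ww u) X) := by
    funext X; simp only [Rop, EV_smul, EV_sub Wt0, EV_add Wt0, EVF]
  have e2 := congrFun e X; beta_reduce at e2
  nth_rw 1 [e]
  refine (((Qd_hd u X).add ((Qb_hd (Φ u) X).const_smul (2 : ℂ))).sub ((hdF (ww_hd u X)).const_smul (2 : ℂ))).congr_deriv ?_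
  rw [e2]; simp only [ww, EV_smul, EV_add Wt0, EVF]; module
lemma Rop_eq u X : EV W0 (Rop u) X = ((Sf X : ℝ) : ℂ) • EV W0 (Rop u) 0 := by
  have h : ∀ X, HasDerivAt (fun X => (((Sf X)⁻¹ : ℝ) : ℂ) • EV W0 (Rop u) X) 0 X := fun X => by
    have hS := (Sf_pos X).ne'
    have := (((Sf_hd X).inv hS).ofReal_comp).smul (Rop_hd u X)
    refine this.congr_deriv ?_
    rw [smul_smul, ← add_smul]
    convert zero_smul ℂ _
    rw [Fc]; norm_cast; simp only [Pi.inv_apply]; field_simp; ring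
  have h2 := is_const_of_deriv_eq_zero (fun X => (h X).differentiableAt) (fun X => (h X).deriv) X 0
  beta_reduce at h2
  have h0 : Sf 0 = 1 := by simp [Sf]
  rw [h0, inv_one, Complex.ofReal_one, one_smul] at h2
  rw [← h2, smul_smul, ← Complex.ofReal_mul, mul_inv_cancel₀ (Sf_pos X).ne', Complex.ofReal_one, one_smul]
def vd (u : A) : A := ww u + (4 : ℂ) • Qa (ww u) - (4 : ℂ) • SA (Qa (ww u)) - (2 : ℂ) • Φ (Qb (ww u))
lemma vv_hd (u : A) (X : ℝ) : HasDerivAt (EV W0 (vv u)) (EV W0 (vd u) X) X := by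
  have e : EV W0 (vv u) = fun X => EV W0 (Qb (ww u)) X - (2 : ℂ) • (Fc X • EV W0 (Qa (ww u)) X) := by
    funext X; simp only [vv, EV_smul, EV_sub Wt0, EVF]
  rw [e]; refine ((Qb_hd (ww u) X).sub ((hdF (Qa_hd (ww u) X)).const_smul (2 : ℂ))).congr_deriv ?_
  simp only [vd, EV_smul, EV_sub Wt0, EV_add Wt0, EVF, EV_SA, Sc_eq]; module
lemma vd_hd (u : A) (X : ℝ) : HasDerivAt (EV W0 (vd u)) (EV W0 u X + EV W0 (Rop u) X + (4 - 6 * (1 - Fc X * Fc X)) • EV W0 (vv u) X) X := by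
  have e : EV W0 (vd u) = fun X => EV W0 (ww u) X + (4 : ℂ) • EV W0 (Qa (ww u)) X - (4 : ℂ) • (((Sf X : ℝ) : ℂ) • EV W0 (Qa (ww u)) X) - (2 : ℂ) • (Fc X • EV W0 (Qb (ww u)) X) := by
    funext X; simp only [vd, EV_smul, EV_sub Wt0, EV_add Wt0, EVF, EV_SA]
  rw [e]; refine ((((ww_hd u X).add ((Qa_hd (ww u) X).const_smul (4 : ℂ))).sub ((hdS (Qa_hd (ww u) X)).const_smul (4 : ℂ))).sub
    ((hdF (Qb_hd (ww u) X)).const_smul (2 : ℂ))).congr_deriv ?_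
  simp only [vv, EV_smul, EV_sub Wt0, EVF]; module
lemma exp_uniq {z z' : ℝ → E} (h : ∀ X, HasDerivAt z (z' X) X) (h' : ∀ X, HasDerivAt z' ((4 : ℂ) • z X) X)
    (ht : Tendsto z (cocompact ℝ) (nhds 0)) (X : ℝ) : z X = 0 := by
  have key : ∀ s : ℝ, s * s = 4 → ∀ X, z' X + (s : ℂ) • z X = ((exp (s * X) : ℝ) : ℂ) • (z' 0 + (s : ℂ) • z 0) := fun s hs X => by
    have hh : ∀ X, HasDerivAt (fun X => ((exp (-(s * X)) : ℝ) : ℂ) • (z' X + (s : ℂ) • z X)) 0 X := fun X => by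
      have h1 : HasDerivAt (fun X => exp (-(s * X))) (exp (-(s * X)) * (-s)) X := by
        simpa using ((hasDerivAt_id X).const_mul s).neg.exp
      refine ((h1.ofReal_comp).smul ((h' X).add ((h X).const_smul (s : ℂ)))).congr_deriv ?_
      have hs' : (s : ℂ) * s = 4 := by exact_mod_cast hs
      rw [← hs']; push_cast; simp only [Pi.add_apply, Pi.smul_apply]; module
    have h2 := is_const_of_deriv_eq_zero (fun X => (hh X).differentiableAt) (fun X => (hh X).deriv) X 0
    beta_reduce at h2
    rw [mul_zero, neg_zero, exp_zero, Complex.ofReal_one, one_smul] at h2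
    rw [← h2, smul_smul, ← Complex.ofReal_mul, ← exp_add, add_neg_cancel, exp_zero, Complex.ofReal_one, one_smul]
  have k1 := key 2 (by norm_num); have k2 := key (-2) (by norm_num)
  have e : ∀ X, (4 : ℂ) • z X = ((exp (2 * X) : ℝ) : ℂ) • (z' 0 + ((2 : ℝ) : ℂ) • z 0) - ((exp (-2 * X) : ℝ) : ℂ) • (z' 0 + ((-2 : ℝ) : ℂ) • z 0) := fun X => by
    rw [← k1, ← k2]; push_cast; module
  have lim : ∀ (s : ℝ) (l : Filter ℝ), l ≤ cocompact ℝ → Tendsto (fun X => s * X) l atTop → ∀ a b : E,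
      (∀ X, (4 : ℂ) • z X = ((exp (s * X) : ℝ) : ℂ) • a - ((exp (-s * X) : ℝ) : ℂ) • b) → l.NeBot → a = 0 := fun s l hl hs a b he _ => by
    have t1 := (ht.mono_left hl).const_smul (4 : ℂ)
    have t2 : Tendsto (fun X => ((exp (-s * X) : ℝ) : ℂ) • b) l (nhds 0) := by
      have : Tendsto (fun X => exp (-s * X)) l (nhds 0) := by
        refine (tendsto_exp_neg_atTop_nhds_zero.comp hs).congr fun X => by simp
      have := ((Complex.continuous_ofReal.tendsto 0).comp this).smul_const b
      simpa using this
    have t3 := t1.add t2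
    rw [smul_zero, add_zero] at t3
    have t4 : Tendsto (fun X => ((exp (s * X) : ℝ) : ℂ) • a) l (nhds 0) := t3.congr fun X => by rw [he]; abel
    have t5 := t4.norm
    rw [norm_zero] at t5
    have : ‖a‖ ≤ 0 := ge_of_tendsto t5 (by
      filter_upwards [hs.eventually_ge_atTop 0] with X hX
      rw [norm_smul, Complex.norm_real, norm_of_nonneg (exp_pos _).le]
      exact le_mul_of_one_le_left (norm_nonneg _) (one_le_exp hX))
    exact norm_le_zero_iff.1 this
  have a0 := lim 2 atTop atTop_le_cocompact (tendsto_id.const_mul_atTop two_pos) _ _ e inferInstance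
  have b0 := lim (-2) atBot atBot_le_cocompact (tendsto_id.const_mul_atBot_of_neg (by norm_num)) (-(z' 0 + ((-2 : ℝ) : ℂ) • z 0)) (-(z' 0 + ((2 : ℝ) : ℂ) • z 0))
    (fun X => by rw [e, neg_neg]; module) inferInstance
  have := e X
  rw [a0, neg_eq_zero.1 b0, smul_zero, smul_zero, sub_zero] at this
  exact (smul_eq_zero.1 this).resolve_left (by norm_num)
def Bz (f : L) : L := op (cs trE) (f + at0 (EV W0 (Rop (f, 0)) 0) - (6 : ℂ) • SL W0 (vv (f, 0)))
lemma trtr e : trE (trE e) = trE e := by ext s; simp; ring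
lemma Bz_v (f : L) (X : ℝ) : ev W0 (p0 (Bz f)) X = -trE (EV W0 (vv (f, 0)) X) := by
  set u : A := (f, 0) with hu
  rw [← sub_eq_zero, sub_neg_eq_add]
  have hc : ∀ {g : ℝ → E} {g' : E} {X : ℝ}, HasDerivAt g g' X → HasDerivAt (fun X => trE (g X)) (trE g') X := fun h =>
    ((trE.restrictScalars ℝ).hasFDerivAt.comp_hasDerivAt _ h)
  refine exp_uniq (z := fun X => ev W0 (p0 (Bz f)) X + trE (EV W0 (vv u) X)) (fun X => (p0_hd _ X).add (hc (vv_hd u X)))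
    (fun X => ((q0_hd _ X).add (hc (vd_hd u X))).congr_deriv ?_) ?_ X
  · have : EV W0 u X = ev W0 f X := EV_inl _ _ _
    have h2 : ev W0 (Bz f) X = trE (ev W0 f X) + (1 - Fc X * Fc X) • trE (EV W0 (Rop u) 0) - (6 * (1 - Fc X * Fc X)) • trE (EV W0 (vv u) X) := by
      rw [Bz, ev_cs Wt0, ev_sub Wt0, ev_add Wt0, ev_at0, ev_smul, ev_SL Wt0, Sc_eq]
      simp only [map_add, map_sub, map_smul]; module
    rw [h2, this, Rop_eq u X, Sc_eq]; simp only [map_add, map_smul]; module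
  · have t1 := EV_tendsto W0 (p0 (Bz f), 0)
    have t2 := ((trE.continuous.tendsto 0).comp (EV_tendsto W0 (vv u)))
    have := t1.add t2
    simp only [map_zero, add_zero] at this
    exact this.congr fun X => by simp only [EV_inl, Function.comp]
lemma Bz_eq (f : L) X : ev W0 (Bz f) X - (6 * ((Sf X : ℝ) : ℂ)) • ev W0 (p0 (Bz f)) X =
    trE (ev W0 f X) + ((Sf X : ℝ) : ℂ) • trE (EV W0 (Rop (f, 0)) 0) := by
  rw [Bz_v, Bz, ev_cs Wt0, ev_sub Wt0, ev_add Wt0, ev_at0, ev_smul, ev_SL Wt0]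
  simp only [map_add, map_sub, map_smul]; module
lemma Ul.p0 : Ul fun _ (f : L) => p0 f := Ul.op (Fam.sc (C := 1) fun _ _ => ⟨m0_cont, m0_norm, fun k => by simp [m0]⟩)
lemma Ul.q0 : Ul fun _ (f : L) => q0 f := Ul.op (Fam.sc (C := 1) fun _ _ => ⟨ikm_cont m0_cont, m0_norm1, fun k => by simp [ikm, m0]⟩)
lemma Ul.Pd : Ul fun _ (u : A) => Pd u :=
  (((Ul.SF WF0).comp (Ul.p0.comp Ul.snd)).csmul 2).sub (((Ul.S WF0).comp (Ul.q0.comp Ul.snd)).csmul 2)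
lemma Ul.Pa : Ul fun _ (u : A) => Pa u := ((Ul.p0.comp Ul.fst).sub (Ul.p0.comp Ul.Pd)).pair (Ul.p0.comp Ul.snd)
lemma Ul.Pb : Ul fun _ (u : A) => Pb u :=
  (((Ul.q0.comp Ul.fst).sub (Ul.q0.comp Ul.Pd)).add ((Ul.S WF0).comp (Ul.p0.comp Ul.snd))).pair (Ul.q0.comp Ul.snd)
lemma Ul.F0 : Ul fun _ (u : A) => Bore.FA W0 u := Ul.FA WF0
lemma Ul.inl {V : Type} [NormedAddCommGroup V] [NormedSpace ℂ V] [HV V] {T : ℝ → V → L} (h : Ul T) : Ul fun ε (u : V) => ((T ε u, 0) : A) := by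
  refine h.pair (T := fun _ _ => (0 : L)) ⟨0, le_rfl, fun _ _ => ⟨fun _ _ => by simp, fun u => by simp, fun _ _ => HV.zero⟩⟩
lemma Ul.SA : Ul fun _ (u : A) => SA u := (Ul.SL WF0).inl
lemma Ul.c {V W : Type} [NormedAddCommGroup V] [NormedSpace ℂ V] [HV V] [NormedAddCommGroup W] [NormedSpace ℂ W] [HV W]
    {T : ℝ → V → W} (r : ℝ) {c : ℂ} (hc : c = r) (hT : Ul T) : Ul fun ε u => c • T ε u := by rw [hc]; exact hT.csmul r
lemma Ul.Qa : Ul fun _ (u : A) => Qa u :=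
  ((((Ul.Pa.c 4 (by simp)).add (Ul.Pb.comp Ul.F0)).sub (Ul.F0.comp Ul.Pb)).sub (Ul.F0.comp (Ul.Pa.comp Ul.F0))).c (-1 / 3) (by simp)
lemma Ul.Qb : Ul fun _ (u : A) => Qb u :=
  ((((((Ul.Pb.c 4 (by simp)).add ((Ul.Pa.comp Ul.F0).c 4 (by simp))).sub ((Ul.F0.comp Ul.Pa).c 4 (by simp))).sub (Ul.SA.comp Ul.Pb)).sub
    (Ul.SA.comp (Ul.Pa.comp Ul.F0))).sub (Ul.F0.comp (Ul.Pb.comp Ul.F0))).c (-1 / 3) (by simp)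
lemma Ul.Qc : Ul fun _ (u : A) => Qc u :=
  ((((((Ul.Pb.c 4 (by simp)).add ((Ul.Pa.comp Ul.F0).c 4 (by simp))).sub ((Ul.F0.comp Ul.Pa).c 4 (by simp))).sub (Ul.Pb.comp Ul.SA)).sub
    (Ul.F0.comp (Ul.Pb.comp Ul.F0))).add (Ul.F0.comp (Ul.Pa.comp Ul.SA))).c (-1 / 3) (by simp)
lemma Ul.Qd : Ul fun _ (u : A) => Qd u :=
  (((((((((Ul.Pa.c 16 (by simp)).add ((Ul.Pb.comp Ul.F0).c 4 (by simp))).sub ((Ul.SA.comp Ul.Pa).c 4 (by simp))).sub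
    ((Ul.F0.comp Ul.Pb).c 4 (by simp))).sub ((Ul.Pa.comp Ul.SA).c 4 (by simp))).sub (Ul.SA.comp (Ul.Pb.comp Ul.F0))).sub
    ((Ul.F0.comp (Ul.Pa.comp Ul.F0)).c 4 (by simp))).add (Ul.SA.comp (Ul.Pa.comp Ul.SA))).add (Ul.F0.comp (Ul.Pb.comp Ul.SA))).c (-1 / 3) (by simp)
lemma Ul.ww : Ul fun _ (u : A) => ww u := Ul.Qc.add ((Ul.Qa.comp Ul.F0).c 2 (by simp))
lemma Ul.Rop : Ul fun _ (u : A) => Rop u := (Ul.Qd.add ((Ul.Qb.comp Ul.F0).c 2 (by simp))).sub ((Ul.F0.comp Ul.ww).c 2 (by simp))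
lemma Ul.vv : Ul fun _ (u : A) => vv u := (Ul.Qb.comp Ul.ww).sub ((Ul.F0.comp (Ul.Qa.comp Ul.ww)).c 2 (by simp))
lemma Ul.Bz : Ul fun _ (f : L) => Bz f :=
  (Ul.op (Fam.cs theta_trE')).comp ((Ul.id.add (Ul.at0.comp (Ul.Rop.comp Ul.id.inl))).sub
    (((Ul.SL WF0).comp (Ul.vv.comp Ul.id.inl)).c 6 (by simp)))
end
section
open MeasureTheory
open HV
section
variable {V W : Type} [NormedAddCommGroup V] [NormedSpace ℂ V] [HV V] [NormedAddCommGroup W] [NormedSpace ℂ W] [HV W]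
lemma Ul.lin {T : ℝ → V → W} (h : Ul T) {ε : ℝ} (o : Ok ε) (u v : V) (r : ℝ) :
    T ε (u + (r : ℂ) • v) = T ε u + (r : ℂ) • T ε v := by
  obtain ⟨C, c0, h⟩ := h
  obtain ⟨h1, h2, -⟩ := h ε o
  have z : T ε 0 = 0 := by have := h1 0 0; simpa using this
  have neg : ∀ u, T ε (-u) = -T ε u := fun u => by have := h1 0 u; simpa [z] using this
  have ad : ∀ u v, T ε (u + v) = T ε u + T ε v := fun u v => by
    have := h1 u (-v); rw [neg] at this; simpa using this
  let F : V →+ W := ⟨⟨T ε, z⟩, ad⟩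
  have hF : Continuous F := AddMonoidHomClass.continuous_of_bound F C h2
  rw [ad]; congr 1
  exact map_real_smul F hF r v
lemma G.mono1 {j} (hj : j ≤ 1) {f : ℝ → V → W} (hf : G 1 f) : G j f := by
  interval_cases j
  · exact hf.zero1
  · exact hf
lemma G.c {j : ℕ} {f : ℝ → V → W} (r : ℝ) {c : ℂ} (hc : c = r) (hf : G j f) : G j fun ε u => c • f ε u := by
  rw [hc]; exact hf.csmul r
lemma G.to0 {j} {f : ℝ → V → W} (hj : j ≤ 1) (hf : G j f) : G 0 f := by
  interval_cases j
  · exact hf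
  · exact hf.zero1
end
lemma meanE_one : meanE (1 : E) = 1 := by
  have : (1 : E) = cst 1 := by ext s; simp
  rw [this, meanE_cst]
lemma meanE_isE : meanE isE = 0 := by rw [isE, map_smul, meanE_sE, smul_zero]
lemma trE_one : trE (1 : E) = 1 := by
  have : (1 : E) = cst 1 := by ext s; simp
  rw [this, trE_cst]
lemma cR {e} (h : trE e = e) (ht : theta e = e) : e = (((e p1).re : ℝ) : ℂ) • (1 : E) := by
  have h1 : e pm1 = star (e p1) := by
    have := congrArg (fun z : E => z pm1) ht
    simp only [theta_apply] at this
    rw [← this]; congr 2; ext; simp [negII, pm1, p1]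
  ext s
  rw [← h, trE_apply, trE_apply, h1]
  simp [Complex.ext_iff]
def Gm (w : ℝ → ℝ) (ε : ℝ) (β u : A) : A := (1 / 2 : ℂ) • u - (1 / 2 : ℂ) • FA w u + (ε : ℂ) • mulA w β u
def gP (P : Pr) (ε : ℝ) (b : A) : A := ((-1 / 2 : ℂ) • Sr (W1 (P.l * |ε|)), 0) + (ε : ℂ) • bt' P (P.l * |ε|) b
section
variable (P : Pr) (a σ c ε : ℝ) (b y : A)
def gy : A := mulA (W1 (P.l * |ε|)) (gP P ε b) y
def Lv : A := (σ : ℂ) • gy P ε b y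
def Lq : A := ((c * (a + σ * ε) : ℝ) : ℂ) • gP P ε b + ((ε * (P.l * |ε|) : ℝ) : ℂ) • gy P ε b y
def Lw0 : A := ((-a ^ 2 * σ * c : ℝ) : ℂ) • csA mI (gP P ε b)
def Lw1 : A := (σ : ℂ) • Gm (W1 (P.l * |ε|)) ε (bt P (P.l * |ε|) b) y
  - ((a * σ : ℝ) : ℂ) • csA mI (((c * σ : ℝ) : ℂ) • gP P ε b + ((P.l * |ε| : ℝ) : ℂ) • gy P ε b y)
def nh : A := TA a (P.l * |ε|) (Lw1 P a σ c ε b y) - KA a (P.l * |ε|) (Lv P σ ε b y)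
  + scA (iph (P.l * |ε|)) (csA meanE (csA mI (Lv P σ ε b y)))
def nn : A := TA a (P.l * |ε|) (Lw0 P a σ c ε b) + (ε : ℂ) • nh P a σ c ε b y
def yy : A := scA (dph (P.l * |ε|)) (nn P a σ c ε b y) - (σ : ℂ) • csA mI (Lq P a σ c ε b y)
end
section
variable {V : Type} [NormedAddCommGroup V] [NormedSpace ℂ V] [HV V] (P : Pr)
lemma G.Gm {j : ℕ} (hj : j ≤ 1) {w : ℝ → ℝ → ℝ} (h : WF w) {f g : ℝ → V → A} (hf : G 0 f) (hg : G j g) :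
    G j fun ε u => Bore.Gm (w ε) ε (f ε u) (g ε u) :=
  ((hg.c (1 / 2) (by simp)).sub ((hg.lin (Ul.FA h)).c (1 / 2) (by simp))).add
    ((G.eps (G.mulA h hf (hg.to0 hj))).mono1 hj)
lemma gs_const : ∀ ε, Ok ε → Hm (((-1 / 2 : ℂ) • Sr (W1 (P.l * |ε|)), 0) : A) ∧ ‖(((-1 / 2 : ℂ) • Sr (W1 (P.l * |ε|)), 0) : A)‖ ≤ shK := fun ε o => by
  have h := WF1 P.hl ε o
  have hs := Sr_norm h
  have e : (-1 / 2 : ℂ) = ((-1 / 2 : ℝ) : ℂ) := by simp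
  refine ⟨⟨by rw [e]; exact HV.smul _ (Sr_herm h), HV.zero⟩, max_le ?_ (by simpa using (norm_nonneg _).trans hs)⟩
  rw [norm_smul]
  have : ‖(-1 / 2 : ℂ)‖ ≤ 1 := by norm_num
  nlinarith [norm_nonneg (Sr (W1 (P.l * |ε|)))]
lemma d_bd {ε} (o : Ok ε) : |P.l * abs ε| ≤ P.l := by
  rw [abs_of_nonneg (dnn P.hl ε)]; exact dle P o
lemma G.gP {f : ℝ → V → A} (hf : G 0 f) : G 1 fun ε u => Bore.gP P ε (f ε u) :=
  (G.const (gs_const P)).add (G.eps (hf.lin (Ul.bt' P)))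
variable {j : ℕ} (hj : j ≤ 1) {f g : ℝ → V → A} (hf : G 0 f) (hg : G j g) {a : ℝ} (ha : 0 < a) (σ c : ℝ)
include hj hf hg
lemma G.gy : G j fun ε u => Bore.gy P ε (f ε u) (g ε u) := G.mulA (WF1 P.hl) ((G.gP P hf).mono1 hj) hg
lemma G.Lv : G j fun ε u => Bore.Lv P σ ε (f ε u) (g ε u) := (G.gy P hj hf hg).csmul σ
lemma G.Lq (a : ℝ) : G 1 fun ε u => Bore.Lq P a σ c ε (f ε u) (g ε u) :=
  ((G.gP P hf).smul (r := fun ε => c * (a + σ * ε)) (C := |c| * (|a| + |σ|)) (fun ε o => by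
    rw [abs_mul]; refine mul_le_mul_of_nonneg_left ((abs_add_le _ _).trans ?_) (abs_nonneg c)
    rw [abs_mul]; nlinarith [o.2, abs_nonneg σ])).add
  (G.ssmul (r := fun ε => ε * (P.l * |ε|)) (C := P.l) (fun ε o => by
    rw [abs_mul, mul_comm]; exact mul_le_mul_of_nonneg_right (d_bd P o) (abs_nonneg _)) ((G.gy P hj hf hg).to0 hj))
include ha
lemma G.nh : G j fun ε u => Bore.nh P a σ c ε (f ε u) (g ε u) := by
  have hv := G.Lv P hj hf hg σ
  refine ((G.lin (f := fun ε u => Bore.Lw1 P a σ c ε (f ε u) (g ε u)) ?_ (Ul.TA P.hl ha)).sub (hv.lin (Ul.KA P.hl ha))).add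
    (((hv.lin (Ul.csA theta_mI)).lin (Ul.csA theta_meanE')).lin (Ul.inc P.hl))
  refine ((G.Gm hj (WF1 P.hl) (hf.lin (Ul.bt P)) hg).csmul σ).sub (G.csmul (a * σ) (G.lin ?_ (Ul.csA theta_mI)))
  exact (((G.gP P hf).mono1 hj).csmul (c * σ)).add ((G.gy P hj hf hg).smul (r := fun ε => P.l * |ε|) (C := P.l) fun ε o => d_bd P o)
lemma G.nn : G 1 fun ε u => Bore.nn P a σ c ε (f ε u) (g ε u) :=
  ((((G.gP P hf).lin (Ul.csA theta_mI)).csmul (-a ^ 2 * σ * c)).lin (Ul.TA P.hl ha)).add (G.eps ((G.nh P hj hf hg ha σ c).to0 hj))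
lemma G.yy : G 1 fun ε u => Bore.yy P a σ c ε (f ε u) (g ε u) :=
  ((G.nn P hj hf hg ha σ c).lin (Ul.up P.hl)).sub (((G.Lq P hj hf hg σ c a).lin (Ul.csA theta_mI)).csmul σ)
end
end
section
open MeasureTheory
open HV
lemma Ul.hm {V W : Type} [NormedAddCommGroup V] [NormedSpace ℂ V] [HV V] [NormedAddCommGroup W] [NormedSpace ℂ W] [HV W]
    {T : ℝ → V → W} (h : Ul T) {ε} (o : Ok ε) {u : V} (hu : Hm u) : Hm (T ε u) := by
  obtain ⟨C, -, h⟩ := h; exact (h ε o).2.2 u hu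
section
variable (P : Pr) (ε : ℝ) (b : A)
def bR (X : ℝ) : ℝ := (EV (W1 (P.l * |ε|)) (bt P (P.l * |ε|) b) X p1).re
def gR (X : ℝ) : ℝ := (EV (W1 (P.l * |ε|)) (gP P ε b) X p1).re
def GR (X : ℝ) : ℝ := (1 - tanh X) / 2 + ε * bR P ε b X
variable {ε b} (o : Ok ε) (hb : Hm b)
include o
lemma bt_tr X : trE (EV (W1 (P.l * |ε|)) (bt P (P.l * |ε|) b) X) = EV (W1 (P.l * |ε|)) (bt P (P.l * |ε|) b) X := by
  simp only [EV, bt, bt1, ev_pq P (dnn P.hl ε) (dle P o), evs_op_cs (NmP P).BCs, map_add, map_smul, trtr]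
lemma bt'_tr X : trE (EV (W1 (P.l * |ε|)) (bt' P (P.l * |ε|) b) X) = EV (W1 (P.l * |ε|)) (bt' P (P.l * |ε|) b) X := by
  have h := (bt_deriv P (dnn P.hl ε) (dle P o) b X)
  have h2 := (trE.restrictScalars ℝ).hasFDerivAt.comp_hasDerivAt X h
  exact h2.unique (h.congr_of_eventuallyEq (Eventually.of_forall fun x => bt_tr P o x))
include hb
lemma EVb X : EV (W1 (P.l * |ε|)) (bt P (P.l * |ε|) b) X = ((bR P ε b X : ℝ) : ℂ) • (1 : E) :=
  cR (bt_tr P o X) (EV_theta (WF1 P.hl ε o) ((Ul.bt P).hm o hb) X)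
lemma EVg X : EV (W1 (P.l * |ε|)) (gP P ε b) X = ((gR P ε b X : ℝ) : ℂ) • (1 : E) := by
  have hw := WF1 P.hl ε o
  refine cR ?_ (EV_theta hw (HV.add (gs_const P ε o).1 (HV.smul ε ((Ul.bt' P).hm o hb))) X)
  simp only [gP, EV_add hw, EV_smul, EV_inl, ev_smul, ev_Sr hw, map_add, map_smul, trE_one, bt'_tr P o]
lemma EVg' X : gR P ε b X = -Sf X / 2 + ε * (EV (W1 (P.l * |ε|)) (bt' P (P.l * |ε|) b) X p1).re := by
  have hw := WF1 P.hl ε o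
  rw [gR, gP, EV_add hw, EV_smul, EV_inl, ev_smul, ev_Sr hw]
  simp; ring
lemma bR_hd X : HasDerivAt (bR P ε b) (EV (W1 (P.l * |ε|)) (bt' P (P.l * |ε|) b) X p1).re X := by
  have h := (bt_deriv P (dnn P.hl ε) (dle P o) b X)
  have h2 := ((Complex.reCLM.comp ((evalE p1).restrictScalars ℝ)).hasFDerivAt.comp_hasDerivAt X h)
  exact h2
lemma GR_hd X : HasDerivAt (GR P ε b) (gR P ε b X) X := by
  refine (((tanh_hd X).const_sub 1).div_const 2 |>.add ((bR_hd P o hb X).const_mul ε)).congr_deriv ?_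
  rw [EVg' P o hb]
lemma EVGm u X : EV (W1 (P.l * |ε|)) (Gm (W1 (P.l * |ε|)) ε (bt P (P.l * |ε|) b) u) X = ((GR P ε b X : ℝ) : ℂ) • EV (W1 (P.l * |ε|)) u X := by
  have hw := WF1 P.hl ε o
  simp only [Gm, EV_add hw, EV_sub hw, EV_smul, EV_FA hw, EV_mulA hw, EVb P o hb, smul_mul_assoc, one_mul, GR]
  push_cast [-Complex.ofReal_tanh]; module
lemma EVgy y X : EV (W1 (P.l * |ε|)) (gy P ε b y) X = ((gR P ε b X : ℝ) : ℂ) • EV (W1 (P.l * |ε|)) y X := by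
  rw [gy, EV_mulA (WF1 P.hl ε o), EVg P o hb, smul_mul_assoc, one_mul]
end
section
variable (P : Pr) {a : ℝ} (ha : 0 < a) (σ c : ℝ) {ε : ℝ} {b y : A} (o : Ok ε) (hb : Hm b)
def Lw (P : Pr) (a σ c ε : ℝ) (b y : A) : A := Lw0 P a σ c ε b + (ε : ℂ) • Lw1 P a σ c ε b y
def QQ (P : Pr) (a σ c ε : ℝ) (b y : A) (X : ℝ) : E := ((c * (a + σ * ε) * gR P ε b X : ℝ) : ℂ) • (1 : E)
  + ((ε * (P.l * |ε|) * gR P ε b X : ℝ) : ℂ) • EV (W1 (P.l * |ε|)) y X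
include o hb
lemma EVq X : EV (W1 (P.l * |ε|)) (Lq P a σ c ε b y) X = QQ P a σ c ε b y X := by
  have hw := WF1 P.hl ε o
  simp only [Lq, EV_add hw, EV_smul, EVgy P o hb, EVg P o hb, QQ]
  push_cast; module
lemma EVw (hσ : σ ^ 2 = 1) X : EV (W1 (P.l * |ε|)) (Lw P a σ c ε b y) X = ((σ * ε * GR P ε b X : ℝ) : ℂ) • EV (W1 (P.l * |ε|)) y X
    - ((a * σ : ℝ) : ℂ) • (isE * QQ P a σ c ε b y X) := by
  have hw := WF1 P.hl ε o
  simp only [Lw, Lw0, Lw1, EV_add hw, EV_sub hw, EV_smul, EV_csA hw, EVgy P o hb, EVg P o hb, EVGm P o hb, QQ, mI_apply, mul_add, mul_smul_comm, mul_one]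
  have : (σ : ℂ) ^ 2 = 1 := by exact_mod_cast hσ
  push_cast; match_scalars
  · linear_combination (a * c * ε * (gR P ε b X : ℂ) * 0) * this
  · ring
  · ring
lemma EVv X : EV (W1 (P.l * |ε|)) (Lv P σ ε b y) X = ((σ * gR P ε b X : ℝ) : ℂ) • EV (W1 (P.l * |ε|)) y X := by
  simp only [Lv, EV_smul, EVgy P o hb]; push_cast; module
include ha
omit hb in
lemma nn_eq : nn P a σ c ε b y = TA a (P.l * |ε|) (Lw P a σ c ε b y) - (ε : ℂ) • KA a (P.l * |ε|) (Lv P σ ε b y)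
    + (ε : ℂ) • scA (iph (P.l * |ε|)) (csA meanE (csA mI (Lv P σ ε b y))) := by
  rw [Lw, (Ul.TA P.hl ha).lin o, nn, nh]; module
omit hb in
lemma TA_mean u X : meanE (EV W0 (TA a (P.l * |ε|) u) X) = 0 := by
  have h := KA_deriv ha (dnn P.hl ε) u X
  have h2 := (meanE.restrictScalars ℝ).hasFDerivAt.comp_hasDerivAt X h
  refine h2.unique ?_
  convert hasDerivAt_const X (0 : E) using 1
  funext x; exact KA_mean (dnn P.hl ε) u x
lemma EVn X : EV W0 (nn P a σ c ε b y) X = EV W0 (TA a (P.l * |ε|) (Lw P a σ c ε b y)) X - (ε : ℂ) • EV W0 (KA a (P.l * |ε|) (Lv P σ ε b y)) X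
    + ((ε * (σ * gR P ε b X) : ℝ) : ℂ) • meanE (isE * EV (W1 (P.l * |ε|)) y X) := by
  have hw := WF1 P.hl ε o
  rw [nn_eq P ha σ c o, EV_add Wt0, EV_sub Wt0, EV_smul, EV_smul, EV_inc (dnn P.hl ε), EV_csA hw, EV_csA hw, EVv P σ o hb, mI_apply]
  rw [mul_smul_comm, map_smul]; push_cast; module
omit hb ha in
lemma mean_Q X : meanE (isE * QQ P a σ c ε b y X) = ((ε * (P.l * |ε|) * gR P ε b X : ℝ) : ℂ) • meanE (isE * EV (W1 (P.l * |ε|)) y X) := by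
  rw [QQ, mul_add, mul_smul_comm, mul_smul_comm, mul_one, map_add, map_smul, map_smul, meanE_isE, smul_zero, zero_add]
variable (hy : y = yy P a σ c ε b y)
include hy
omit ha in
lemma L1 X : EV (W1 (P.l * |ε|)) y X = ((P.l * |ε| : ℝ) : ℂ) • EV W0 (nn P a σ c ε b y) X - (σ : ℂ) • (isE * QQ P a σ c ε b y X) := by
  have hw := WF1 P.hl ε o
  conv_lhs => rw [hy, yy, EV_sub hw, EV_up (dnn P.hl ε), EV_smul, EV_csA hw, EVq P σ c o hb, mI_apply]
lemma L2 X : meanE (EV (W1 (P.l * |ε|)) y X) = 0 := by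
  rw [L1 P σ c o hb hy, map_sub, map_smul, map_smul, mean_Q P σ c o, EVn P ha σ c o hb, map_add, map_sub, map_smul, map_smul,
    TA_mean P ha o, KA_mean (dnn P.hl ε), meanE_meanE]
  push_cast; module
lemma L3 (hσ : σ ^ 2 = 1) X : EV W0 (nn P a σ c ε b y) X - c1 (EV W0 (nn P a σ c ε b y) X) =
    Jop ((Complex.I * ((a + σ * ε * GR P ε b X : ℝ) : ℂ)) • deriv (EV (W1 (P.l * |ε|)) y) X) := by
  have hw := WF1 P.hl ε o
  have hδ := dnn P.hl ε
  set δ := P.l * |ε| with hd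
  set w := Lw P a σ c ε b y with hw'
  set v := Lv P σ ε b y with hv'
  have d1 := EV_hd Wt0 (TA a δ w) X
  have d2 := EV_hd hw w X
  have eqK := (Jop.restrictScalars ℝ).hasFDerivAt.comp_hasDerivAt X
    (((d2.sub ((meanE.restrictScalars ℝ).hasFDerivAt.comp_hasDerivAt X d2)).const_smul Complex.I).add
      (d1.const_smul (Complex.I * ((a * δ : ℝ) : ℂ))))
  have kd := KA_deriv ha hδ w X
  have eqK' := kd.sub ((c1.restrictScalars ℝ).hasFDerivAt.comp_hasDerivAt X kd)
  have k1 := eqK'.unique (by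
    convert eqK using 1
    funext x; exact KA_eq ha hδ w x)
  have k2 := KA_eq ha hδ v X
  simp only [ContinuousLinearMap.coe_restrictScalars'] at k1
  have dy := EV_hd hw y X
  have dG := GR_hd P o hb X
  have dn := EV_hd Wt0 (nn P a σ c ε b y) X
  have dQ : HasDerivAt (QQ P a σ c ε b y) (deriv (QQ P a σ c ε b y) X) X := by
    have : QQ P a σ c ε b y = EV (W1 δ) (Lq P a σ c ε b y) := by funext x; exact (EVq P σ c o hb x).symm
    rw [this]; exact EV_hd hw _ X
  have dw : deriv (EV (W1 δ) w) X = ((σ * ε * gR P ε b X : ℝ) : ℂ) • EV (W1 δ) y X + ((σ * ε * GR P ε b X : ℝ) : ℂ) • deriv (EV (W1 δ) y) X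
      - ((a * σ : ℝ) : ℂ) • (isE * deriv (QQ P a σ c ε b y) X) := by
    have h1 := (((dG.const_mul (σ * ε)).ofReal_comp).smul dy).sub ((((mI.restrictScalars ℝ).hasFDerivAt.comp_hasDerivAt X dQ)).const_smul ((a * σ : ℝ) : ℂ))
    refine d2.unique ?_
    have e : EV (W1 δ) w = _ := funext fun x => EVw P σ c o hb hσ x
    rw [e]
    refine h1.congr_deriv ?_
    simp only [ContinuousLinearMap.coe_restrictScalars', mI_apply]; module
  have dy' : deriv (EV (W1 δ) y) X = (δ : ℂ) • deriv (EV W0 (nn P a σ c ε b y)) X - (σ : ℂ) • (isE * deriv (QQ P a σ c ε b y) X) := by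
    have h1 := (dn.const_smul (δ : ℂ)).sub ((((mI.restrictScalars ℝ).hasFDerivAt.comp_hasDerivAt X dQ)).const_smul (σ : ℂ))
    refine dy.unique ?_
    have e : EV (W1 δ) y = _ := funext fun x => L1 P σ c o hb hy x
    rw [e]
    refine h1.congr_deriv ?_
    simp only [ContinuousLinearMap.coe_restrictScalars', mI_apply]
  have my : meanE (deriv (EV (W1 δ) y) X) = 0 := by
    have h2 := (meanE.restrictScalars ℝ).hasFDerivAt.comp_hasDerivAt X dy
    refine h2.unique ?_
    convert hasDerivAt_const X (0 : E) using 1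
    funext x; exact L2 P ha σ c o hb hy x
  have hn : (δ : ℂ) • deriv (EV W0 (nn P a σ c ε b y)) X = (δ : ℂ) • deriv (EV W0 (TA a δ w)) X - ((δ * ε : ℝ) : ℂ) • EV W0 (TA a δ v) X
      + (σ : ℂ) • meanE (isE * deriv (QQ P a σ c ε b y) X) := by
    have h1 := ((d1.const_smul (δ : ℂ)).sub ((KA_deriv ha hδ v X).const_smul ((δ * ε : ℝ) : ℂ))).add
      ((((meanE ∘L mI).restrictScalars ℝ).hasFDerivAt.comp_hasDerivAt X dQ).const_smul (σ : ℂ))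
    refine (dn.const_smul (δ : ℂ)).unique ?_
    refine (h1.congr_deriv ?_).congr_of_eventuallyEq (Eventually.of_forall fun x => ?_)
    · simp only [ContinuousLinearMap.coe_restrictScalars', mI_apply, ContinuousLinearMap.comp_apply]
    · simp only [Pi.add_apply, Pi.sub_apply, Pi.smul_apply, Function.comp, ContinuousLinearMap.coe_restrictScalars', mI_apply, ContinuousLinearMap.comp_apply]
      rw [mean_Q P σ c o, EVn P ha σ c o hb, ← hd]; push_cast; module
  rw [EVn P ha σ c o hb, map_add, map_sub, map_smul, map_smul, c1_meanE]
  have hv : EV (W1 δ) v X = _ := EVv P σ o hb X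
  rw [hv, map_smul, L2 P ha σ c o hb hy X, smul_zero, sub_zero] at k2
  have mw : meanE (deriv (EV (W1 δ) w) X) = -(((a * σ : ℝ) : ℂ) • meanE (isE * deriv (QQ P a σ c ε b y) X)) := by
    rw [dw, map_sub, map_add, map_smul, map_smul, map_smul, my, L2 P ha σ c o hb hy]; module
  have e1 : ∀ p q : E, ∀ z : E, p - (ε : ℂ) • q + z - (c1 p - (ε : ℂ) • c1 q + z) = (p - c1 p) - (ε : ℂ) • (q - c1 q) := by intros; module
  rw [e1, k1, k2, ← map_smul Jop, ← map_sub Jop]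
  congr 1
  rw [mw, dw]
  have hn' := congrArg (fun z => (Complex.I * (a : ℂ)) • z) hn
  have hy' := congrArg (fun z => (Complex.I * (a : ℂ)) • z) dy'
  beta_reduce at hn' hy'
  push_cast at hn' hy' ⊢
  linear_combination (norm := module) -hn' - hy'
end
end
section
open MeasureTheory
open HV
section
variable {V : Type} [NormedAddCommGroup V] [NormedSpace ℂ V] [HV V] [CompleteSpace V]
lemma G.fix {Θ : ℝ → V → V} (h : G 1 Θ) : ∃ ε₁ > 0, ∃ R, ∀ ε, Ok ε → |ε| < ε₁ → ∃ u, Hm u ∧ ‖u‖ ≤ R ∧ Θ ε u = u := by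
  obtain ⟨M0, m0, h0⟩ := h.2 0
  obtain ⟨M, m1, hM⟩ := h.2 (M0 + 1)
  refine ⟨1 / (2 * (M + 1) * (M0 + 1)), by positivity, M0 + 1, fun ε o he => ?_⟩
  rw [lt_div_iff₀ (by positivity)] at he
  have e0 := abs_nonneg ε
  have he1 : M * |ε| * (M0 + 1) ≤ 1 / 2 := by nlinarith [mul_nonneg e0 m0, mul_nonneg e0 m1, mul_nonneg (mul_nonneg e0 m1) m0]
  have he2 : M * |ε| ≤ 1 / 2 := by nlinarith [mul_nonneg m1 e0]
  let s : Set V := {u | Hm u} ∩ Metric.closedBall 0 (M0 + 1)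
  have hs : IsComplete s := (closed.inter Metric.isClosed_closedBall).isComplete
  have z : ‖(0 : V)‖ ≤ M0 + 1 := by rw [norm_zero]; positivity
  have maps : MapsTo (Θ ε) s s := fun u hu => by
    refine ⟨h.1 ε o u hu.1, ?_⟩
    have hu2 := mem_closedBall_zero_iff.1 hu.2
    rw [mem_closedBall_zero_iff]
    have h1 := (h0 ε o 0 0 (by simp) (by simp)).1
    have h2 := (hM ε o u 0 hu2 z).2
    rw [pow_one, sub_zero] at h2
    have h3 : ‖Θ ε u‖ ≤ ‖Θ ε u - Θ ε 0‖ + ‖Θ ε 0‖ := by simpa using norm_add_le (Θ ε u - Θ ε 0) (Θ ε 0)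
    have h4 : M * |ε| * ‖u‖ ≤ M * |ε| * (M0 + 1) := by gcongr
    linarith
  have hc : ContractingWith (1 / 2) (maps.restrict (Θ ε) s s) := by
    refine ⟨by rw [← NNReal.coe_lt_coe]; norm_num, LipschitzWith.of_dist_le_mul fun u v => ?_⟩
    rw [Subtype.dist_eq, Subtype.dist_eq, dist_eq_norm, dist_eq_norm]
    refine ((hM ε o u v (mem_closedBall_zero_iff.1 u.2.2) (mem_closedBall_zero_iff.1 v.2.2)).2).trans ?_
    rw [pow_one]; push_cast
    exact mul_le_mul_of_nonneg_right he2 (norm_nonneg _)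
  obtain ⟨u, hu, hf, -⟩ := hc.exists_fixedPoint' hs maps (x := 0) ⟨HV.zero, by rw [mem_closedBall_zero_iff]; exact z⟩ (edist_ne_top _ _)
  exact ⟨u, hu.1, mem_closedBall_zero_iff.1 hu.2, hf⟩
end
structure Dt where
  P : Pr
  ρ : ℝ
  c : ℝ
  κ : ℝ
  hρ : 0 < ρ
  hρ1 : ρ < 1
  hc : 0 < c
  hκ : 0 < κ
  hs : P.a + P.b = 1
  hc2 : c ^ 2 = P.a - P.b
  hr : ρ * P.a ^ 2 = P.b ^ 2
  hκ2 : 2 * κ = P.a * P.b * (1 - ρ)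
  hp : P.p * κ = 2 * P.l ^ 2 * c ^ 2 * (P.a * P.b) ^ 2 * P.a
  hq : P.q * κ = 2 * P.l ^ 2 * c ^ 2 * (P.a * P.b) ^ 2 * (ρ * P.b)
section
variable (D : Dt) (ε : ℝ) (β : A)
def H1m (u : A) : A := (D.P.a : ℂ) • u + (ε : ℂ) • Gm W0 ε β u
def H2m (u : A) : A := (D.P.b : ℂ) • u - (ε : ℂ) • Gm W0 ε β u
def g1m : A := ((-1 / 4 : ℂ) • Sr W0, 0) - (ε : ℂ) • FA W0 β + (ε : ℂ) • (ε : ℂ) • mulA W0 β β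
def Eq1 : A := Gm W0 ε β (((3 * D.c ^ 2 : ℝ) : ℂ) • Gm W0 ε β (g1m ε β) - ((D.c ^ 2 : ℝ) : ℂ) • g1m ε β + (2 : ℂ) • (ε : ℂ) • Gm W0 ε β (Gm W0 ε β (g1m ε β)))
def EA2 (n : A) : A := ((2 * D.P.a * D.P.b : ℝ) : ℂ) • Gm W0 ε β n + (D.P.b : ℂ) • (ε : ℂ) • Gm W0 ε β (Gm W0 ε β n) - H1m D ε β (H1m D ε β n)
def EA1 (n : A) : A := H2m D ε β (H2m D ε β n) - ((2 * D.P.a * D.P.b : ℝ) : ℂ) • Gm W0 ε β n + (D.P.a : ℂ) • (ε : ℂ) • Gm W0 ε β (Gm W0 ε β n)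
def Ez (g : A) : A := H1m D ε β (H1m D ε β (H2m D ε β (H2m D ε β (mulA W0 g g))))
def Eop (g n1 n2 h1 h2 : A) : A := (G0 D.P ε, 0) - (12 : ℂ) • (ε : ℂ) • FA W0 (mulA W0 β β) + (8 : ℂ) • (ε : ℂ) • (ε : ℂ) • mulA W0 β (mulA W0 β β)
  + ((-2 / (D.P.a * D.P.b) : ℝ) : ℂ) • Eq1 D ε β
  + ((2 * D.P.l ^ 2 * D.c / D.κ : ℝ) : ℂ) • ((D.ρ : ℂ) • EA2 D ε β n2 - EA1 D ε β n1 + ((D.ρ * D.P.b * D.P.a ^ 2 : ℝ) : ℂ) • h2 - ((D.P.a * D.P.b ^ 2 : ℝ) : ℂ) • h1)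
  + ((D.P.l ^ 4 / D.κ : ℝ) : ℂ) • (ε : ℂ) • (ε : ℂ) • ((D.ρ : ℂ) • H1m D ε β (H1m D ε β (mulA W0 n2 n2)) - H2m D ε β (H2m D ε β (mulA W0 n1 n1)))
  + ((D.P.l ^ 2 * (D.ρ - 1) / D.κ : ℝ) : ℂ) • ((2 : ℂ) • (ε : ℂ) • (Gm W0 ε β (Ez D ε β g) - Ez D ε β g) - ((D.c ^ 2 : ℝ) : ℂ) • Ez D ε β g)
end
lemma g1m_const : ∀ ε, Ok ε → Hm (((-1 / 4 : ℂ) • Sr W0, 0) : A) ∧ ‖(((-1 / 4 : ℂ) • Sr W0, 0) : A)‖ ≤ shK := fun ε o => by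
  have e : (-1 / 4 : ℂ) = ((-1 / 4 : ℝ) : ℂ) := by simp
  refine ⟨⟨by rw [e]; exact HV.smul _ (Sr_herm Wt0), HV.zero⟩, max_le ?_ (by simpa using (norm_nonneg _).trans (Sr_norm Wt0))⟩
  rw [norm_smul]
  have : ‖(-1 / 4 : ℂ)‖ ≤ 1 := by norm_num
  nlinarith [norm_nonneg (Sr W0), Sr_norm Wt0]
lemma G0A_const P : ∀ ε, Ok ε → Hm ((G0 P ε, 0) : A) ∧ ‖((G0 P ε, 0) : A)‖ ≤ 384 * P.l * shK := fun ε o =>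
  ⟨⟨(G0_const P ε o).1, HV.zero⟩, max_le (G0_const P ε o).2 (by simpa using (norm_nonneg _).trans (G0_const P ε o).2)⟩
section
variable {V : Type} [NormedAddCommGroup V] [NormedSpace ℂ V] [HV V] (D : Dt) {β : ℝ → V → A} (hβ : G 0 β)
include hβ
lemma G.Gm1 {u : ℝ → V → A} (hu : G 1 u) : G 1 fun ε v => Bore.Gm W0 ε (β ε v) (u ε v) := G.Gm le_rfl WF0 hβ hu
lemma G.H1m {u} (hu : G 1 u) : G 1 fun ε v => Bore.H1m D ε (β ε v) (u ε v) :=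
  (hu.csmul _).add (G.Gm1 hβ hu).zero1.eps
lemma G.H2m {u} (hu : G 1 u) : G 1 fun ε v => Bore.H2m D ε (β ε v) (u ε v) :=
  (hu.csmul _).sub (G.Gm1 hβ hu).zero1.eps
lemma G.g1m : G 1 fun ε v => Bore.g1m ε (β ε v) :=
  ((G.const (W := A) g1m_const).sub (hβ.lin Ul.F0).eps).add (G.mulA WF0 hβ hβ).eps.zero1.eps
lemma G.Eq1 : G 1 fun ε v => Bore.Eq1 D ε (β ε v) :=
  G.Gm1 hβ ((((G.Gm1 hβ (G.g1m hβ)).csmul _).sub ((G.g1m hβ).csmul _)).add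
    ((G.Gm1 hβ (G.Gm1 hβ (G.g1m hβ))).zero1.eps.c 2 (by simp)))
lemma G.EA2 {u} (hu : G 1 u) : G 1 fun ε v => Bore.EA2 D ε (β ε v) (u ε v) :=
  (((G.Gm1 hβ hu).csmul _).add ((G.Gm1 hβ (G.Gm1 hβ hu)).zero1.eps.csmul _)).sub (G.H1m D hβ (G.H1m D hβ hu))
lemma G.EA1 {u} (hu : G 1 u) : G 1 fun ε v => Bore.EA1 D ε (β ε v) (u ε v) :=
  ((G.H2m D hβ (G.H2m D hβ hu)).sub ((G.Gm1 hβ hu).csmul _)).add ((G.Gm1 hβ (G.Gm1 hβ hu)).zero1.eps.csmul _)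
lemma G.Ez {u : ℝ → V → A} (hu : G 1 u) : G 1 fun ε v => Bore.Ez D ε (β ε v) (u ε v) :=
  G.H1m D hβ (G.H1m D hβ (G.H2m D hβ (G.H2m D hβ (G.mulA WF0 hu hu))))
lemma G.Eop {g n1 n2 h1 h2 : ℝ → V → A} (hg : G 1 g) (k1 : G 1 n1) (k2 : G 1 n2) (l1 : G 1 h1) (l2 : G 1 h2) :
    G 1 fun ε v => Bore.Eop D ε (β ε v) (g ε v) (n1 ε v) (n2 ε v) (h1 ε v) (h2 ε v) := by
  have bb := G.mulA WF0 hβ hβ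
  have z := G.Ez D hβ hg
  have t1 : G 1 fun ε (_ : V) => ((G0 D.P ε, 0) : A) := G.const (G0A_const D.P)
  have t2 : G 1 fun ε v => (12 : ℂ) • (ε : ℂ) • FA W0 (Bore.mulA W0 (β ε v) (β ε v)) := (bb.lin Ul.F0).eps.c 12 (by simp)
  have t3 : G 1 fun ε v => (8 : ℂ) • (ε : ℂ) • (ε : ℂ) • Bore.mulA W0 (β ε v) (Bore.mulA W0 (β ε v) (β ε v)) := (G.mulA WF0 hβ bb).eps.zero1.eps.c 8 (by simp)
  have t4 := (G.Eq1 D hβ).csmul (-2 / (D.P.a * D.P.b))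
  have t5 := (((((G.EA2 D hβ k2).csmul D.ρ).sub (G.EA1 D hβ k1)).add (l2.csmul (D.ρ * D.P.b * D.P.a ^ 2))).sub (l1.csmul (D.P.a * D.P.b ^ 2))).csmul (2 * D.P.l ^ 2 * D.c / D.κ)
  have t6 := (((G.H1m D hβ (G.H1m D hβ (G.mulA WF0 k2 k2))).csmul D.ρ).sub (G.H2m D hβ (G.H2m D hβ (G.mulA WF0 k1 k1)))).zero1.eps.zero1.eps.csmul (D.P.l ^ 4 / D.κ)
  have t7 : G 1 fun ε v => (2 : ℂ) • (ε : ℂ) • (Bore.Gm W0 ε (β ε v) (Bore.Ez D ε (β ε v) (g ε v)) - Bore.Ez D ε (β ε v) (g ε v)) :=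
    ((G.Gm1 hβ z).sub z).zero1.eps.c 2 (by simp)
  exact (((((t1.sub t2).add t3).add t4).add t5).add t6).add ((t7.sub (z.csmul (D.c ^ 2))).csmul (D.P.l ^ 2 * (D.ρ - 1) / D.κ))
end
end
section
open MeasureTheory
open HV
section
variable (D : Dt) (ε : ℝ) (b z1 z2 e : A)
def EEo : A := Eop D ε (scA (iph (D.P.l * |ε|)) (bt D.P (D.P.l * |ε|) b)) (scA (iph (D.P.l * |ε|)) (gP D.P ε b))
  (csA trE (nn D.P D.P.a 1 D.c ε b z1)) (csA trE (nn D.P D.P.b (-1) D.c ε b z2))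
  (csA trE (nh D.P D.P.a 1 D.c ε b z1)) (csA trE (nh D.P D.P.b (-1) D.c ε b z2))
def dm (P : Pr) (ε k : ℝ) : ℂ := ((PP P (P.l * |ε|) k - (4 + k ^ 2)⁻¹ : ℝ) : ℂ)
def b2n : L := (-1 : ℂ) • op (cs trE) e.2
def fo (P : Pr) : L := (6 : ℂ) • cv W0 (Sr W0) (op (sc (dm P ε)) (op (cs trE) b.1))
  + (6 : ℂ) • SL W0 (scA (iph (P.l * |ε|)) (bt P (P.l * |ε|) (0, b2n e))) - e.1
def y1n : A := yy D.P D.P.a 1 D.c ε b z1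
def y2n : A := yy D.P D.P.b (-1) D.c ε b z2
def Th (u : A × A × A) : A × A × A :=
  ((Bz (fo ε u.1 (EEo D ε u.1 (y1n D ε u.1 u.2.1) (y2n D ε u.1 u.2.2)) D.P), b2n (EEo D ε u.1 (y1n D ε u.1 u.2.1) (y2n D ε u.1 u.2.2))),
    y1n D ε u.1 u.2.1, y2n D ε u.1 u.2.2)
end
lemma dm_us P : ∀ ε, Ok ε → Continuous (sc (dm P ε)) ∧ (∀ k, ‖sc (dm P ε) k‖ ≤ (768 * pK P * P.l) * |ε|) ∧ HS (sc (dm P ε)) := fun ε o =>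
  ⟨sc_cont (Complex.continuous_ofReal.comp ((PP_cont P _).sub ((continuous_const.add (continuous_pow 2)).inv₀ fun k => (by positivity : (4 + k ^ 2 : ℝ) ≠ 0)))),
   fun k => (sc_norm k).trans (by
    rw [dm, Complex.norm_real, Real.norm_eq_abs]
    exact (PP_diff P (dnn P.hl ε) (dle P o) k).trans (le_of_eq (by ring))), HS.sc fun k => by simp [dm, PP, DD_neg]⟩
section
variable (D : Dt)
lemma G.EEo {V : Type} [NormedAddCommGroup V] [NormedSpace ℂ V] [HV V] {b z1 z2 : ℝ → V → A} (hb : G 0 b) (h1 : G 1 z1) (h2 : G 1 z2) :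
    G 1 fun ε u => Bore.EEo D ε (b ε u) (z1 ε u) (z2 ε u) :=
  G.Eop D ((hb.lin (Ul.bt D.P)).lin (Ul.inc D.P.hl)) ((G.gP D.P hb).lin (Ul.inc D.P.hl))
    ((G.nn D.P le_rfl hb h1 D.P.ha 1 D.c).lin (Ul.csA theta_trE')) ((G.nn D.P le_rfl hb h2 D.P.hb (-1) D.c).lin (Ul.csA theta_trE'))
    ((G.nh D.P le_rfl hb h1 D.P.ha 1 D.c).lin (Ul.csA theta_trE')) ((G.nh D.P le_rfl hb h2 D.P.hb (-1) D.c).lin (Ul.csA theta_trE'))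
lemma G.zl {V : Type} [NormedAddCommGroup V] [NormedSpace ℂ V] [HV V] {f : ℝ → V → L} (hf : G 1 f) : G 1 fun ε u => ((0, f ε u) : A) :=
  G.pair (G.const (C := 0) fun ε _ => ⟨HV.zero, by simp⟩) hf
lemma G.Th : G 1 (Th D) := by
  have hb : G 0 fun (_ : ℝ) (u : A × A × A) => u.1 := G.of_ul Ul.fst
  have hz : G 0 fun (_ : ℝ) (u : A × A × A) => u.2 := G.of_ul Ul.snd
  have h1 : G 1 fun ε (u : A × A × A) => y1n D ε u.1 u.2.1 := G.yy D.P zero_le_one hb hz.fst D.P.ha 1 D.c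
  have h2 : G 1 fun ε (u : A × A × A) => y2n D ε u.1 u.2.2 := G.yy D.P zero_le_one hb hz.snd D.P.hb (-1) D.c
  have he := G.EEo D hb h1 h2
  have hB : G 1 fun ε (u : A × A × A) => b2n (Bore.EEo D ε u.1 (y1n D ε u.1 u.2.1) (y2n D ε u.1 u.2.2)) :=
    (he.snd.lin (Ul.op (Fam.cs theta_trE'))).c (-1) (by simp)
  have t1 : G 1 fun ε (u : A × A × A) => (6 : ℂ) • cv W0 (Sr W0) (op (sc (dm D.P ε)) (op (cs trE) u.1.1)) :=
    (((hb.fst.lin (Ul.op (Fam.cs theta_trE'))).slin (Us.op (dm_us D.P))).lin (Ul.S WF0)).c 6 (by simp)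
  have t2 : G 1 fun ε (u : A × A × A) => (6 : ℂ) • SL W0 (Bore.scA (iph (D.P.l * |ε|)) (bt D.P (D.P.l * |ε|) (0, b2n (Bore.EEo D ε u.1 (y1n D ε u.1 u.2.1) (y2n D ε u.1 u.2.2))))) :=
    (((hB.zl.lin (Ul.bt D.P)).lin (Ul.inc D.P.hl)).lin (Ul.SL WF0)).c 6 (by simp)
  exact ((((t1.add t2).sub he.fst).lin Ul.Bz).pair hB).pair (h1.pair h2)
def Er (D : Dt) (ε F S β γ n1 n2 h1 h2 : ℝ) : ℝ :=
  let g := (1 - F) / 2 + ε * β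
  let g1 := -S / 4 - ε * (F * β) + ε ^ 2 * β ^ 2
  let H1 := D.P.a + ε * g
  let H2 := D.P.b - ε * g
  let z := H1 ^ 2 * H2 ^ 2 * γ ^ 2
  8 * ε ^ 2 * β ^ 3 - 12 * ε * F * β ^ 2 + (-2 / (D.P.a * D.P.b)) * (g * (3 * D.c ^ 2 * g * g1 - D.c ^ 2 * g1 + 2 * ε * g ^ 2 * g1))
  + 2 * D.P.l ^ 2 * D.c / D.κ * (D.ρ * (2 * D.P.a * D.P.b * g * n2 + D.P.b * ε * g ^ 2 * n2 - H1 ^ 2 * n2)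
    - (H2 ^ 2 * n1 - 2 * D.P.a * D.P.b * g * n1 + D.P.a * ε * g ^ 2 * n1) + D.ρ * D.P.b * D.P.a ^ 2 * h2 - D.P.a * D.P.b ^ 2 * h1)
  + D.P.l ^ 4 / D.κ * ε ^ 2 * (D.ρ * H1 ^ 2 * n2 ^ 2 - H2 ^ 2 * n1 ^ 2)
  + D.P.l ^ 2 * (D.ρ - 1) / D.κ * (2 * ε * (g * z - z) - D.c ^ 2 * z)
lemma EV_Eop {ε X bb γ n1_ n2_ h1_ h2_ : ℝ} {β g n1 n2 h1 h2 : A} (hβ : EV W0 β X = (bb : ℂ) • 1) (hg : EV W0 g X = (γ : ℂ) • 1)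
    (k1 : EV W0 n1 X = (n1_ : ℂ) • 1) (k2 : EV W0 n2 X = (n2_ : ℂ) • 1) (l1 : EV W0 h1 X = (h1_ : ℂ) • 1) (l2 : EV W0 h2 X = (h2_ : ℂ) • 1) :
    EV W0 (Eop D ε β g n1 n2 h1 h2) X = ev W0 (G0 D.P ε) X + ((Er D ε (tanh X) (Sf X) bb γ n1_ n2_ h1_ h2_ : ℝ) : ℂ) • 1 := by
  have sm : ∀ r s : ℂ, (r • (1 : E)) * (s • (1 : E)) = (r * s) • 1 := fun r s => by rw [smul_mul_smul_comm, one_mul]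
  have hG : ∀ u, EV W0 (Gm W0 ε β u) X = (((1 - tanh X) / 2 + ε * bb : ℝ) : ℂ) • EV W0 u X := fun u => by
    simp only [Gm, EV_add Wt0, EV_sub Wt0, EV_smul, EV_FA Wt0, EV_mulA Wt0, hβ, smul_mul_assoc, one_mul]
    push_cast [-Complex.ofReal_tanh]; module
  have hg1 : EV W0 (g1m ε β) X = ((-Sf X / 4 - ε * (tanh X * bb) + ε ^ 2 * bb ^ 2 : ℝ) : ℂ) • 1 := by
    simp only [g1m, EV_add Wt0, EV_sub Wt0, EV_smul, EV_FA Wt0, EV_mulA Wt0, hβ, EV_inl, ev_smul, ev_Sr Wt0, sm]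
    push_cast [-Complex.ofReal_tanh]; module
  rw [Er]
  simp only [Eop, Eq1, EA2, EA1, Ez, H1m, H2m, EV_add Wt0, EV_sub Wt0, EV_smul, EV_FA Wt0, EV_mulA Wt0, EV_inl, hG, hg1, hβ, hg, k1, k2, l1, l2, sm]
  rw [sub_eq_add_neg, add_assoc, add_assoc, add_assoc, add_assoc, add_assoc]; congr 1
  generalize tanh X = F
  generalize Sf X = S
  push_cast; module
end
end
section
open MeasureTheory
open HV
section
variable (P : Pr) {ε : ℝ} (o : Ok ε)
include o
lemma bt_split b X : EV (W1 (P.l * |ε|)) (bt P (P.l * |ε|) b) X =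
    trE (ev W0 (p0 b.1) X + ev W0 (op (sc (dm P ε)) (op (cs trE) b.1)) X) + EV (W1 (P.l * |ε|)) (bt P (P.l * |ε|) (0, b.2)) X := by
  have hδ := dnn P.hl ε
  have hw := WF1 P.hl ε o
  have e1 : bt P (P.l * |ε|) b = (op (sc (pq P (P.l * |ε|))) (op (cs trE) b.1), 0) + bt P (P.l * |ε|) (0, b.2) := by
    refine Prod.ext ?_ ?_
    · have : f0 P (P.l * |ε|) b = b.1 + f0 P (P.l * |ε|) (0, b.2) := by simp [f0, C1, Cr, bt1, bt1', sub_eq_add_neg]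
      simp only [bt, this, map_add]; rfl
    · simp [bt, bt1]
  have hd : BCs (sc (dm P ε)) := ⟨(dm_us P ε o).1, _, (dm_us P ε o).2.1⟩
  have hn : BCs (sc fun k => wi W0 k * m0 k) := (NmW m0_cont m0_norm).BCs
  have hn2 : BCs (sc fun k => wi W0 k * dm P ε k) := by
    refine BCs.sc (C := 1 * ((768 * pK P * P.l) * |ε|)) ((wi_cont Wt0).mul (Complex.continuous_ofReal.comp ((PP_cont P _).sub ((continuous_const.add (continuous_pow 2)).inv₀ fun k => (by positivity : (4 + k ^ 2 : ℝ) ≠ 0))))) fun k => ?_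
    rw [norm_mul]
    refine mul_le_mul (wi_norm Wt0 k |>.trans ?_) ?_ (norm_nonneg _) zero_le_one
    · exact inv_le_one_of_one_le₀ (one_le_pow₀ (by linarith [abs_nonneg k]))
    · rw [dm, Complex.norm_real, Real.norm_eq_abs]
      exact (PP_diff P (dnn P.hl ε) (dle P o) k).trans (le_of_eq (by ring))
  rw [e1, EV_add hw, EV_inl]; congr 1
  have e2 : ev W0 (p0 b.1) X = evs (sc fun k => wi W0 k * m0 k) b.1 X := by rw [ev, p0, evs_op_sc BC0]
  rw [ev_pq P hδ (dle P o), map_add, e2, ev, evs_op_sc hd, evs_op_cs hn2, trtr, ← evs_op_cs hn2, ← evs_op_cs hn, ← evs_add_sym hn hn2]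
  congr 1; funext k; ext1 v; simp only [sc_apply, add_apply, ← add_smul, m0, dm]; congr 1; push_cast; ring
end
section
variable (D : Dt) {ε : ℝ} (o : Ok ε)
def nR (P : Pr) (a σ c ε : ℝ) (b y : A) (X : ℝ) : ℝ := (trE (EV W0 (nn P a σ c ε b y) X) p1).re
def hR (P : Pr) (a σ c ε : ℝ) (b y : A) (X : ℝ) : ℝ := (trE (EV W0 (nh P a σ c ε b y) X) p1).re
def cc (D : Dt) (ε : ℝ) (b y1 y2 : A) : ℝ := (trE (EV W0 (Rop (fo ε b (EEo D ε b y1 y2) D.P, 0)) 0) p1).re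
section
variable (P : Pr) {b y : A} (hb : Hm b) (hy : Hm y) {a : ℝ} (ha : 0 < a) (σ c : ℝ) (X : ℝ)
include o hb hy ha
lemma nnHm : Hm (nn P a σ c ε b y) :=
  (G.nn (V := A × A) P (j := 0) zero_le_one (G.of_ul Ul.fst) (G.of_ul Ul.snd) ha σ c).1 ε o (b, y) ⟨hb, hy⟩
lemma nhHm : Hm (nh P a σ c ε b y) :=
  (G.nh (V := A × A) P (j := 0) zero_le_one (G.of_ul Ul.fst) (G.of_ul Ul.snd) ha σ c).1 ε o (b, y) ⟨hb, hy⟩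
lemma tr_nn : trE (EV W0 (nn P a σ c ε b y) X) = ((nR P a σ c ε b y X : ℝ) : ℂ) • 1 :=
  cR (trtr _) (by rw [theta_trE', EV_theta Wt0 (nnHm o P hb hy ha σ c)])
lemma tr_nh : trE (EV W0 (nh P a σ c ε b y) X) = ((hR P a σ c ε b y X : ℝ) : ℂ) • 1 :=
  cR (trtr _) (by rw [theta_trE', EV_theta Wt0 (nhHm o P hb hy ha σ c)])
lemma nR_eq : nR P a σ c ε b y X = -a ^ 2 * σ * c * (trE (EV W0 (TA a (P.l * |ε|) (csA mI (gP P ε b))) X) p1).re + ε * hR P a σ c ε b y X := by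
  have : TA a (P.l * |ε|) (Lw0 P a σ c ε b) = ((-a ^ 2 * σ * c : ℝ) : ℂ) • TA a (P.l * |ε|) (csA mI (gP P ε b)) := by
    have h := (Ul.TA P.hl ha).lin o 0 (csA mI (gP P ε b)) (-a ^ 2 * σ * c)
    have h0 := (Ul.TA P.hl ha).lin o 0 0 0
    simp only [Complex.ofReal_zero, zero_smul, add_zero] at h0
    rw [zero_add] at h; rw [Lw0, h]
    have h2 := (Ul.TA P.hl ha).lin o 0 0 (-1)
    have : TA a (P.l * |ε|) (0 : A) = 0 := by
      simp only [smul_zero, add_zero] at h2; push_cast at h2; rw [neg_one_smul, add_neg_cancel] at h2; exact h2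
    rw [this, zero_add]
  rw [nR, nn, this, EV_add Wt0, EV_smul, EV_smul, map_add, map_smul, map_smul, hR]
  simp only [E.add_apply, E.smul_apply, Complex.add_re, Complex.re_ofReal_mul]
end
variable {b y1 y2 : A} (hb : Hm b) (hy1 : Hm y1) (hy2 : Hm y2) (f1 : y1 = y1n D ε b y1) (f2 : y2 = y2n D ε b y2)
  (fb : b = (Bz (fo ε b (EEo D ε b y1 y2) D.P), b2n (EEo D ε b y1 y2)))
include o fb
lemma fix1 X : trE (EV W0 b X) - (6 * ((Sf X : ℝ) : ℂ)) • EV (W1 (D.P.l * |ε|)) (bt D.P (D.P.l * |ε|) b) X + trE (EV W0 (EEo D ε b y1 y2) X)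
    = ((Sf X : ℝ) : ℂ) • trE (EV W0 (Rop (fo ε b (EEo D ε b y1 y2) D.P, 0)) 0) := by
  set e := EEo D ε b y1 y2
  have h1 : b.1 = Bz (fo ε b e D.P) := congrArg Prod.fst fb
  have h2 : b.2 = b2n e := congrArg Prod.snd fb
  have hB := Bz_eq (fo ε b e D.P) X
  rw [← h1] at hB
  have h3 : trE (ev W0 b.1 X) = ev W0 b.1 X := by rw [h1, Bz, ev_cs Wt0, trtr]
  have h5 : trE (ev W0 (p0 b.1) X) = ev W0 (p0 b.1) X := by
    rw [h1, Bz_v, map_neg, trtr]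
  have h4 : trE (ev W0 b.2 X) = -trE (ev W0 e.2 X) := by rw [h2, b2n, ev_smul, ev_cs Wt0, map_smul, trtr, neg_one_smul]
  have h6 : trE (ev W0 (fo ε b e D.P) X) = (6 * ((Sf X : ℝ) : ℂ)) • trE (ev W0 (op (sc (dm D.P ε)) (op (cs trE) b.1)) X)
      + (6 * ((Sf X : ℝ) : ℂ)) • EV (W1 (D.P.l * |ε|)) (bt D.P (D.P.l * |ε|) (0, b.2)) X - trE (ev W0 e.1 X) := by
    rw [fo, ← h2]
    simp only [ev_sub Wt0, ev_add Wt0, ev_smul, ev_SL Wt0, ev_cv Wt0, ev_Sr Wt0, EV_inc (dnn D.P.hl ε), map_sub, map_add, map_smul, bt_tr D.P o, smul_mul_assoc, one_mul]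
    module
  have hE : ∀ u : A, trE (EV W0 u X) = trE (ev W0 u.1 X) + ((tanh X : ℝ) : ℂ) • trE (ev W0 u.2 X) := fun u => by rw [EV, map_add, map_smul]
  rw [bt_split D.P o b X, hE, hE, map_add, h3, h4, h5]
  linear_combination (norm := module) hB + h6
include hb hy1 hy2
lemma fix2 X : tanh X * Sf X + (D.P.p * (trE (EV W0 (TA D.P.a (D.P.l * |ε|) (csA mI (gP D.P ε b))) X) p1).re
     + D.P.q * (trE (EV W0 (TA D.P.b (D.P.l * |ε|) (csA mI (gP D.P ε b))) X) p1).re)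
    + ε * ((4 - 6 * Sf X) * bR D.P ε b X + Er D ε (tanh X) (Sf X) (bR D.P ε b X) (gR D.P ε b X) (nR D.P D.P.a 1 D.c ε b y1 X)
      (nR D.P D.P.b (-1) D.c ε b y2 X) (hR D.P D.P.a 1 D.c ε b y1 X) (hR D.P D.P.b (-1) D.c ε b y2 X)) = ε * Sf X * cc D ε b y1 y2 := by
  have hδ := dnn D.P.hl ε
  have e1 := EV_Eop D (ε := ε) (X := X) (by rw [EV_inc hδ]; exact EVb D.P o hb X) (by rw [EV_inc hδ]; exact EVg D.P o hb X)
    (by rw [EV_csA Wt0]; exact tr_nn o D.P hb hy1 D.P.ha 1 D.c X) (by rw [EV_csA Wt0]; exact tr_nn o D.P hb hy2 D.P.hb (-1) D.c X)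
    (by rw [EV_csA Wt0]; exact tr_nh o D.P hb hy1 D.P.ha 1 D.c X) (by rw [EV_csA Wt0]; exact tr_nh o D.P hb hy2 D.P.hb (-1) D.c X)
  have h := fix1 D o fb X
  rw [EEo, e1, ← EEo] at h
  have hg := ev_G0 D.P o X
  have hbt := bt_eq D.P hδ (dle D.P o) b X
  have hd : EV W0 (DT D.P (D.P.l * |ε|) (gP D.P ε b)) X = EV W0 (DT D.P (D.P.l * |ε|) ((-1 / 2 : ℂ) • Sr (W1 (D.P.l * |ε|)), 0)) X
      + (ε : ℂ) • EV W0 (DT D.P (D.P.l * |ε|) (bt' D.P (D.P.l * |ε|) b)) X := by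
    rw [← EV_smul, ← EV_add Wt0]; congr 1
    exact ((((Ul.TA D.P.hl D.P.ha).comp (Ul.csA theta_mI)).csmul D.P.p).add
      (((Ul.TA D.P.hl D.P.hb).comp (Ul.csA theta_mI)).csmul D.P.q)).lin o _ _ ε
  have hd2 := congrArg trE hd
  rw [DT, EV_add Wt0, EV_smul, EV_smul] at hd2
  simp only [map_add, map_smul, trE_one] at h hd2
  have hg2 := congrArg trE hg
  simp only [map_add, map_smul, trE_one, trtr] at hg2
  rw [← hbt, EVb D.P o hb] at h
  have k1 := congrArg (fun v : E => (v p1).re) h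
  have k2 := congrArg (fun v : E => (v p1).re) hg2
  have k3 := congrArg (fun v : E => (v p1).re) hd2
  have c4 : (4 : ℂ) = ((4 : ℝ) : ℂ) := by simp
  have c6 : (6 : ℂ) = ((6 : ℝ) : ℂ) := by simp
  rw [c4, c6] at k1
  simp only [E.add_apply, E.sub_apply, E.smul_apply, E.one_apply, mul_one, Complex.add_re, Complex.sub_re, Complex.re_ofReal_mul, Complex.ofReal_re, ← Complex.ofReal_mul] at k1 k2 k3
  rw [cc]
  linear_combination ε * k1 - k2 + k3
end
end
section
open MeasureTheory
open HV
lemma PH_id (D : Dt) (ε F β : ℝ) : D.ρ * (D.c * (D.P.b - ε)) ^ 2 * (D.P.a + ε * ((1 - F) / 2 + ε * β)) ^ 2 - (D.c * (D.P.a + ε)) ^ 2 * (D.P.b - ε * ((1 - F) / 2 + ε * β)) ^ 2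
    + (D.ρ - 1) * (2 * ε * ((1 - F) / 2 + ε * β - 1) - D.c ^ 2) * (D.P.a + ε * ((1 - F) / 2 + ε * β)) ^ 2 * (D.P.b - ε * ((1 - F) / 2 + ε * β)) ^ 2
    = ε ^ 3 * (D.κ * (F * (1 - F ^ 2) + ε * (4 - 6 * (1 - F ^ 2)) * β - 12 * ε ^ 2 * F * β ^ 2 + 8 * ε ^ 3 * β ^ 3)
      + ε * (D.ρ - 1) * (((1 - F) / 2 + ε * β) * (3 * D.c ^ 2 * ((1 - F) / 2 + ε * β) * (-(1 - F ^ 2) / 4 - ε * (F * β) + ε ^ 2 * β ^ 2) - D.c ^ 2 * (-(1 - F ^ 2) / 4 - ε * (F * β) + ε ^ 2 * β ^ 2)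
        + 2 * ε * ((1 - F) / 2 + ε * β) ^ 2 * (-(1 - F ^ 2) / 4 - ε * (F * β) + ε ^ 2 * β ^ 2)))) := by
  have ha := D.P.ha
  have hb : D.P.b = 1 - D.P.a := by linarith [D.hs]
  have hρ : D.ρ = (1 - D.P.a) ^ 2 / D.P.a ^ 2 := by rw [eq_div_iff (by positivity), ← hb]; exact D.hr
  have hκ : D.κ = D.P.a * D.P.b * (1 - D.ρ) / 2 := by linarith [D.hκ2]
  have hc : D.c ^ 2 = 2 * D.P.a - 1 := by rw [D.hc2, hb]; ring
  simp only [mul_pow, hc, hκ, hρ, hb]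
  set G := (1 - F) / 2 + ε * β with hG
  have hF : F = 1 + 2 * ε * β - 2 * G := by rw [hG]; ring
  clear_value G
  subst hF
  field_simp
  ring
lemma Er_k D ε F S β γ n1 n2 h1 h2 : D.κ * Er D ε F S β γ n1 n2 h1 h2 =
  let g := (1 - F) / 2 + ε * β
  let g1 := -S / 4 - ε * (F * β) + ε ^ 2 * β ^ 2
  let H1 := D.P.a + ε * g
  let H2 := D.P.b - ε * g
  let z := H1 ^ 2 * H2 ^ 2 * γ ^ 2
  D.κ * (8 * ε ^ 2 * β ^ 3 - 12 * ε * F * β ^ 2) + (D.ρ - 1) * (g * (3 * D.c ^ 2 * g * g1 - D.c ^ 2 * g1 + 2 * ε * g ^ 2 * g1))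
  + 2 * D.P.l ^ 2 * D.c * (D.ρ * (2 * D.P.a * D.P.b * g * n2 + D.P.b * ε * g ^ 2 * n2 - H1 ^ 2 * n2)
    - (H2 ^ 2 * n1 - 2 * D.P.a * D.P.b * g * n1 + D.P.a * ε * g ^ 2 * n1) + D.ρ * D.P.b * D.P.a ^ 2 * h2 - D.P.a * D.P.b ^ 2 * h1)
  + D.P.l ^ 4 * ε ^ 2 * (D.ρ * H1 ^ 2 * n2 ^ 2 - H2 ^ 2 * n1 ^ 2)
  + D.P.l ^ 2 * (D.ρ - 1) * (2 * ε * (g * z - z) - D.c ^ 2 * z) := by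
  have ha := D.P.ha
  have hb := D.P.hb
  have hk := D.hκ
  have e : -2 / (D.P.a * D.P.b) = (D.ρ - 1) / D.κ := by
    rw [div_eq_div_iff (by positivity) hk.ne']; linear_combination (-1 : ℝ) * D.hκ2
  simp only [Er]
  rw [e]
  have k1 : ∀ x y : ℝ, D.κ * (x / D.κ * y) = x * y := fun x y => by field_simp
  have k2 : ∀ x y : ℝ, D.κ * (x / D.κ * ε ^ 2 * y) = x * ε ^ 2 * y := fun x y => by field_simp
  simp only [mul_add D.κ (_ + _), k1, k2]
  simp only [mul_add D.κ, k1]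
section
variable (D : Dt) {ε : ℝ} (o : Ok ε)
variable {b y1 y2 : A} (hb : Hm b) (hy1 : Hm y1) (hy2 : Hm y2)
  (fb : b = (Bz (fo ε b (EEo D ε b y1 y2) D.P), b2n (EEo D ε b y1 y2)))
include o fb hb hy1 hy2
lemma fix3 (X : ℝ) : D.ρ * (D.c * (D.P.b - ε) + D.P.l ^ 2 * ε ^ 3 * nR D.P D.P.b (-1) D.c ε b y2 X) ^ 2 * (D.P.a + ε * GR D.P ε b X) ^ 2
    - (D.c * (D.P.a + ε) + D.P.l ^ 2 * ε ^ 3 * nR D.P D.P.a 1 D.c ε b y1 X) ^ 2 * (D.P.b - ε * GR D.P ε b X) ^ 2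
    + (D.ρ - 1) * (2 * ε * (GR D.P ε b X - 1) - D.c ^ 2) * (D.P.a + ε * GR D.P ε b X) ^ 2 * (D.P.b - ε * GR D.P ε b X) ^ 2 * (1 + ε ^ 4 * D.P.l ^ 2 * gR D.P ε b X ^ 2)
    = D.κ * ε ^ 4 * Sf X * cc D ε b y1 y2 := by
  have h := fix2 D o hb hy1 hy2 fb X
  have e1 := nR_eq o D.P hb hy1 D.P.ha 1 D.c X
  have e2 := nR_eq o D.P hb hy2 D.P.hb (-1) D.c X
  have hE := Er_k D ε (tanh X) (Sf X) (bR D.P ε b X) (gR D.P ε b X) (nR D.P D.P.a 1 D.c ε b y1 X)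
      (nR D.P D.P.b (-1) D.c ε b y2 X) (hR D.P D.P.a 1 D.c ε b y1 X) (hR D.P D.P.b (-1) D.c ε b y2 X)
  have hP := PH_id D ε (tanh X) (bR D.P ε b X)
  have hS : Sf X = 1 - tanh X ^ 2 := by rw [Sf]
  simp only [GR]
  generalize trE (EV W0 (TA D.P.a (D.P.l * |ε|) (csA mI (gP D.P ε b))) X) p1 = t1 at *
  generalize trE (EV W0 (TA D.P.b (D.P.l * |ε|) (csA mI (gP D.P ε b))) X) p1 = t2 at *
  generalize nR D.P D.P.a 1 D.c ε b y1 X = n1 at *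
  generalize nR D.P D.P.b (-1) D.c ε b y2 X = n2 at *
  generalize hR D.P D.P.a 1 D.c ε b y1 X = h1 at *
  generalize hR D.P D.P.b (-1) D.c ε b y2 X = h2 at *
  generalize bR D.P ε b X = β at *
  generalize gR D.P ε b X = γ at *
  generalize cc D ε b y1 y2 = K at *
  simp only [hS] at *
  generalize tanh X = F at *
  generalize Er D ε F (1 - F ^ 2) β γ n1 n2 h1 h2 = R at *
  set G := (1 - F) / 2 + ε * β with hG
  have hp := D.hp
  have hq := D.hq
  have e1' : D.P.a * D.P.b ^ 2 * n1 = D.P.a * D.P.b ^ 2 * (-D.P.a ^ 2 * D.c * t1.re + ε * h1) := by rw [e1]; ring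
  have e2' : D.ρ * D.P.b * D.P.a ^ 2 * n2 = D.ρ * D.P.b * D.P.a ^ 2 * (D.P.b ^ 2 * D.c * t2.re + ε * h2) := by rw [e2]; ring
  clear_value G
  linear_combination hP + D.κ * ε ^ 3 * h - ε ^ 4 * hE + 2 * D.P.l ^ 2 * ε ^ 3 * D.c * (e2' - e1') - ε ^ 3 * (hp * t1.re + hq * t2.re)
end
end
section
open MeasureTheory
open HV
lemma hfd2 {f fx fy : ℝ × ℝ → ℂ} (hx : ∀ p : ℝ × ℝ, HasDerivAt (fun t => f (t, p.2)) (fx p) p.1)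
    (hy : ∀ p : ℝ × ℝ, HasDerivAt (fun t => f (p.1, t)) (fy p) p.2) (cx : Continuous fx)
    (cy : Continuous fy) (p : ℝ × ℝ) : HasFDerivAt f
    ((ContinuousLinearMap.fst ℝ ℝ ℝ).smulRight (fx p) + (ContinuousLinearMap.snd ℝ ℝ ℝ).smulRight (fy p)) p := by
  have h := hasStrictFDerivAt_uncurry_coprod (𝕜 := ℝ) (u := p) (f := fun a b => f (a, b))
    (f₁ := fun a b => (1 : ℝ →L[ℝ] ℝ).smulRight (fx (a, b)))
    (f₂ := fun a b => (1 : ℝ →L[ℝ] ℝ).smulRight (fy (a, b)))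
    (Eventually.of_forall fun v => (hx v).hasFDerivAt.congr_fderiv (by ext; simp [Function.HasUncurry.uncurry]))
    (Eventually.of_forall fun v => (hy v).hasFDerivAt.congr_fderiv (by ext; simp [Function.HasUncurry.uncurry]))
    (Continuous.continuousAt (by simp only [Function.HasUncurry.uncurry, id]; fun_prop)) (Continuous.continuousAt (by simp only [Function.HasUncurry.uncurry, id]; fun_prop))
  refine (h.hasFDerivAt.congr_fderiv ?_)
  ext <;> simp [Function.HasUncurry.uncurry]
lemma cdn {f fx fy : ℝ × ℝ → ℂ} (n : ℕ) (hx : ∀ p : ℝ × ℝ, HasDerivAt (fun t => f (t, p.2)) (fx p) p.1)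
    (hy : ∀ p : ℝ × ℝ, HasDerivAt (fun t => f (p.1, t)) (fy p) p.2) (cx : ContDiff ℝ n fx)
    (cy : ContDiff ℝ n fy) : ContDiff ℝ (n + 1) f :=
  contDiff_succ_iff_hasFDerivAt.2 ⟨_, by fun_prop, hfd2 hx hy cx.continuous cy.continuous⟩
def JL (s : ℝ) : E →L[ℂ] ℂ := LinearMap.mkContinuous
  { toFun := fun e => ∫ t in (0 : ℝ)..s, ext e t
    map_add' := fun e f => intervalIntegral.integral_add (ext_ii e _ _) (ext_ii f _ _)
    map_smul' := fun c e => intervalIntegral.integral_const_mul _ _ } |s| (fun e => by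
      have := intervalIntegral.norm_integral_le_of_norm_le_const (a := 0) (b := s) (f := ext e)
        (C := ‖e‖) (fun t _ => ext_norm e t)
      rwa [sub_zero, mul_comm] at this)
lemma JL_apply s e : JL s e = ∫ t in (0 : ℝ)..s, ext e t := rfl
lemma JL_hd e s : HasDerivAt (fun s => JL s e) (ext e s) s :=
  (ext_cont e).integral_hasStrictDerivAt 0 s |>.hasDerivAt
lemma JL_bd e s : ‖JL s e‖ ≤ |s| * ‖e‖ :=
  LinearMap.mkContinuous_norm_le _ (abs_nonneg s) _ |> (JL s).le_of_opNorm_le <| e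
lemma JL_cont e : Continuous (fun s => JL s e) :=
  continuous_iff_continuousAt.2 fun s => (JL_hd e s).continuousAt
def JM (s : ℝ) : E →L[ℂ] ℂ := LinearMap.mkContinuous
  { toFun := fun e => ∫ t in (0 : ℝ)..s, JL t e
    map_add' := fun e f => by
      simp only [map_add]
      exact intervalIntegral.integral_add ((JL_cont e).intervalIntegrable _ _) ((JL_cont f).intervalIntegrable _ _)
    map_smul' := fun c e => by
      simp only [map_smul]; exact intervalIntegral.integral_const_mul _ _ } (|s| * |s|) (fun e => by
      have := intervalIntegral.norm_integral_le_of_norm_le_const (a := 0) (b := s) (f := fun t => JL t e)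
        (C := |s| * ‖e‖) (fun t ht => (JL_bd e t).trans (mul_le_mul_of_nonneg_right (by
          rcases le_total 0 s with h | h
          · rw [uIoc_of_le h] at ht; rw [abs_of_pos ht.1, abs_of_nonneg h]; exact ht.2
          · rw [uIoc_of_ge h] at ht; rw [abs_of_nonpos ht.2, abs_of_nonpos h]; linarith [ht.1]) (norm_nonneg _)))
      rw [sub_zero] at this
      exact this.trans (le_of_eq (by ring)))
lemma JM_apply s e : JM s e = ∫ t in (0 : ℝ)..s, JL t e := rfl
lemma JM_hd e s : HasDerivAt (fun s => JM s e) (JL s e) s :=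
  (JL_cont e).integral_hasStrictDerivAt 0 s |>.hasDerivAt
lemma ext_j {φ} (h : Continuous φ) : Continuous fun p : ℝ × ℝ => ext (φ p.1) p.2 := by
  have h1 : Continuous fun p : ℝ × ℝ => ((φ p.1 : C(II, ℂ)), projIcc (-1) 1 mone_le p.2) :=
    (h.comp continuous_fst).prodMk (continuous_projIcc.comp continuous_snd)
  exact (ContinuousEval.continuous_eval (F := C(II, ℂ))).comp h1
lemma JL_j {φ} (h : Continuous φ) : Continuous fun p : ℝ × ℝ => JL p.2 (φ p.1) := by
  have := intervalIntegral.continuous_parametric_intervalIntegral_of_continuous (μ := volume) (a₀ := 0)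
    (f := fun (p : ℝ × ℝ) t => ext (φ p.1) t) (s := fun p => p.2)
    ((ext_j h).comp (by fun_prop : Continuous fun q : (ℝ × ℝ) × ℝ => (q.1.1, q.2))) continuous_snd
  exact this
lemma JM_j {φ} (h : Continuous φ) : Continuous fun p : ℝ × ℝ => JM p.2 (φ p.1) := by
  have := intervalIntegral.continuous_parametric_intervalIntegral_of_continuous (μ := volume) (a₀ := 0)
    (f := fun (p : ℝ × ℝ) t => JL t (φ p.1)) (s := fun p => p.2)
    ((JL_j h).comp (by fun_prop : Continuous fun q : (ℝ × ℝ) × ℝ => (q.1.1, q.2))) continuous_snd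
  exact this
lemma clm_hd (T : E →L[ℂ] ℂ) {φ : ℝ → E} {φ' : E} {x : ℝ} (h : HasDerivAt φ φ' x) :
    HasDerivAt (fun t => T (φ t)) (T φ') x := (T.restrictScalars ℝ).hasFDerivAt.comp_hasDerivAt x h
lemma JL_c1 {φ φ' : ℝ → E} (h : ∀ x, HasDerivAt φ (φ' x) x) (c' : Continuous φ') :
    ContDiff ℝ 1 fun p : ℝ × ℝ => JL p.2 (φ p.1) := by
  have c : Continuous φ := continuous_iff_continuousAt.2 fun s => (h s).continuousAt
  simpa using cdn (f := fun p : ℝ × ℝ => JL p.2 (φ p.1)) 0 (fun p => clm_hd (JL p.2) (h p.1)) (fun p => JL_hd (φ p.1) p.2)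
    (contDiff_zero.2 (JL_j c')) (contDiff_zero.2 (ext_j c))
lemma JM_c1 {φ φ' : ℝ → E} (h : ∀ x, HasDerivAt φ (φ' x) x) (c' : Continuous φ') :
    ContDiff ℝ 1 fun p : ℝ × ℝ => JM p.2 (φ p.1) := by
  have c : Continuous φ := continuous_iff_continuousAt.2 fun s => (h s).continuousAt
  simpa using cdn (f := fun p : ℝ × ℝ => JM p.2 (φ p.1)) 0 (fun p => clm_hd (JM p.2) (h p.1)) (fun p => JM_hd (φ p.1) p.2)
    (contDiff_zero.2 (JM_j c')) (contDiff_zero.2 (JL_j c))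
lemma cd_hd {V : Type*} [NormedAddCommGroup V] [NormedSpace ℝ V] {φ : ℝ → V} {n} (h : ContDiff ℝ (n + 1) φ) :
    (∀ x, HasDerivAt φ (deriv φ x) x) ∧ ContDiff ℝ n (deriv φ) :=
  ⟨fun x => ((h.differentiable (by simp)) x).hasDerivAt, (contDiff_succ_iff_deriv.1 h).2.2⟩
lemma JM_c2 {φ : ℝ → E} (h : ContDiff ℝ 2 φ) :
    ContDiff ℝ 2 fun p : ℝ × ℝ => JM p.2 (φ p.1) := by
  obtain ⟨h1, h2⟩ := cd_hd (n := 1) (by simpa using! h)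
  obtain ⟨h3, h4⟩ := cd_hd (n := 0) (φ := deriv φ) (by simpa using! h2)
  exact cdn (f := fun p : ℝ × ℝ => JM p.2 (φ p.1)) 1 (fun p => clm_hd (JM p.2) (h1 p.1)) (fun p => JM_hd (φ p.1) p.2)
    (JM_c1 h3 (contDiff_zero.1 h4)) (JL_c1 h1 (contDiff_zero.1 (h2.of_le (by simp))))
end
section
open MeasureTheory
open HV
structure Lay where
  m : ℝ
  H : ℝ → ℝ
  p : ℝ → E
  N : ℝ → E
  R : ℝ → ℝ
  T : ℝ → ℝ
  cH : ContDiff ℝ 3 H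
  hd : ∀ x, HasDerivAt H (T x) x
  hH : ∀ x, 0 < H x
  cp : ContDiff ℝ 3 p
  th : ∀ x, theta (p x) = p x
  mean : ∀ x, meanE (p x) = (m : ℂ) • 1
  eq1 : ∀ x, (1 + (T x : ℂ) • isE) * p x = (m : ℂ) • 1 + N x
  eq2 : ∀ x, N x - c1 (N x) = Jop ((Complex.I * (H x : ℝ)) • deriv p x)
  tr : ∀ x, trE (N x) = ((R x - m : ℝ) : ℂ) • 1
namespace Lay
variable (L : Lay)
open Complex (I)
lemma Tc : ContDiff ℝ 2 L.T := by
  have := (cd_hd (n := 2) L.cH).2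
  rwa [show deriv L.H = L.T from funext fun x => (L.hd x).deriv] at this
lemma pd (x) : HasDerivAt L.p (deriv L.p x) x := (cd_hd (n := 2) L.cp).1 x
lemma nz (τ s : ℝ) : 1 + I * (τ * s : ℂ) ≠ 0 := fun h => by
  simpa using congrArg Complex.re h
lemma jp (x) : Jop (L.p x) p1 = 2 * L.m := by
  have h := congrArg (fun v : E => v p1) (L.mean x)
  simp at h; linear_combination 2 * h
lemma jp' (x) : Jop (deriv L.p x) p1 = 0 := by
  have h := clm_hd (evalE p1 ∘L Jop) (L.pd x)
  simp only [ContinuousLinearMap.comp_apply, evalE_apply, L.jp] at h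
  exact h.unique (hasDerivAt_const _ _)
lemma end1 (x) : (1 + I * L.T x) * L.p x p1 = L.R x ∧ (1 - I * L.T x) * L.p x pm1 = L.R x := by
  have h1 := congrArg (fun v : E => v p1) (L.eq1 x)
  have h2 := congrArg (fun v : E => v pm1) (L.eq1 x)
  have h3 := congrArg (fun v : E => v p1) (L.eq2 x)
  have h4 := congrArg (fun v : E => v p1) (L.tr x)
  rw [map_smul] at h3
  simp [L.jp'] at h1 h2 h3 h4
  simp [p1, pm1] at h1 h2 h3 h4 ⊢
  constructor
  · linear_combination h1 + h3 / 2 + h4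
  · linear_combination h2 - h3 / 2 + h4
lemma key (x s) (hs : s ∈ Icc (-1 : ℝ) 1) : (1 + I * (L.T x * s)) * ext (L.p x) s =
    ext (L.p x) 0 + I * L.H x * JL s (deriv L.p x) := by
  have h0 : (0 : ℝ) ∈ Icc (-1 : ℝ) 1 := by norm_num
  have a := congrArg (fun v : E => v ⟨s, hs⟩) (L.eq1 x)
  have b := congrArg (fun v : E => v ⟨0, h0⟩) (L.eq1 x)
  have c := congrArg (fun v : E => v ⟨s, hs⟩) (L.eq2 x)
  have d := congrArg (fun v : E => v ⟨0, h0⟩) (L.eq2 x)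
  have e := intervalIntegral.integral_interval_sub_left (ext_ii (deriv L.p x) (-1) s) (ext_ii (deriv L.p x) (-1) 0)
  rw [map_smul] at c d
  rw [ext_of_mem _ hs, ext_of_mem _ h0, JL_apply, ← e]
  simp [Jop_apply] at a b c d
  linear_combination a - b + c - d
def tI (x : ℝ) : E := 1 + (L.T x : ℂ) • isE
def nu (x : ℝ) : E := Ring.inverse (L.tI x) * (I • ((L.H x : ℂ) • deriv L.p x - (L.T x : ℂ) • L.p x))
lemma tIu (x) : IsUnit (L.tI x) := by
  refine IsUnit.of_mul_eq_one (mkE (fun s => (1 + I * ((L.T x : ℝ) * (s : ℝ) : ℂ))⁻¹) ?_) ?_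
  · exact Continuous.inv₀ (by fun_prop) fun s => nz _ _
  · ext s
    simp only [tI, E.mul_apply, E.add_apply, E.smul_apply, E.one_apply, isE_apply, mkE_apply]
    rw [show (L.T x : ℂ) * (I * ((s : ℝ) : ℂ)) = I * ((L.T x : ℂ) * (s : ℝ)) by ring]
    exact mul_inv_cancel₀ (nz _ _)
lemma nu_eq (x s) (hs : s ∈ Icc (-1 : ℝ) 1) : (1 + I * (L.T x * s)) * ext (L.nu x) s =
    I * (L.H x * ext (deriv L.p x) s - L.T x * ext (L.p x) s) := by
  have h : L.tI x * L.nu x = _ := Ring.mul_inverse_cancel_left _ _ (L.tIu x)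
  have := congrArg (fun v : E => ext v s) h
  simp only [ext_of_mem _ hs, tI, E.mul_apply, E.add_apply, E.smul_apply, E.one_apply, isE_apply, E.sub_apply] at this ⊢
  linear_combination this
lemma nu_c : ContDiff ℝ 2 L.nu := by
  have h1 : ContDiff ℝ 2 (fun x => (L.T x : ℂ)) := Complex.ofRealCLM.contDiff.comp L.Tc
  have h2 : ContDiff ℝ 2 (fun x => ((L.H x : ℝ) : ℂ)) := Complex.ofRealCLM.contDiff.comp (L.cH.of_le (by norm_num))
  have h3 := (cd_hd (n := 2) L.cp).2
  have h4 : ContDiff ℝ 2 L.p := L.cp.of_le (by norm_num)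
  have h5 : ContDiff ℝ 2 L.tI := contDiff_const.add (h1.smul contDiff_const)
  have h6 : ContDiff ℝ 2 fun x => Ring.inverse (L.tI x) := contDiff_iff_contDiffAt.2 fun x => by
    obtain ⟨u, hu⟩ := L.tIu x
    have := contDiffAt_ringInverse ℝ (n := 2) u
    rw [hu] at this
    exact this.comp x h5.contDiffAt
  exact h6.mul (ContDiff.const_smul (R := ℂ) I ((h2.smul h3).sub (h1.smul h4)))
def Pe (q : ℝ × ℝ) : ℂ := ext (L.p q.1) 0 + JL q.2 (L.nu q.1)
lemma Pe_eq (x s) (hs : s ∈ Icc (-1 : ℝ) 1) : L.Pe (x, s) = ext (L.p x) s := by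
  set F : ℝ → ℂ := fun s => (ext (L.p x) 0 + I * L.H x * JL s (deriv L.p x)) / (1 + I * (L.T x * s))
  have hF : ∀ s ∈ Icc (-1 : ℝ) 1, F s = ext (L.p x) s := fun s hs => by
    rw [div_eq_iff (nz _ _), ← L.key x s hs]; ring
  have hd : ∀ s ∈ Icc (-1 : ℝ) 1, HasDerivAt F (ext (L.nu x) s) s := fun s hs => by
    have h1 : HasDerivAt (fun s : ℝ => 1 + I * (L.T x * (s : ℂ))) (I * L.T x) s := by
      have := (((Complex.ofRealCLM.hasDerivAt (x := s)).const_mul (L.T x : ℂ)).const_mul I).const_add 1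
      simpa using! this
    refine ((((JL_hd (deriv L.p x) s).const_mul (I * L.H x)).const_add (ext (L.p x) 0)).div h1 (nz _ _)).congr_deriv ?_
    have h2 := nz (L.T x) s
    have h3 := L.nu_eq x s hs
    have h4 := hF s hs
    simp only [F] at h4
    rw [div_eq_iff h2] at h4
    rw [h4, div_eq_iff (pow_ne_zero 2 h2)]
    linear_combination (-1 - I * (L.T x * s)) * h3
  have hu : uIcc 0 s ⊆ Icc (-1 : ℝ) 1 := (convex_Icc _ _).ordConnected.uIcc_subset (by norm_num) hs
  have := intervalIntegral.integral_eq_sub_of_hasDerivAt (fun t ht => hd t (hu ht)) (ext_ii _ _ _)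
  rw [Pe, JL_apply, this, hF s hs, hF 0 (by norm_num)]; ring
def Ga (q : ℝ × ℝ) : ℂ := q.2 * ext (L.p q.1) 0 + JM q.2 (L.nu q.1)
lemma Ga_s (x s) : HasDerivAt (fun t => L.Ga (x, t)) (L.Pe (x, s)) s := by
  have := ((Complex.ofRealCLM.hasDerivAt (x := s)).mul_const (ext (L.p x) 0)).add (JM_hd (L.nu x) s)
  simpa [Pe] using! this
lemma Ga_eq (x s) (hs : s ∈ Icc (-1 : ℝ) 1) : L.Ga (x, s) = JL s (L.p x) := by
  have hu : uIcc 0 s ⊆ Icc (-1 : ℝ) 1 := (convex_Icc _ _).ordConnected.uIcc_subset (by norm_num) hs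
  have h : ∀ t ∈ uIcc 0 s, HasDerivAt (fun t => L.Ga (x, t)) (ext (L.p x) t) t := fun t ht => by
    rw [← L.Pe_eq x t (hu ht)]; exact L.Ga_s x t
  rw [JL_apply, intervalIntegral.integral_eq_sub_of_hasDerivAt h (ext_ii _ _ _)]
  simp [Ga, JM_apply]
lemma ev_c {φ : ℝ → E} {n : ℕ} (h : ContDiff ℝ n φ) (t) : ContDiff ℝ n fun x => ext (φ x) t :=
  ((evalE _).restrictScalars ℝ).contDiff.comp h
lemma Pe_c : ContDiff ℝ 1 L.Pe := by
  obtain ⟨h1, h2⟩ := cd_hd (n := 1) L.nu_c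
  exact ((ev_c (n := 1) (L.cp.of_le (by norm_num)) 0).comp contDiff_fst).add (JL_c1 h1 h2.continuous)
lemma Ga_c : ContDiff ℝ 2 L.Ga :=
  ((Complex.ofRealCLM.contDiff.comp contDiff_snd).mul
    ((ev_c (n := 2) (L.cp.of_le (by norm_num)) 0).comp contDiff_fst)).add (JM_c2 L.nu_c)
lemma Ga_x (x s) (hs : s ∈ Icc (-1 : ℝ) 1) : HasDerivAt (fun t => L.Ga (t, s)) (JL s (deriv L.p x)) x := by
  simp only [fun t => L.Ga_eq t s hs]; exact clm_hd _ (L.pd x)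
lemma Pe_x (x s) (hs : s ∈ Icc (-1 : ℝ) 1) : HasDerivAt (fun t => L.Pe (t, s)) (ext (deriv L.p x) s) x := by
  simp only [fun t => L.Pe_eq t s hs]; exact clm_hd (evalE _) (L.pd x)
lemma Pe_s (x s) : HasDerivAt (fun t => L.Pe (x, t)) (ext (L.nu x) s) s := (JL_hd (L.nu x) s).const_add (ext (L.p x) 0)
lemma path {f : ℝ × ℝ → ℂ} {g} {x g'} {a b} (hf : DifferentiableAt ℝ f (x, g x))
    (ha : HasDerivAt (fun t => f (t, g x)) a x) (hb : HasDerivAt (fun t => f (x, t)) b (g x))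
    (hg : HasDerivAt g g' x) : HasDerivAt (fun t => f (t, g t)) (a + g' * b) x := by
  have h := hf.hasFDerivAt
  have h1 := h.comp_hasDerivAt x ((hasDerivAt_id x).prodMk (hasDerivAt_const x (g x)))
  have h2 := h.comp_hasDerivAt (g x) ((hasDerivAt_const (g x) x).prodMk (hasDerivAt_id (g x)))
  have h3 := h.comp_hasDerivAt x ((hasDerivAt_id x).prodMk hg)
  refine h3.congr_deriv ?_
  rw [ha.unique h1, hb.unique h2, ← Complex.real_smul, ← map_smul, ← map_add]; simp
def psi (q : ℝ × ℝ) : ℝ := L.m - (L.Ga (q.1, q.2 / L.H q.1)).re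
lemma psi_c : ContDiff ℝ 2 L.psi := by
  have h1 : ContDiff ℝ 2 fun q : ℝ × ℝ => q.2 / L.H q.1 :=
    contDiff_snd.div ((L.cH.of_le (by norm_num)).comp contDiff_fst) fun q => (L.hH _).ne'
  exact contDiff_const.sub (Complex.reCLM.contDiff.comp (L.Ga_c.comp (contDiff_fst.prodMk h1)))
lemma psi0 (x) : L.psi (x, 0) = L.m := by simp [psi, Ga, JM_apply]
lemma p0 (x) : (ext (L.p x) 0).im = 0 := by
  have h0 : (0 : ℝ) ∈ Icc (-1 : ℝ) 1 := by norm_num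
  have := congrArg (fun v : E => (v ⟨0, h0⟩).im) (L.th x)
  simp [negII] at this
  rw [ext_of_mem _ h0]; linarith
lemma psiH (x) : L.psi (x, L.H x) = 0 := by
  have h1 : (1 : ℝ) ∈ Icc (-1 : ℝ) 1 := by norm_num
  have h0 : (0 : ℝ) ∈ Icc (-1 : ℝ) 1 := by norm_num
  simp only [psi, div_self (L.hH x).ne', L.Ga_eq x 1 h1]
  have h := Jop_theta (L.p x) ⟨0, h0⟩
  rw [L.th] at h
  have e := intervalIntegral.integral_interval_sub_left (ext_ii (L.p x) (-1) 1) (ext_ii (L.p x) (-1) 0)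
  have j := L.jp x
  simp [Jop_apply, negII, p1] at h j
  have h' := congrArg Complex.re h
  have j' := congrArg Complex.re j
  rw [JL_apply, ← e]
  simp at h' j' ⊢
  linarith
lemma sH {x Y} (h : 0 ≤ Y) (h' : Y ≤ L.H x) : Y / L.H x ∈ Icc (-1 : ℝ) 1 :=
  ⟨by have := div_nonneg h (L.hH x).le; linarith, (div_le_one (L.hH x)).2 h'⟩
lemma gd (x Y) : HasDerivAt (fun t => Y / L.H t) (-(Y / L.H x * L.T x / L.H x)) x := by
  refine ((L.hd x).inv (L.hH x).ne').const_mul Y |>.congr_deriv ?_ |>.congr_of_eventuallyEq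
    (Eventually.of_forall fun t => div_eq_mul_inv _ _)
  field_simp
lemma psix {x Y} (h : 0 ≤ Y) (h' : Y ≤ L.H x) :
    HasDerivAt (fun t => L.psi (t, Y)) (-(ext (L.p x) (Y / L.H x)).im / L.H x) x := by
  have hs := L.sH h h'
  have h1 := path (L.Ga_c.differentiable (by norm_num) _) (L.Ga_x x _ hs) (L.Ga_s x _) (L.gd x Y)
  have h2 := (Complex.reCLM.hasFDerivAt.comp_hasDerivAt x h1).const_sub L.m
  refine h2.congr_deriv ?_
  have hH : (L.H x : ℂ) ≠ 0 := by exact_mod_cast (L.hH x).ne'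
  have k : JL (Y / L.H x) (deriv L.p x) + ((-(Y / L.H x * L.T x / L.H x) : ℝ) : ℂ) * L.Pe (x, Y / L.H x) =
      -I * ((ext (L.p x) (Y / L.H x) - ext (L.p x) 0) / (L.H x : ℝ)) := by
    have := L.key x _ hs
    rw [L.Pe_eq _ _ hs, ← mul_div_assoc, eq_div_iff hH]
    generalize Y / L.H x = s at *
    push_cast
    field_simp
    linear_combination I * this + (L.H x * JL s (deriv L.p x) - L.T x * s * ext (L.p x) s) * Complex.I_sq
  rw [k]
  simp [L.p0]; ring
lemma psiy {x Y} (h : 0 ≤ Y) (h' : Y ≤ L.H x) :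
    HasDerivAt (fun t => L.psi (x, t)) (-(ext (L.p x) (Y / L.H x)).re / L.H x) Y := by
  have hs := L.sH h h'
  have h1 := (L.Ga_s x (Y / L.H x)).scomp Y ((hasDerivAt_id Y).div_const (L.H x))
  refine ((Complex.reCLM.hasFDerivAt.comp_hasDerivAt Y h1).const_sub L.m).congr_deriv ?_
  rw [L.Pe_eq _ _ hs]; simp; ring
lemma psixx {x Y} (h : 0 < Y) (h' : Y < L.H x) : ∃ A B,
    HasDerivAt (fun t => deriv (fun t => L.psi (t, Y)) t) A x ∧
    HasDerivAt (fun Y => deriv (fun t => L.psi (x, t)) Y) B Y ∧ A + B = 0 := by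
  have hs := L.sH h.le h'.le
  have h1 := path (L.Pe_c.differentiable (by norm_num) _) (L.Pe_x x _ hs) (L.Pe_s x _) (L.gd x Y)
  have h2 := ((Complex.imCLM.hasFDerivAt.comp_hasDerivAt x h1).neg.div (L.hd x) (L.hH x).ne').congr_of_eventuallyEq
    (f₁ := fun t => deriv (fun t => L.psi (t, Y)) t) (by
      filter_upwards [(L.cH.continuous.tendsto x).eventually (lt_mem_nhds h')] with t ht
      rw [(L.psix h.le (le_of_lt ht)).deriv, ← L.Pe_eq _ _ (L.sH h.le (le_of_lt ht))]; rfl)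
  have h3 := (L.Pe_s x (Y / L.H x)).scomp Y ((hasDerivAt_id Y).div_const (L.H x))
  have h4 := ((Complex.reCLM.hasFDerivAt.comp_hasDerivAt Y h3).neg.div_const (L.H x)).congr_of_eventuallyEq
    (f₁ := fun Y => deriv (fun t => L.psi (x, t)) Y) (by
      filter_upwards [Ioo_mem_nhds h h'] with t ht
      rw [(L.psiy ht.1.le ht.2.le).deriv, ← L.Pe_eq _ _ (L.sH ht.1.le ht.2.le)]; rfl)
  refine ⟨_, _, h2, h4, ?_⟩
  have hH := (L.hH x).ne'
  have e := L.nu_eq x _ hs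
  have e1 := congrArg Complex.im e
  have e2 := congrArg Complex.re e
  have e3 := L.Pe_eq x _ hs
  simp [e3] at e1 e2 ⊢
  generalize Y / L.H x = s at *
  field_simp
  linarith
def S (x : ℝ) : ℝ := (Jop (L.p x * L.p x) p1).re / (4 * L.H x)
lemma S_d (x) : HasDerivAt L.S (-(L.R x ^ 2 * L.T x) / (2 * L.H x ^ 2 * (1 + L.T x ^ 2))) x := by
  have h1 := clm_hd (evalE p1 ∘L Jop) ((L.pd x).mul (L.pd x))
  have h2 := (Complex.reCLM.hasFDerivAt.comp_hasDerivAt x h1).div ((L.hd x).const_mul 4) (by have := L.hH x; positivity)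
  refine h2.congr_deriv ?_
  have e1 : ∀ t : ℝ, HasDerivAt (fun s : ℝ => (1 + I * (L.T x * (s : ℂ))) * L.Pe (x, s) ^ 2)
      (I * L.T x * L.Pe (x, t) ^ 2 + (1 + I * (L.T x * (t : ℂ))) * (2 * L.Pe (x, t) * ext (L.nu x) t)) t := fun t => by
    have a := (((Complex.ofRealCLM.hasDerivAt (x := t)).const_mul (L.T x : ℂ)).const_mul I).const_add 1
    have b := (L.Pe_s x t).pow 2
    refine (a.mul b).congr_deriv ?_
    simp [Pe]
  have cP : Continuous fun t => L.Pe (x, t) := L.Pe_c.continuous.comp (by fun_prop)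
  have e2 := J_of_deriv (e := (2 * I * L.H x) • (L.p x * deriv L.p x) - (I * L.T x) • (L.p x * L.p x)) e1
    (fun s => by
      rw [L.Pe_eq x s s.2, ext_coe]
      have := L.nu_eq x s s.2
      simp only [ext_coe] at this
      simp
      linear_combination (-2 * L.p x s) * this) p1 (by fun_prop)
  rw [map_sub, map_smul, map_smul] at e2
  have q := L.Pe_eq x 1 (by norm_num)
  have q' := L.Pe_eq x (-1) (by norm_num)
  obtain ⟨r, r'⟩ := L.end1 x
  rw [show ext (L.p x) 1 = L.p x p1 from ext_coe _ p1] at q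
  rw [show ext (L.p x) (-1) = L.p x pm1 from ext_coe _ pm1] at q'
  simp only [p1, E.sub_apply, E.smul_apply] at e2 q r
  have e3 : 2 * L.H x * Jop (L.p x * deriv L.p x) p1 - L.T x * Jop (L.p x * L.p x) p1 =
    ((-2 * L.T x * L.R x ^ 2 / (1 + L.T x ^ 2) : ℝ) : ℂ) := by
    have n3 : (1 + (L.T x : ℂ) ^ 2) ≠ 0 := by exact_mod_cast (by positivity : (1 + L.T x ^ 2) ≠ 0)
    push_cast
    rw [eq_div_iff n3]
    rw [q, q'] at e2
    generalize L.p x ⟨1, _⟩ = u at *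
    generalize L.p x pm1 = v at *
    push_cast at e2
    have a : ((1 + I * L.T x) * u ^ 2 - (1 - I * L.T x) * v ^ 2) * ((1 + I * L.T x) * (1 - I * L.T x)) = -2 * I * L.T x * L.R x ^ 2 := by
      linear_combination (1 - I * L.T x) * ((1 + I * L.T x) * u + L.R x) * r - (1 + I * L.T x) * ((1 - I * L.T x) * v + L.R x) * r'
    rw [show (1 + I * L.T x) * (1 - I * L.T x) = 1 + (L.T x : ℂ) ^ 2 by linear_combination -L.T x ^ 2 * Complex.I_sq] at a
    refine mul_left_cancel₀ Complex.I_ne_zero ?_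
    simp only [p1]
    linear_combination (1 + (L.T x : ℂ) ^ 2) * e2 + a
  have e4 := congrArg Complex.re e3
  rw [Complex.ofReal_re, eq_div_iff (by positivity)] at e4
  have hH := (L.hH x).ne'
  have : Jop (deriv L.p x * L.p x) = Jop (L.p x * deriv L.p x) := by rw [mul_comm]
  simp only [p1] at e4
  simp [this, p1] at e4 ⊢
  have n3 : (1 + L.T x ^ 2) ≠ 0 := by positivity
  field_simp
  linear_combination 2 * e4
end Lay
end
section
open MeasureTheory
open HV
section
variable (P : Pr) {a : ℝ} (ha : 0 < a) {σ : ℝ} (hσ : σ ^ 2 = 1) (c : ℝ) {ε : ℝ} (o : Ok ε) {b y : A} (hb : Hm b) (hy : Hm y)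
  (fy : y = yy P a σ c ε b y) (hp : ∀ X, 0 < a + σ * ε * GR P ε b X)
include o
lemma GR_cd : ContDiff ℝ 3 (GR P ε b) := by
  have h : ContDiff ℝ 3 (bR P ε b) := (Complex.reCLM.comp ((evalE p1).restrictScalars ℝ)).contDiff.comp (EV_contDiff (WF1 P.hl ε o) _)
  exact ((contDiff_const.sub (tanh_cd (n := 3))).div_const 2).add (contDiff_const.mul h)
omit o
def mkLay : Lay where
  m := c * (a + σ * ε)
  H x := a + σ * ε * GR P ε b (P.l * |ε| * x)
  T x := σ * ε * (P.l * |ε|) * gR P ε b (P.l * |ε| * x)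
  p x := ((c * (a + σ * ε) : ℝ) : ℂ) • 1 + ((ε * (P.l * |ε|) : ℝ) : ℂ) • EV (W1 (P.l * |ε|)) y (P.l * |ε| * x)
  N x := ((ε * (P.l * |ε|) ^ 2 : ℝ) : ℂ) • EV W0 (nn P a σ c ε b y) (P.l * |ε| * x)
  R x := c * (a + σ * ε) + P.l ^ 2 * ε ^ 3 * nR P a σ c ε b y (P.l * |ε| * x)
  cH := contDiff_const.add (contDiff_const.mul ((GR_cd P o).comp (contDiff_const.mul contDiff_id)))
  hd x := by
    have := ((GR_hd P o hb (P.l * |ε| * x)).comp x ((hasDerivAt_id x).const_mul (P.l * |ε|))).const_mul (σ * ε) |>.const_add a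
    refine this.congr_deriv ?_
    ring
  hH x := hp _
  cp := contDiff_const.add (ContDiff.const_smul (R := ℂ) _ ((EV_contDiff (WF1 P.hl ε o) y).comp (contDiff_const.mul contDiff_id)))
  th x := by
    rw [theta_add, theta_smul, theta_smul, theta_one, EV_theta (WF1 P.hl ε o) hy]; simp
  mean x := by
    rw [map_add, map_smul, map_smul, L2 P ha σ c o hb fy, meanE_one, smul_zero, add_zero]
  eq1 x := by
    have h := L1 P σ c o hb fy (P.l * |ε| * x)
    ext s
    have h := congrArg (fun v : E => v s) h
    simp [QQ] at h ⊢
    linear_combination (ε * (P.l * |ε|) : ℂ) * h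
  eq2 x := by
    have h := L3 P ha σ c o hb fy hσ (P.l * |ε| * x)
    have hd : HasDerivAt (fun x => ((c * (a + σ * ε) : ℝ) : ℂ) • (1 : E) + ((ε * (P.l * |ε|) : ℝ) : ℂ) • EV (W1 (P.l * |ε|)) y (P.l * |ε| * x))
        (((ε * (P.l * |ε|) ^ 2 : ℝ) : ℂ) • deriv (EV (W1 (P.l * |ε|)) y) (P.l * |ε| * x)) x := by
      have h1 := ((EV_contDiff (WF1 P.hl ε o) y).differentiable (by norm_num) (P.l * |ε| * x)).hasDerivAt
      have := ((h1.scomp x ((hasDerivAt_id x).const_mul (P.l * |ε|))).const_smul (((ε * (P.l * |ε|) : ℝ) : ℂ))).const_add (((c * (a + σ * ε) : ℝ) : ℂ) • (1 : E))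
      refine this.congr_deriv ?_
      rw [← Complex.coe_smul, smul_smul]
      push_cast; congr 1; ring
    rw [hd.deriv, smul_comm, map_smul Jop, ← h, map_smul, smul_sub]
  tr x := by
    rw [map_smul, tr_nn o P hb hy ha σ c, smul_smul]
    congr 1
    push_cast
    have : ((|ε| : ℝ) : ℂ) ^ 2 = (ε : ℂ) ^ 2 := by exact_mod_cast sq_abs ε
    linear_combination (ε * P.l ^ 2 * nR P a σ c ε b y (P.l * |ε| * x) : ℂ) * this
end
end
section
open MeasureTheory
open HV
lemma tanh_top : Tendsto tanh atTop (nhds 1) := by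
  have h1 : Tendsto (fun x => 1 - 2 / (exp (2 * x) + 1)) atTop (nhds (1 - 0)) :=
    tendsto_const_nhds.sub (tendsto_const_nhds.div_atTop
      (tendsto_atTop_add_const_right _ _ (tendsto_exp_atTop.comp (tendsto_id.const_mul_atTop two_pos))))
  rw [sub_zero] at h1
  refine h1.congr fun x => ?_
  rw [tanh_eq_sinh_div_cosh, sinh_eq, cosh_eq, show 2 * x = x + x by ring, exp_add, exp_neg]
  have := exp_pos x
  field_simp; ring
lemma tanh_bot : Tendsto tanh atBot (nhds (-1)) := by
  have := (tanh_top.comp tendsto_neg_atBot_atTop).neg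
  refine this.congr fun x => by simp
lemma ffz {f w β : ℝ → ℝ} {K δ e M w0 w1 l : ℝ} (hδ : 0 < δ)
    (hd : ∀ x, HasDerivAt f (K * (Sf (δ * x) / 2 - e * β x) * Sf (δ * x) * w x) x)
    (hw : ∀ x, w0 ≤ w x ∧ w x ≤ w1) (h0 : 0 < w0) (hβ : ∀ x, |β x| ≤ M) (he : 3 * |e| * M * w1 < w0)
    (ht : Tendsto f atTop (nhds l)) (hb : Tendsto f atBot (nhds l)) : K = 0 := by
  by_contra hK
  have hM : 0 ≤ M := (abs_nonneg _).trans (hβ 0)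
  let q : ℝ → ℝ := fun x => δ / K * f x - w0 / 2 * (tanh (δ * x) - tanh (δ * x) ^ 3 / 3) + |e| * M * w1 * tanh (δ * x)
  have hq : ∀ x, HasDerivAt q (δ * Sf (δ * x) * ((Sf (δ * x) / 2 - e * β x) * w x - w0 / 2 * Sf (δ * x) + |e| * M * w1)) x := fun x => by
    have a := (tanh_hd (δ * x)).comp x ((hasDerivAt_id x).const_mul δ)
    refine ((((hd x).const_mul (δ / K)).sub ((a.sub ((a.pow 3).div_const 3)).const_mul (w0 / 2))).add (a.const_mul (|e| * M * w1))).congr_deriv ?_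
    simp [Sf]; field_simp
  have hm : Monotone q := monotone_of_deriv_nonneg (fun x => (hq x).differentiableAt) fun x => by
    rw [(hq x).deriv]
    have s := Sf_pos (δ * x)
    refine mul_nonneg (by positivity) ?_
    have h1 : e * β x * w x ≤ |e| * M * w1 := (le_abs_self _).trans (by
      rw [abs_mul, abs_mul, abs_of_pos (h0.trans_le (hw x).1)]
      have h3 := hβ x; have h4 := hw x; have h5 := h0.le.trans h4.1
      exact mul_le_mul (mul_le_mul_of_nonneg_left h3 (abs_nonneg _)) h4.2 h5 (by positivity))
    nlinarith [mul_le_mul_of_nonneg_left (hw x).1 s.le]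
  have dt : Tendsto (fun x => tanh (δ * x)) atTop (nhds 1) := tanh_top.comp (tendsto_id.const_mul_atTop hδ)
  have db : Tendsto (fun x => tanh (δ * x)) atBot (nhds (-1)) := tanh_bot.comp (tendsto_id.const_mul_atBot hδ)
  have h1 := hm.ge_of_tendsto (((ht.const_mul (δ / K)).sub ((dt.sub ((dt.pow 3).div_const 3)).const_mul (w0 / 2))).add (dt.const_mul (|e| * M * w1))) 0
  have h2 := hm.le_of_tendsto (((hb.const_mul (δ / K)).sub ((db.sub ((db.pow 3).div_const 3)).const_mul (w0 / 2))).add (db.const_mul (|e| * M * w1))) 0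
  norm_num at h1 h2
  linarith
namespace Lay
variable (L : Lay)
lemma S_lim {F : Filter ℝ} {k} (hk : 0 < k) (hH : Tendsto L.H F (nhds k)) (hp : Tendsto L.p F (nhds ((L.m : ℂ) • 1))) :
    Tendsto L.S F (nhds (L.m ^ 2 / (2 * k))) := by
  have h1 := (Complex.continuous_re.tendsto _).comp (((evalE p1 ∘L Jop).continuous.tendsto _).comp (hp.mul hp))
  have h2 := h1.div (hH.const_mul 4) (by positivity)
  refine (h2.congr fun x => rfl).congr' EventuallyEq.rfl |>.trans (le_of_eq ?_)
  congr 1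
  have : ((L.m : ℂ) • (1 : E)) * ((L.m : ℂ) • 1) = cst ((L.m : ℂ) ^ 2) := by ext s; simp [sq]
  simp only [this, ContinuousLinearMap.comp_apply, evalE_apply, Jop_cst]
  rw [← Complex.ofReal_pow]
  simp [p1, -Complex.ofReal_pow]
  field_simp; ring
lemma lim3 {c k} (hk : 0 < k) (hc : c * k = L.m) (hH : Tendsto L.H atBot (nhds k)) (hp : Tendsto L.p atBot (nhds ((L.m : ℂ) • 1)))
    {d} (hd : 0 < d) : ∃ X, ∀ x ≤ X, ∀ Y, 0 ≤ Y → Y ≤ L.H x →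
    |deriv (fun t => L.psi (t, Y)) x| ≤ d ∧ |deriv (fun t => L.psi (x, t)) Y + c| ≤ d := by
  have h1 : Tendsto (fun x => (|c * L.H x - L.m| + ‖L.p x - (L.m : ℂ) • 1‖) / L.H x) atBot (nhds ((|c * k - L.m| + ‖(L.m : ℂ) • (1 : E) - (L.m : ℂ) • 1‖) / k)) :=
    (((hH.const_mul c).sub_const _).abs.add (hp.sub_const _).norm).div hH hk.ne'
  rw [hc, sub_self, sub_self, abs_zero, norm_zero, add_zero, zero_div] at h1
  obtain ⟨X, hX⟩ := eventually_atBot.1 (h1.eventually (gt_mem_nhds hd))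
  refine ⟨X, fun x hx Y h0 h => ?_⟩
  have hH := L.hH x
  have b := hX x hx
  rw [div_lt_iff₀ hH] at b
  have e : ‖ext (L.p x) (Y / L.H x) - L.m‖ ≤ ‖L.p x - (L.m : ℂ) • 1‖ := by
    have := ext_norm (L.p x - (L.m : ℂ) • 1) (Y / L.H x)
    simpa [ext] using this
  have e1 := (Complex.abs_re_le_norm _).trans e
  have e2 := (Complex.abs_im_le_norm _).trans e
  simp only [Complex.sub_re, Complex.ofReal_re, Complex.sub_im, Complex.ofReal_im, sub_zero] at e1 e2
  have a1 := abs_nonneg (c * L.H x - L.m)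
  rw [(L.psix h0 h).deriv, (L.psiy h0 h).deriv]
  constructor
  · rw [abs_div, abs_neg, abs_of_pos hH, div_le_iff₀ hH]; linarith
  · rw [show -(ext (L.p x) (Y / L.H x)).re / L.H x + c = ((c * L.H x - L.m) - ((ext (L.p x) (Y / L.H x)).re - L.m)) / L.H x by field_simp; ring,
      abs_div, abs_of_pos hH, div_le_iff₀ hH]
    have := abs_sub (c * L.H x - L.m) ((ext (L.p x) (Y / L.H x)).re - L.m)
    linarith
lemma speed (x) : deriv (fun t => L.psi (t, L.H x)) x ^ 2 + deriv (fun t => L.psi (x, t)) (L.H x) ^ 2 = L.R x ^ 2 / (L.H x ^ 2 * (1 + L.T x ^ 2)) := by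
  have hH := L.hH x
  rw [(L.psix hH.le le_rfl).deriv, (L.psiy hH.le le_rfl).deriv, div_self hH.ne', show ext (L.p x) 1 = L.p x p1 from ext_coe _ p1]
  have h := (L.end1 x).1
  have h1 := congrArg Complex.re h
  have h2 := congrArg Complex.im h
  simp at h1 h2
  field_simp
  rw [← h1]
  linear_combination ((L.p x p1).im + L.T x * (L.p x p1).re) * h2
def phi (q : ℝ × ℝ) : ℝ := -L.psi (q.1, 1 - q.2)
lemma phi_c : ContDiff ℝ 2 L.phi := (L.psi_c.comp (contDiff_fst.prodMk (contDiff_const.sub contDiff_snd))).neg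
lemma phix x Y : deriv (fun t => L.phi (t, Y)) x = -deriv (fun t => L.psi (t, 1 - Y)) x := deriv.neg
lemma phiy x Y : deriv (fun t => L.phi (x, t)) Y = deriv (fun t => L.psi (x, t)) (1 - Y) := by
  have := deriv_comp_const_sub (f := fun t => L.psi (x, t)) 1 Y
  have h2 : deriv (fun t => L.phi (x, t)) Y = -deriv (fun t => L.psi (x, 1 - t)) Y := deriv.neg
  rw [h2, this, neg_neg]
end Lay
end
section
open MeasureTheory
open HV
namespace Lay
lemma harm (L : Lay) {x Y} (h : 0 < Y) (h' : Y < L.H x) :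
    deriv (fun t => deriv (fun s => L.psi (s, Y)) t) x + deriv (fun t => deriv (fun s => L.psi (x, s)) t) Y = 0 := by
  obtain ⟨A, B, h1, h2, h3⟩ := L.psixx h h'
  rw [h1.deriv, h2.deriv, h3]
lemma harm' (L : Lay) {x Y} (h : 0 < 1 - Y) (h' : 1 - Y < L.H x) :
    deriv (fun t => deriv (fun s => L.phi (s, Y)) t) x + deriv (fun t => deriv (fun s => L.phi (x, s)) t) Y = 0 := by
  simp only [phix, phiy]
  rw [deriv.fun_neg, deriv_comp_const_sub (f := fun Y => deriv (fun s => L.psi (x, s)) Y), ← neg_add, L.harm h h', neg_zero]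
variable (L M : Lay)
lemma flow {ρ c k a b ε δ e0 : ℝ} {β : ℝ → ℝ} (ha : 0 < a) (hb : 0 < b) (hab : c ^ 2 * (ρ * a + b) = (1 - ρ) * (a * b))
    (he : ε ≠ 0) (ea : 4 * |ε| ≤ a) (eb : 4 * |ε| ≤ b) (hδ : 0 < δ)
    (hL : L.m = c * (a + ε)) (hM : M.m = c * (b - ε)) (hH : ∀ x, M.H x = 1 - L.H x) (hs : a + b = 1) (hT : ∀ x, M.T x = -L.T x)
    (b1 : ∀ x, |L.H x - a| ≤ 2 * |ε|) (b2 : ∀ x, |L.T x| ≤ 1) (b3 : ∀ x, |β x| ≤ e0) (b4 : 3 * |ε| * e0 * (8 / (a * b) ^ 2) < 1 / 4)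
    (l1 : Tendsto L.H atBot (nhds (a + ε))) (l2 : Tendsto L.H atTop (nhds a))
    (l3 : Tendsto L.p (cocompact ℝ) (nhds ((L.m : ℂ) • 1))) (l4 : Tendsto M.p (cocompact ℝ) (nhds ((M.m : ℂ) • 1)))
    (t : ∀ x, L.T x = -(ε * δ) * (Sf (δ * x) / 2 - ε * β x))
    (f : ∀ x, ρ * M.R x ^ 2 * L.H x ^ 2 - L.R x ^ 2 * M.H x ^ 2 + (ρ - 1) * (2 * (L.H x - (a + ε)) - c ^ 2) * L.H x ^ 2 * M.H x ^ 2 * (1 + L.T x ^ 2)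
      = k * Sf (δ * x)) : k = 0 := by
  have hHf : M.H = fun x => 1 - L.H x := funext hH
  have m1 : Tendsto M.H atBot (nhds (b - ε)) := by
    rw [hHf, show b - ε = 1 - (a + ε) by linarith]; exact l1.const_sub 1
  have m2 : Tendsto M.H atTop (nhds b) := by
    rw [hHf, show b = 1 - a by linarith]; exact l2.const_sub 1
  have ha' : 0 < a + ε := by linarith [neg_abs_le ε]
  have hb' : 0 < b - ε := by linarith [le_abs_self ε]
  have q1 := (((M.S_lim hb' m1 (l4.mono_left atBot_le_cocompact)).const_mul ρ).add (L.S_lim ha' l1 (l3.mono_left atBot_le_cocompact))).add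
    ((((l1.sub_const (a + ε)).pow 2).const_mul ((ρ - 1) / 2)).sub (l1.const_mul ((ρ - 1) * c ^ 2 / 2)))
  have q2 := (((M.S_lim hb m2 (l4.mono_left atTop_le_cocompact)).const_mul ρ).add (L.S_lim ha l2 (l3.mono_left atTop_le_cocompact))).add
    ((((l2.sub_const (a + ε)).pow 2).const_mul ((ρ - 1) / 2)).sub (l2.const_mul ((ρ - 1) * c ^ 2 / 2)))
  have ee : ρ * (M.m ^ 2 / (2 * (b - ε))) + L.m ^ 2 / (2 * (a + ε)) + ((ρ - 1) / 2 * (a + ε - (a + ε)) ^ 2 - (ρ - 1) * c ^ 2 / 2 * (a + ε)) =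
      ρ * (M.m ^ 2 / (2 * b)) + L.m ^ 2 / (2 * a) + ((ρ - 1) / 2 * (a - (a + ε)) ^ 2 - (ρ - 1) * c ^ 2 / 2 * a) := by
    rw [hL, hM]
    field_simp
    linear_combination (-ε ^ 2) * hab
  rw [ee] at q1
  have q3 := fun x => (((M.S_d x).const_mul ρ).add (L.S_d x)).add
    (((((L.hd x).sub_const (a + ε)).pow 2).const_mul ((ρ - 1) / 2)).sub ((L.hd x).const_mul ((ρ - 1) * c ^ 2 / 2)))
  have key := ffz (K := -(k * (ε * δ))) (β := β) (e := ε) (M := e0) (w0 := 1 / 4) (w1 := 8 / (a * b) ^ 2)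
    (w := fun x => 1 / (2 * L.H x ^ 2 * M.H x ^ 2 * (1 + L.T x ^ 2))) hδ (fun x => (q3 x).congr_deriv ?_) (fun x => ?_) (by norm_num) b3 b4 q2 q1
  · have := mul_ne_zero he hδ.ne'
    simpa [this] using key
  · have h1 := (L.hH x).ne'
    have h2 := (M.hH x).ne'
    have h3 : (0:ℝ) < 1 + L.T x ^ 2 := by positivity
    have e : -(k * (ε * δ)) * (Sf (δ * x) / 2 - ε * β x) * Sf (δ * x) = L.T x * (k * Sf (δ * x)) := by rw [t]; ring
    rw [e, ← f x, hT]
    have h4 : (1 + (-L.T x) ^ 2) = 1 + L.T x ^ 2 := by ring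
    rw [h4]
    simp
    field_simp
    ring
  · have h1 := abs_le.1 (b1 x)
    have h2 := hH x
    have h3 := abs_le.1 (b2 x)
    have h4 : a / 2 ≤ L.H x := by linarith
    have h5 : b / 2 ≤ M.H x := by linarith
    have g1 : (a / 2) ^ 2 ≤ L.H x ^ 2 := by gcongr
    have g2 : (b / 2) ^ 2 ≤ M.H x ^ 2 := by gcongr
    have g3 : L.H x ^ 2 ≤ 1 := by have := M.hH x; have := L.hH x; nlinarith
    have g4 : M.H x ^ 2 ≤ 1 := by have := M.hH x; have := L.hH x; nlinarith
    have g5 : L.T x ^ 2 ≤ 1 := by nlinarith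
    have g6 : L.H x ^ 2 * M.H x ^ 2 ≤ 1 := mul_le_one₀ g3 (sq_nonneg _) g4
    have g7 : (a / 2) ^ 2 * (b / 2) ^ 2 ≤ L.H x ^ 2 * M.H x ^ 2 := by gcongr
    have p1 := L.hH x
    have p2 := M.hH x
    constructor
    · apply one_div_le_one_div_of_le (by positivity)
      linarith [mul_le_mul g6 (by linarith : 1 + L.T x ^ 2 ≤ 2) (by positivity) zero_le_one]
    · rw [div_le_div_iff₀ (by positivity) (by positivity)]
      linarith [mul_nonneg (mul_nonneg (sq_nonneg (L.H x)) (sq_nonneg (M.H x))) (sq_nonneg (L.T x))]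
end Lay
end
section
open MeasureTheory
open HV
lemma Ul.ebd {P : Pr} {T : ℝ → A → A} (h : Ul T) (R : ℝ) : ∃ M, 0 ≤ M ∧ ∀ ε b, Ok ε → ‖b‖ ≤ R → ∀ X, |(EV (W1 (P.l * |ε|)) (T ε b) X p1).re| ≤ M := by
  obtain ⟨C, hC, h⟩ := h
  refine ⟨2 * (C * |R|), by positivity, fun ε b o hb X => ?_⟩
  refine (Complex.abs_re_le_norm _).trans ((E.le_norm _ _).trans ((EV_norm (WF1 P.hl ε o) _ X).trans ?_))
  have := ((h ε o).2.1 b).trans (mul_le_mul_of_nonneg_left (hb.trans (le_abs_self R)) hC)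
  linarith
section
variable (D : Dt) {ε : ℝ} (o : Ok ε) {b y1 y2 : A} (hb : Hm b) (hy1 : Hm y1) (hy2 : Hm y2)
  (fb : b = (Bz (fo ε b (EEo D ε b y1 y2) D.P), b2n (EEo D ε b y1 y2))) (f1 : y1 = y1n D ε b y1) (f2 : y2 = y2n D ε b y2)
include o hb hy1 hy2 fb f1 f2
lemma exLay {M M' : ℝ} (hM : ∀ X, |bR D.P ε b X| ≤ M) (hM' : ∀ X, |(EV (W1 (D.P.l * |ε|)) (bt' D.P (D.P.l * |ε|) b) X p1).re| ≤ M')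
    (e1 : |ε| * M < 1) (ea : |ε| * 4 < D.P.a) (eb : |ε| * 4 < D.P.b) (e2 : |ε| * M' < 1 / 2) (e3 : |ε| * D.P.l < 1)
    (e4 : |ε| * (3 * M' * (8 / (D.P.a * D.P.b) ^ 2)) < 1 / 4) :
    ∃ L N : Lay, L.m = D.c * (D.P.a + ε) ∧ N.m = D.c * (D.P.b - ε) ∧ (∀ x, N.H x = 1 - L.H x) ∧ (∀ x, N.T x = -L.T x) ∧
    Tendsto L.H atBot (nhds (D.P.a + ε)) ∧ Tendsto L.H atTop (nhds D.P.a) ∧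
    Tendsto L.p (cocompact ℝ) (nhds ((L.m : ℂ) • 1)) ∧ Tendsto N.p (cocompact ℝ) (nhds ((N.m : ℂ) • 1)) ∧
    (∀ x, D.ρ * N.R x ^ 2 * L.H x ^ 2 - L.R x ^ 2 * N.H x ^ 2 + (D.ρ - 1) * (2 * (L.H x - (D.P.a + ε)) - D.c ^ 2) * L.H x ^ 2 * N.H x ^ 2 * (1 + L.T x ^ 2) = 0) ∧
    ∀ x, |L.H x - (D.P.a + ε) + ε * (1 + tanh (D.P.l * |ε| * x)) / 2| ≤ M * ε ^ 2 := by
  have hε := o.1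
  have hδ : 0 < D.P.l * |ε| := mul_pos D.P.hl hε
  have hG : ∀ X, |ε * GR D.P ε b X| ≤ 2 * |ε| := fun X => by
    rw [abs_mul, mul_comm]
    refine mul_le_mul_of_nonneg_right ?_ hε.le
    have h1 := abs_le.1 (tanh_abs X)
    have h2 : |ε * bR D.P ε b X| ≤ 1 := by
      rw [abs_mul]; exact (mul_le_mul_of_nonneg_left (hM X) hε.le).trans e1.le
    have h2 := abs_le.1 h2
    rw [GR, abs_le]; constructor <;> linarith
  let L := mkLay D.P D.P.ha (σ := 1) (by norm_num) D.c o hb hy1 f1 fun X => by have := abs_le.1 (hG X); linarith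
  let N := mkLay D.P D.P.hb (σ := -1) (by norm_num) D.c o hb hy2 f2 fun X => by have := abs_le.1 (hG X); linarith
  have LH : ∀ x, L.H x = D.P.a + 1 * ε * GR D.P ε b (D.P.l * |ε| * x) := fun _ => rfl
  have NH : ∀ x, N.H x = D.P.b + -1 * ε * GR D.P ε b (D.P.l * |ε| * x) := fun _ => rfl
  have LT : ∀ x, L.T x = 1 * ε * (D.P.l * |ε|) * gR D.P ε b (D.P.l * |ε| * x) := fun _ => rfl
  have NT : ∀ x, N.T x = -1 * ε * (D.P.l * |ε|) * gR D.P ε b (D.P.l * |ε| * x) := fun _ => rfl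
  have LR : ∀ x, L.R x = D.c * (D.P.a + 1 * ε) + D.P.l ^ 2 * ε ^ 3 * nR D.P D.P.a 1 D.c ε b y1 (D.P.l * |ε| * x) := fun _ => rfl
  have NR : ∀ x, N.R x = D.c * (D.P.b + -1 * ε) + D.P.l ^ 2 * ε ^ 3 * nR D.P D.P.b (-1) D.c ε b y2 (D.P.l * |ε| * x) := fun _ => rfl
  have hs := D.hs
  have tb : Tendsto (fun x : ℝ => D.P.l * |ε| * x) atBot atBot := tendsto_id.const_mul_atBot hδ
  have tt : Tendsto (fun x : ℝ => D.P.l * |ε| * x) atTop atTop := tendsto_id.const_mul_atTop hδ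
  have c0 : Tendsto (fun x : ℝ => D.P.l * |ε| * x) (cocompact ℝ) (cocompact ℝ) := by
    rw [cocompact_eq_atBot_atTop]; exact tb.sup_sup tt
  have pl : ∀ (m r : ℂ) (y : A), Tendsto (fun x => m • (1 : E) + r • EV (W1 (D.P.l * |ε|)) y (D.P.l * |ε| * x)) (cocompact ℝ) (nhds (m • 1)) := fun m r y => by
    simpa using (((EV_tendsto (W1 (D.P.l * |ε|)) y).comp c0).const_smul r).const_add (m • (1 : E))
  have bl : Tendsto (bR D.P ε b) (cocompact ℝ) (nhds 0) := by
    have := (Complex.continuous_re.tendsto _).comp (((evalE p1).continuous.tendsto _).comp (EV_tendsto (W1 (D.P.l * |ε|)) (bt D.P (D.P.l * |ε|) b)))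
    rwa [map_zero, Complex.zero_re] at this
  have l1 : Tendsto L.H atBot (nhds (D.P.a + ε)) := by
    have := (((((tanh_bot.const_sub 1).div_const 2).add ((bl.mono_left atBot_le_cocompact).const_mul ε)).const_mul (1 * ε)).const_add D.P.a).comp tb
    refine (show Tendsto L.H _ (nhds _) from this).trans (le_of_eq (congrArg nhds ?_)); ring
  have l2 : Tendsto L.H atTop (nhds D.P.a) := by
    have := (((((tanh_top.const_sub 1).div_const 2).add ((bl.mono_left atTop_le_cocompact).const_mul ε)).const_mul (1 * ε)).const_add D.P.a).comp tt
    refine (show Tendsto L.H _ (nhds _) from this).trans (le_of_eq (congrArg nhds ?_)); ring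
  have hab : D.c ^ 2 * (D.ρ * D.P.a + D.P.b) = (1 - D.ρ) * (D.P.a * D.P.b) := by
    refine mul_left_cancel₀ D.P.ha.ne' ?_
    rw [D.hc2]
    linear_combination D.P.a * D.hr
  have lp : Tendsto L.p (cocompact ℝ) (nhds ((L.m : ℂ) • 1)) := pl _ _ y1
  have np : Tendsto N.p (cocompact ℝ) (nhds ((N.m : ℂ) • 1)) := pl _ _ y2
  have lm : L.m = D.c * (D.P.a + ε) := by show D.c * (D.P.a + 1 * ε) = _; ring
  have nm : N.m = D.c * (D.P.b - ε) := by show D.c * (D.P.b + -1 * ε) = _; ring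
  have hH : ∀ x, N.H x = 1 - L.H x := fun x => by rw [LH, NH]; linarith
  have hT : ∀ x, N.T x = -L.T x := fun x => by rw [LT, NT]; ring
  have f : ∀ x, D.ρ * N.R x ^ 2 * L.H x ^ 2 - L.R x ^ 2 * N.H x ^ 2 + (D.ρ - 1) * (2 * (L.H x - (D.P.a + ε)) - D.c ^ 2) * L.H x ^ 2 * N.H x ^ 2 * (1 + L.T x ^ 2)
      = D.κ * ε ^ 4 * cc D ε b y1 y2 * Sf (D.P.l * |ε| * x) := fun x => by
    have := fix3 D o hb hy1 hy2 fb (D.P.l * |ε| * x)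
    rw [mul_right_comm (D.κ * ε ^ 4), ← this, LH, NH, LT, LR, NR, mul_pow _ (gR _ _ _ _), mul_pow, mul_pow D.P.l, sq_abs]
    ring
  have b2 : ∀ x, |L.T x| ≤ 1 := fun x => by
    have g : |gR D.P ε b (D.P.l * |ε| * x)| ≤ 1 := by
      rw [EVg' D.P o hb]
      have h1 := Sf_pos (D.P.l * |ε| * x)
      have h2 := Sf_le (D.P.l * |ε| * x)
      have h3 : |ε * (EV (W1 (D.P.l * |ε|)) (bt' D.P (D.P.l * |ε|) b) (D.P.l * |ε| * x) p1).re| ≤ 1 / 2 := by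
        rw [abs_mul]; exact (mul_le_mul_of_nonneg_left (hM' _) hε.le).trans e2.le
      have h3 := abs_le.1 h3
      rw [abs_le]; constructor <;> linarith
    rw [LT, one_mul, abs_mul, abs_mul, abs_of_pos hδ]
    exact mul_le_one₀ (mul_le_one₀ o.2 hδ.le (by linarith)) (abs_nonneg _) g
  have k0 := L.flow N D.P.ha D.P.hb hab (abs_pos.1 hε) (by linarith) (by linarith) hδ lm nm hH hs hT
    (fun x => by rw [LH, one_mul, add_sub_cancel_left]; exact hG _) b2 (fun x => hM' (D.P.l * |ε| * x)) (by linarith) l1 l2 lp np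
    (fun x => by rw [LT, EVg' D.P o hb]; ring) f
  refine ⟨L, N, lm, nm, hH, hT, l1, l2, lp, np, fun x => by rw [f, k0, zero_mul], fun x => ?_⟩
  rw [LH, GR, show D.P.a + 1 * ε * ((1 - tanh (D.P.l * |ε| * x)) / 2 + ε * bR D.P ε b (D.P.l * |ε| * x)) - (D.P.a + ε) + ε * (1 + tanh (D.P.l * |ε| * x)) / 2
    = bR D.P ε b (D.P.l * |ε| * x) * ε ^ 2 by ring, abs_mul, abs_of_nonneg (sq_nonneg ε)]
  exact mul_le_mul_of_nonneg_right (hM _) (sq_nonneg ε)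
end
end
open HV
lemma core (D : Dt) : ∃ ε₀ > (0 : ℝ), ∃ C > (0 : ℝ), ∀ ε : ℝ, 0 < |ε| → |ε| < ε₀ →
    ∃ L N : Lay, L.m = D.c * (D.P.a + ε) ∧ N.m = D.c * (D.P.b - ε) ∧ (∀ x, N.H x = 1 - L.H x) ∧ (∀ x, N.T x = -L.T x) ∧
    0 < D.P.a + ε ∧ 0 < D.P.b - ε ∧
    Tendsto L.H atBot (nhds (D.P.a + ε)) ∧ Tendsto L.H atTop (nhds D.P.a) ∧
    Tendsto L.p (cocompact ℝ) (nhds ((L.m : ℂ) • 1)) ∧ Tendsto N.p (cocompact ℝ) (nhds ((N.m : ℂ) • 1)) ∧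
    (∀ x, D.ρ * N.R x ^ 2 * L.H x ^ 2 - L.R x ^ 2 * N.H x ^ 2 + (D.ρ - 1) * (2 * (L.H x - (D.P.a + ε)) - D.c ^ 2) * L.H x ^ 2 * N.H x ^ 2 * (1 + L.T x ^ 2) = 0) ∧
    ∀ x, |L.H x - (D.P.a + ε) + ε * (1 + Real.tanh (D.P.l * |ε| * x)) / 2| ≤ C * ε ^ 2 := by
  obtain ⟨ε₁, h1, R, hR⟩ := (G.Th D).fix
  obtain ⟨M, m0, hM⟩ := (Ul.bt D.P).ebd (P := D.P) R
  obtain ⟨M', m0', hM'⟩ := (Ul.bt' D.P).ebd (P := D.P) R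
  have ev : ∀ K k : ℝ, 0 < k → ∀ᶠ t in nhds (0 : ℝ), t * K < k := fun K k hk =>
    (Continuous.tendsto' (by fun_prop : Continuous fun t : ℝ => t * K) 0 0 (by simp)).eventually (gt_mem_nhds hk)
  obtain ⟨ε₀, h0, h⟩ := Metric.eventually_nhds_iff.1 ((ev 1 ε₁ h1).and ((ev 1 1 one_pos).and ((ev M 1 one_pos).and ((ev 4 _ D.P.ha).and
    ((ev 4 _ D.P.hb).and ((ev M' (1 / 2) (by norm_num)).and ((ev D.P.l 1 one_pos).and (ev (3 * M' * (8 / (D.P.a * D.P.b) ^ 2)) (1 / 4) (by norm_num)))))))))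
  refine ⟨ε₀, h0, M + 1, by linarith, fun ε hε he => ?_⟩
  obtain ⟨g1, g2, e1, ea, eb, e2, e3, e4⟩ := @h |ε| (by simpa using he)
  have o : Ok ε := ⟨hε, by linarith⟩
  obtain ⟨⟨b, y1, y2⟩, hu, hn, hf⟩ := hR ε o (by linarith)
  have hnb : ‖b‖ ≤ R := (norm_fst_le (b, y1, y2)).trans hn
  have f1 : y1n D ε b y1 = y1 := congrArg (fun z => z.2.1) hf
  have f2 : y2n D ε b y2 = y2 := congrArg (fun z => z.2.2) hf
  have fb := congrArg Prod.fst hf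
  simp only [Th, f1, f2] at fb
  obtain ⟨L, N, a1, a2, a3, a4, a5, a6, a7, a8, a9, a10⟩ := exLay D o hu.1 hu.2.1 hu.2.2 fb.symm f1.symm f2.symm (hM ε b o hnb) (hM' ε b o hnb) e1 ea eb e2 e3 e4
  refine ⟨L, N, a1, a2, a3, a4, by linarith [neg_abs_le ε, D.P.ha], by linarith [le_abs_self ε], a5, a6, a7, a8, a9, fun x => (a10 x).trans ?_⟩
  nlinarith [sq_nonneg ε]
lemma dat {ρ c l} (hρ : ρ ∈ Ioo (0 : ℝ) 1) (hc : c = √(1 - ρ) / (1 + √ρ))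
    (hl : l = √(3 * (1 + √ρ) ^ 4 / (4 * √ρ * (ρ - √ρ + 1)))) : ∃ D : Dt, D.ρ = ρ ∧ D.c = c ∧ D.P.l = l ∧ D.P.a = 1 / (1 + √ρ) := by
  obtain ⟨h0, h1⟩ := hρ
  obtain ⟨r, hr⟩ : ∃ r, r = √ρ := ⟨_, rfl⟩
  have r0 : 0 < r := hr ▸ Real.sqrt_pos.2 h0
  have r2 : ρ = r ^ 2 := by rw [hr, Real.sq_sqrt h0.le]
  have r1 : r < 1 := by nlinarith
  rw [← hr, r2] at hl hc
  rw [← hr, r2]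
  obtain ⟨k, hk⟩ : ∃ k, k = r ^ 2 - r + 1 := ⟨_, rfl⟩
  rw [← hk] at hl
  have z : 0 < k := by nlinarith
  have l0 : 0 < l := hl ▸ Real.sqrt_pos.2 (by positivity)
  have l2 : l ^ 2 = 3 * (1 + r) ^ 4 / (4 * r * k) := by rw [hl, Real.sq_sqrt (by positivity)]
  have q : 0 < 1 - r ^ 2 := by nlinarith
  have c0 : 0 < c := hc ▸ div_pos (Real.sqrt_pos.2 q) (by linarith)
  have c2 : c ^ 2 = (1 - r) / (1 + r) := by
    rw [hc, div_pow, Real.sq_sqrt q.le, div_eq_div_iff (by positivity) (by positivity)]; ring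
  let P : Pr := { a := 1 / (1 + r), b := r / (1 + r), p := 3 / ((1 + r) * k), q := 3 * r ^ 3 / ((1 + r) * k), l := l
                  ha := by positivity, hb := by positivity, hp := by positivity, hq := by positivity, hl := l0
                  ha1 := by rw [div_le_one (by linarith)]; linarith
                  hb1 := by rw [div_le_one (by linarith)]; linarith
                  hpq := by field_simp; rw [hk]; ring }
  exact ⟨{ P := P, ρ := r ^ 2, c := c, κ := r / (1 + r) ^ 2 * (1 - r ^ 2) / 2
           hρ := by positivity, hρ1 := by linarith, hc := c0, hκ := by positivity
           hs := by simp only [P]; field_simp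
           hc2 := by simp only [P]; rw [c2]; ring
           hr := by simp only [P]; field_simp
           hκ2 := by simp only [P]; field_simp
           hp := by simp only [P]; rw [l2, c2]; field_simp; ring
           hq := by simp only [P]; rw [l2, c2]; field_simp; ring }, rfl, rfl, rfl, rfl⟩
end
end Bore

/-- Existence of small irrotational bores in a two-layer channel. -/
theorem irrotational_bores (ρ h₀ c₀ lam₁ : ℝ) (hρ : ρ ∈ Ioo (0 : ℝ) 1)
    (hh₀ : h₀ = 1 / (1 + Real.sqrt ρ))
    (hc₀ : c₀ = Real.sqrt (1 - ρ) / (1 + Real.sqrt ρ))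
    (hlam₁ : lam₁ = Real.sqrt (3 * (1 + Real.sqrt ρ) ^ 4 /
      (4 * Real.sqrt ρ * (ρ - Real.sqrt ρ + 1)))) :
    ∃ ε₀ > (0 : ℝ), ∃ C > (0 : ℝ), ∀ ε : ℝ, 0 < |ε| → |ε| < ε₀ →
      ∃ η : ℝ → ℝ, ∃ ψ₁ ψ₂ : ℝ × ℝ → ℝ,
        -- the interface height and its range
        ContDiff ℝ 2 η ∧
        (∀ x : ℝ, 0 < h₀ + ε + η x ∧ h₀ + ε + η x < 1) ∧
        -- stream functions, C² up to the boundary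
        ContDiff ℝ 2 ψ₁ ∧ ContDiff ℝ 2 ψ₂ ∧
        -- harmonicity in each layer (vorticity ω = 0)
        (∀ x Y : ℝ, 0 < Y → Y < h₀ + ε + η x →
          pdx (pdx ψ₁) (x, Y) + pdy (pdy ψ₁) (x, Y) = 0) ∧
        (∀ x Y : ℝ, h₀ + ε + η x < Y → Y < 1 →
          pdx (pdx ψ₂) (x, Y) + pdy (pdy ψ₂) (x, Y) = 0) ∧
        -- kinematic boundary conditions
        (∀ x : ℝ, ψ₁ (x, 0) = c₀ * (h₀ + ε)) ∧
        (∀ x : ℝ, ψ₁ (x, h₀ + ε + η x) = 0) ∧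
        (∀ x : ℝ, ψ₂ (x, h₀ + ε + η x) = 0) ∧
        (∀ x : ℝ, ψ₂ (x, 1) = -c₀ * (1 - (h₀ + ε))) ∧
        -- dynamic boundary condition on the interface
        (∀ x : ℝ,
          (ρ / 2) * ((pdx ψ₂ (x, h₀ + ε + η x)) ^ 2 + (pdy ψ₂ (x, h₀ + ε + η x)) ^ 2)
            - (1 / 2) * ((pdx ψ₁ (x, h₀ + ε + η x)) ^ 2 + (pdy ψ₁ (x, h₀ + ε + η x)) ^ 2)
            + (ρ - 1) * η x = (ρ - 1) * c₀ ^ 2 / 2) ∧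
        -- (i) closeness to the explicit tanh bore profile
        (∀ x : ℝ, |η x + ε * (1 + Real.tanh (lam₁ * |ε| * x)) / 2| ≤ C * ε ^ 2) ∧
        -- (ii) upstream and downstream limits of the interface
        Tendsto η atBot (nhds 0) ∧ Tendsto η atTop (nhds (-ε)) ∧
        -- (iii) uniform upstream limits of the velocity fields
        (∀ δ > (0 : ℝ), ∃ X : ℝ, ∀ x ≤ X, ∀ Y : ℝ, 0 ≤ Y → Y ≤ h₀ + ε + η x →
          |pdx ψ₁ (x, Y)| ≤ δ ∧ |pdy ψ₁ (x, Y) + c₀| ≤ δ) ∧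
        (∀ δ > (0 : ℝ), ∃ X : ℝ, ∀ x ≤ X, ∀ Y : ℝ, h₀ + ε + η x ≤ Y → Y ≤ 1 →
          |pdx ψ₂ (x, Y)| ≤ δ ∧ |pdy ψ₂ (x, Y) + c₀| ≤ δ) := by
  obtain ⟨D, rfl, rfl, rfl, ha⟩ := Bore.dat hρ hc₀ hlam₁
  rw [← ha] at hh₀
  subst hh₀
  have hs := D.hs
  obtain ⟨ε₀, e0, C, hC, h⟩ := Bore.core D
  refine ⟨ε₀, e0, C, hC, fun ε h1 h2 => ?_⟩
  obtain ⟨L, N, a1, a2, a3, a4, ka, kb, a5, a6, a7, a8, a9, a10⟩ := h ε h1 h2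
  have m5 : Tendsto N.H atBot (nhds (D.P.b - ε)) := by
    rw [show N.H = fun x => 1 - L.H x from funext a3, show D.P.b - ε = 1 - (D.P.a + ε) by linarith]; exact a5.const_sub 1
  have hh : ∀ x, D.P.a + ε + (L.H x - (D.P.a + ε)) = L.H x := fun x => by ring
  refine ⟨fun x => L.H x - (D.P.a + ε), L.psi, N.phi, (L.cH.of_le (by norm_num)).sub contDiff_const, ?_⟩
  simp only [hh]
  refine ⟨fun x => ⟨L.hH x, by have := N.hH x; have := a3 x; linarith⟩, L.psi_c, N.phi_c, fun x Y g g' => L.harm g g',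
    fun x Y g g' => N.harm' (by linarith) (by have := a3 x; linarith), fun x => by rw [L.psi0, a1], L.psiH, fun x => ?_, fun x => ?_, fun x => ?_, a10, ?_, ?_, fun δ hδ => ?_, fun δ hδ => ?_⟩
  · rw [Bore.Lay.phi, ← a3 x, N.psiH, neg_zero]
  · rw [Bore.Lay.phi, sub_self, N.psi0, a2, show D.P.b = 1 - D.P.a by linarith]; ring
  · have s1 := L.speed x
    have s2 := N.speed x
    have u1 : pdx L.psi (x, L.H x) ^ 2 + pdy L.psi (x, L.H x) ^ 2 = _ := s1
    have u2 : pdx N.phi (x, L.H x) ^ 2 + pdy N.phi (x, L.H x) ^ 2 = N.R x ^ 2 / (N.H x ^ 2 * (1 + N.T x ^ 2)) := by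
      rw [pdx, pdy, N.phix, N.phiy, ← a3 x, neg_sq]; exact s2
    have := L.hH x
    have := N.hH x
    rw [u1, u2, a4, neg_sq]
    have p : (0:ℝ) < 1 + L.T x ^ 2 := by positivity
    have a9 := a9 x
    field_simp
    linear_combination a9
  · have := a5.sub_const (D.P.a + ε); rwa [sub_self] at this
  · have := a6.sub_const (D.P.a + ε); rwa [sub_add_cancel_left] at this
  · exact L.lim3 ka a1.symm a5 (a7.mono_left atBot_le_cocompact) hδ
  · obtain ⟨X, hX⟩ := N.lim3 kb a2.symm m5 (a8.mono_left atBot_le_cocompact) hδ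
    refine ⟨X, fun x hx Y g g' => ?_⟩
    have := hX x hx (1 - Y) (by linarith) (by have := a3 x; linarith)
    rw [pdx, pdy, N.phix, N.phiy, abs_neg]
    exact this
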